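/- Let 1 < p, q < ∞ satisfy 1/(2p) < 1/q ≤ 1/p and 1/q > 3/p − 1. Let I ⊂ ℝ be a bounded open interval containing 0 and let φ ∈ C^∞(I, ℝ) satisfy φ(0) ≠ 0 and φ′(0) ≠ 0. Then there exists ε₀ > 0 such that for every cutoff η ∈ C₀^∞(ℝ) supported in [−ε₀, ε₀] there exists a constant C = C(p, q, φ, η) with ‖Mf‖_{L^q(ℝ²)} ≤ C ‖f‖_{L^p(ℝ²)} for all f ∈ C₀^∞(ℝ²). -/

import Mathlib

open MeasureTheory Set
open scoped ENNReal

/-- The maximal operator along the curve `(x, x² φ(x))` with nonisotropic dilations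
`(t, t²)`, with supremum over `t ∈ [1,2]`:
`M f (y) = sup_{t ∈ [1,2]} |∫ f(y₁ - t x, y₂ - t² x² φ(x)) η(x) dx|`. -/
noncomputable def maxOpCurve (φ η : ℝ → ℝ) (f : ℝ × ℝ → ℝ) (y : ℝ × ℝ) : ℝ :=
  ⨆ t : Set.Icc (1 : ℝ) 2,
    |∫ x : ℝ, f (y.1 - t * x, y.2 - t ^ 2 * x ^ 2 * φ x) * η x|

/-- A pair-difference function with its two derivatives on `[0,c0]`. -/
structure PairFn (c0 : ℝ) (h h1 h2 : ℝ → ℝ) (D : ℝ) : Prop where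
  hc0 : 0 < c0
  hc1 : c0 ≤ 1 / 16
  d0 : ∀ x ∈ Icc 0 c0, HasDerivAt h (h1 x) x
  d1 : ∀ x ∈ Icc 0 c0, HasDerivAt h1 (h2 x) x
  hD : D = |h 0| + |h1 0| + |h2 0|
  p2 : ∀ x ∈ Icc 0 c0, |h2 x - h2 0| ≤ D / 16

/-- mean value inequality on an interval. -/
lemma mvt_abs {c0 : ℝ} {f f' : ℝ → ℝ} (hd : ∀ x ∈ Icc 0 c0, HasDerivAt f (f' x) x) {C : ℝ}
    (hC : ∀ x ∈ Icc 0 c0, |f' x| ≤ C) {x y : ℝ} (hx : x ∈ Icc 0 c0) (hy : y ∈ Icc 0 c0) :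
    |f x - f y| ≤ C * |x - y| := by
  have := (convex_Icc 0 c0).norm_image_sub_le_of_norm_hasDerivWithin_le
    (f := f) (f' := f') (C := C) (fun z hz => (hd z hz).hasDerivWithinAt) (fun z hz => hC z hz) hy hx
  simpa using this

/-- existence form of the mean value theorem. -/
lemma mvt_exists {c0 : ℝ} {f f' : ℝ → ℝ} (hd : ∀ x ∈ Icc 0 c0, HasDerivAt f (f' x) x)
    {x y : ℝ} (hx : x ∈ Icc 0 c0) (hy : y ∈ Icc 0 c0) (hxy : x < y) :
    ∃ z ∈ Ioo x y, f y - f x = f' z * (y - x) := by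
  have hsub : ∀ z ∈ Icc x y, z ∈ Icc 0 c0 := fun z hz => ⟨hx.1.trans hz.1, hz.2.trans hy.2⟩
  obtain ⟨z, hz, h⟩ := exists_hasDerivAt_eq_slope f f' hxy
    (fun z hz => (hd z (hsub z hz)).continuousAt.continuousWithinAt)
    (fun z hz => hd z (hsub z (Ioo_subset_Icc_self hz)))
  refine ⟨z, hz, ?_⟩
  rw [h]; field_simp [sub_ne_zero.2 hxy.ne']

lemma mono_of_deriv {c0 : ℝ} {f f' : ℝ → ℝ} (hd : ∀ x ∈ Icc 0 c0, HasDerivAt f (f' x) x) {m : ℝ}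
    (hm : ∀ x ∈ Icc 0 c0, m ≤ f' x) {x y : ℝ} (hx : x ∈ Icc 0 c0) (hy : y ∈ Icc 0 c0)
    (hxy : x ≤ y) : m * (y - x) ≤ f y - f x := by
  rcases hxy.eq_or_lt with rfl | hlt
  · simp
  · obtain ⟨z, hz, h⟩ := mvt_exists hd hx hy hlt
    rw [h]
    have hz' : z ∈ Icc 0 c0 := ⟨hx.1.trans hz.1.le, hz.2.le.trans hy.2⟩
    exact mul_le_mul_of_nonneg_right (hm z hz') (by linarith)

/-- Second order Taylor lower bound. -/
lemma taylor2_lower {c0 : ℝ} {h h1 h2 : ℝ → ℝ} (d0 : ∀ x ∈ Icc 0 c0, HasDerivAt h (h1 x) x)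
    (d1 : ∀ x ∈ Icc 0 c0, HasDerivAt h1 (h2 x) x) {m : ℝ} (hm : ∀ x ∈ Icc 0 c0, m ≤ h2 x)
    {x z : ℝ} (hx : x ∈ Icc 0 c0) (hz : z ∈ Icc 0 c0) :
    h x + h1 x * (z - x) + m / 2 * (z - x) ^ 2 ≤ h z := by
  set ψ : ℝ → ℝ := fun t => h t - h1 x * (t - x) - m / 2 * (t - x) ^ 2 with hψ
  have hdψ : ∀ t ∈ Icc 0 c0, HasDerivAt ψ (h1 t - h1 x - m * (t - x)) t := by
    intro t ht
    have e1 : HasDerivAt (fun t : ℝ => h1 x * (t - x)) (h1 x) t := by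
      simpa using ((hasDerivAt_id t).sub_const x).const_mul (h1 x)
    have e2 : HasDerivAt (fun t : ℝ => m / 2 * (t - x) ^ 2) (m * (t - x)) t := by
      have := (((hasDerivAt_id t).sub_const x).pow 2).const_mul (m / 2)
      have e : m / 2 * (((2:ℕ):ℝ) * (id t - x) ^ (2 - 1) * 1) = m * (t - x) := by
        simp only [id]; norm_num; ring
      rw [e] at this; exact this
    exact ((d0 t ht).sub e1).sub e2
  have hx0 : ψ x = h x := by simp [hψ]
  have key : h x ≤ ψ z := by
    rw [← hx0]
    rcases lt_trichotomy x z with hlt | rfl | hlt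
    · obtain ⟨t, ht, e⟩ := mvt_exists hdψ hx hz hlt
      have ht' : t ∈ Icc 0 c0 := ⟨hx.1.trans ht.1.le, ht.2.le.trans hz.2⟩
      have := mono_of_deriv d1 hm hx ht' ht.1.le
      have : 0 ≤ (h1 t - h1 x - m * (t - x)) * (z - x) :=
        mul_nonneg (by linarith) (by linarith)
      linarith
    · exact le_rfl
    · obtain ⟨t, ht, e⟩ := mvt_exists hdψ hz hx hlt
      have ht' : t ∈ Icc 0 c0 := ⟨hz.1.trans ht.1.le, ht.2.le.trans hx.2⟩
      have := mono_of_deriv d1 hm ht' hx ht.2.le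
      have : 0 ≤ -(h1 t - h1 x - m * (t - x)) * (x - z) :=
        mul_nonneg (by linarith) (by linarith)
      linarith
  simp only [hψ] at key
  linarith

namespace PairFn
variable {c0 D : ℝ} {h h1 h2 : ℝ → ℝ}

lemma neg (P : PairFn c0 h h1 h2 D) :
    PairFn c0 (fun x => - h x) (fun x => - h1 x) (fun x => - h2 x) D where
  hc0 := P.hc0
  hc1 := P.hc1
  d0 := fun x hx => (P.d0 x hx).fun_neg
  d1 := fun x hx => (P.d1 x hx).fun_neg
  hD := by simp only [abs_neg]; exact P.hD
  p2 := fun x hx => by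
    have := P.p2 x hx
    rwa [neg_sub_neg, abs_sub_comm]

lemma D_nonneg (P : PairFn c0 h h1 h2 D) : 0 ≤ D := by rw [P.hD]; positivity

lemma zero_mem (P : PairFn c0 h h1 h2 D) : (0 : ℝ) ∈ Icc 0 c0 := ⟨le_rfl, P.hc0.le⟩

lemma h2_le (P : PairFn c0 h h1 h2 D) {x : ℝ} (hx : x ∈ Icc 0 c0) : |h2 x| ≤ 17 / 16 * D := by
  have a := P.p2 x hx
  have b := P.hD
  have c := abs_nonneg (h 0)
  have d := abs_nonneg (h1 0)
  have : |h2 x| ≤ |h2 x - h2 0| + |h2 0| := by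
    have := abs_add_le (h2 x - h2 0) (h2 0); simpa using this
  linarith

lemma h1_diff (P : PairFn c0 h h1 h2 D) {x y : ℝ} (hx : x ∈ Icc 0 c0) (hy : y ∈ Icc 0 c0) :
    |h1 x - h1 y| ≤ 17 / 16 * D * |x - y| :=
  mvt_abs P.d1 (fun _ hz => P.h2_le hz) hx hy

lemma h1_le (P : PairFn c0 h h1 h2 D) {x : ℝ} (hx : x ∈ Icc 0 c0) : |h1 x| ≤ 17 / 16 * D := by
  have a := P.h1_diff hx P.zero_mem
  have hb : |x - 0| ≤ 1 / 16 := by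
    rw [sub_zero, abs_of_nonneg hx.1]; exact hx.2.trans P.hc1
  have hD := P.D_nonneg
  have a' : |h1 x - h1 0| ≤ 17 / 16 * D * (1 / 16) :=
    a.trans (mul_le_mul_of_nonneg_left hb (by linarith))
  have b := P.p2 x hx
  have e := P.hD
  have c := abs_nonneg (h 0)
  have d := abs_nonneg (h2 0)
  have : |h1 x| ≤ |h1 x - h1 0| + |h1 0| := by
    have := abs_add_le (h1 x - h1 0) (h1 0); simpa using this
  -- crude bound: D + 17/256 D
  have h17 : 17 / 16 * D * (1 / 16) = 17 / 256 * D := by ring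
  by_cases hh : |h1 0| ≤ D * (255/256)
  · linarith
  · -- then `h2 0` is small
    push Not at hh
    have h20 : |h2 0| ≤ D / 256 := by linarith
    have : ∀ z ∈ Icc 0 c0, |h2 z| ≤ D / 4 := by
      intro z hz
      have := P.p2 z hz
      have h3 : |h2 z| ≤ |h2 z - h2 0| + |h2 0| := by
        have := abs_add_le (h2 z - h2 0) (h2 0); simpa using this
      linarith
    have a2 := mvt_abs P.d1 this hx P.zero_mem
    have : |h1 x - h1 0| ≤ D / 4 * (1 / 16) :=
      a2.trans (mul_le_mul_of_nonneg_left hb (by linarith))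
    linarith

lemma h_diff (P : PairFn c0 h h1 h2 D) {x y : ℝ} (hx : x ∈ Icc 0 c0) (hy : y ∈ Icc 0 c0) :
    |h x - h y| ≤ 17 / 16 * D * |x - y| :=
  mvt_abs P.d0 (fun _ hz => P.h1_le hz) hx hy

lemma jet_lower (P : PairFn c0 h h1 h2 D) {x : ℝ} (hx : x ∈ Icc 0 c0) :
    D / 2 ≤ |h x| + |h1 x| + |h2 x| := by
  have hb : |x - 0| ≤ 1 / 16 := by
    rw [sub_zero, abs_of_nonneg hx.1]; exact hx.2.trans P.hc1
  have hD := P.D_nonneg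
  have a : |h1 x - h1 0| ≤ 17 / 16 * D * (1 / 16) :=
    (P.h1_diff hx P.zero_mem).trans (mul_le_mul_of_nonneg_left hb (by linarith))
  have b : |h x - h 0| ≤ 17 / 16 * D * (1 / 16) :=
    (P.h_diff hx P.zero_mem).trans (mul_le_mul_of_nonneg_left hb (by linarith))
  have c := P.p2 x hx
  have e := P.hD
  have t1 : |h 0| - |h x| ≤ |h x - h 0| := by
    rw [abs_sub_comm]; exact abs_sub_abs_le_abs_sub _ _
  have t2 : |h1 0| - |h1 x| ≤ |h1 x - h1 0| := by
    rw [abs_sub_comm]; exact abs_sub_abs_le_abs_sub _ _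
  have t3 : |h2 0| - |h2 x| ≤ |h2 x - h2 0| := by
    rw [abs_sub_comm]; exact abs_sub_abs_le_abs_sub _ _
  nlinarith

/-- second derivative differences. -/
lemma h2_diff (P : PairFn c0 h h1 h2 D) {x y : ℝ} (hx : x ∈ Icc 0 c0) (hy : y ∈ Icc 0 c0) :
    |h2 x - h2 y| ≤ D / 8 := by
  have a := P.p2 x hx
  have b := P.p2 y hy
  rw [abs_le] at *
  constructor <;> linarith [a.1, a.2, b.1, b.2]

/-- G1, the case of convex functions. -/
lemma inter_convex (P : PairFn c0 h h1 h2 D) {δ κ ρ : ℝ} (hκ : 0 < κ)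
    (hδ : 0 < δ) (hρ : ρ / 2 ≤ D) (hρ0 : 0 < ρ) (hpos : ∀ z ∈ Icc 0 c0, D / 16 ≤ h2 z)
    {x y : ℝ} (hx : x ∈ Icc 0 c0) (hy : y ∈ Icc 0 c0) (hxy : x < y)
    (h0x : |h x| ≤ δ) (h0y : |h y| ≤ δ) (h1x : |h1 x| ≤ κ) (h1y : |h1 y| ≤ κ)
    (hsgn : 0 ≤ h1 x * h1 y)
    (hk : κ ^ 2 ≤ 4 * δ * ρ ∨ (κ / 2 ≤ |h1 x| ∧ κ / 2 ≤ |h1 y|)) :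
    y - x ≤ 256 * δ / κ := by
  have hmono := mono_of_deriv P.d1 hpos hx hy hxy.le
  rw [le_div_iff₀ hκ]
  rcases hk with hk | ⟨hk1, hk2⟩
  · -- D/16 (y-x) ≤ 2 κ
    have : D / 16 * (y - x) ≤ 2 * κ := by
      have := abs_le.1 h1x; have := abs_le.1 h1y; linarith
    have h2 : ρ / 32 * (y - x) ≤ 2 * κ := by
      refine le_trans ?_ this
      exact mul_le_mul_of_nonneg_right (by linarith) (by linarith)
    -- multiply by κ
    have h3 : ρ * ((y - x) * κ) ≤ ρ * (256 * δ) := by nlinarith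
    exact le_of_mul_le_mul_left h3 hρ0
  · obtain ⟨z, hz, e⟩ := mvt_exists P.d0 hx hy hxy
    have hz' : z ∈ Icc 0 c0 := ⟨hx.1.trans hz.1.le, hz.2.le.trans hy.2⟩
    have m1 := mono_of_deriv P.d1 hpos hx hz' hz.1.le
    have m2 := mono_of_deriv P.d1 hpos hz' hy hz.2.le
    have hD := P.D_nonneg
    have m1' : h1 x ≤ h1 z := by
      have : 0 ≤ D / 16 * (z - x) := mul_nonneg (by linarith) (by linarith [hz.1])
      linarith
    have m2' : h1 z ≤ h1 y := by
      have : 0 ≤ D / 16 * (y - z) := mul_nonneg (by linarith) (by linarith [hz.2])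
      linarith
    have hkz : κ / 2 ≤ |h1 z| := by
      rcases le_or_gt 0 (h1 x) with hp | hn
      · rw [abs_of_nonneg hp] at hk1
        exact (hk1.trans m1').trans (le_abs_self _)
      · have hy' : h1 y ≤ 0 := by
          by_contra hc; push Not at hc; nlinarith
        rw [abs_of_nonpos hy'] at hk2
        have := neg_le_abs (h1 z)
        linarith
    have : |h y - h x| ≤ 2 * δ := by
      have := abs_le.1 h0x; have := abs_le.1 h0y; rw [abs_le]; constructor <;> linarith
    rw [e, abs_mul, abs_of_pos (sub_pos.2 hxy)] at this
    have : κ / 2 * (y - x) ≤ 2 * δ :=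
      (mul_le_mul_of_nonneg_right hkz (by linarith)).trans this
    nlinarith

/-- G1: two intersection points of the same type are close. -/
lemma inter (P : PairFn c0 h h1 h2 D) {δ κ ρ : ℝ} (hκ : 0 < κ) (hκρ : κ ≤ 4 * ρ)
    (hδ : 0 < δ) (hDδ : 8 * δ ≤ D) (hρ : ρ / 2 ≤ D)
    {x y : ℝ} (hx : x ∈ Icc 0 c0) (hy : y ∈ Icc 0 c0) (hxy : x < y)
    (h0x : |h x| ≤ δ) (h0y : |h y| ≤ δ) (h1x : |h1 x| ≤ κ) (h1y : |h1 y| ≤ κ)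
    (hsgn : 0 ≤ h1 x * h1 y)
    (hk : κ ^ 2 ≤ 4 * δ * ρ ∨ (κ / 2 ≤ |h1 x| ∧ κ / 2 ≤ |h1 y|)) :
    y - x ≤ 256 * δ / κ := by
  have hρ0 : 0 < ρ := by linarith
  by_cases hc : D / 8 ≤ |h2 0|
  · rcases le_or_gt 0 (h2 0) with hp | hn
    · refine P.inter_convex hκ hδ hρ hρ0 ?_ hx hy hxy h0x h0y h1x h1y hsgn hk
      intro z hz
      rw [abs_of_nonneg hp] at hc
      have := (abs_le.1 (P.p2 z hz)).1
      linarith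
    · refine P.neg.inter_convex hκ hδ hρ hρ0 ?_ hx hy hxy (by simpa) (by simpa) (by simpa)
        (by simpa) (by simpa) (by simpa)
      intro z hz
      rw [abs_of_neg hn] at hc
      have := (abs_le.1 (P.p2 z hz)).2
      linarith
  · push Not at hc
    have hs : ∀ z ∈ Icc 0 c0, |h2 z| ≤ 3 / 16 * D := by
      intro z hz
      have := P.p2 z hz
      have h3 : |h2 z| ≤ |h2 z - h2 0| + |h2 0| := by
        have := abs_add_le (h2 z - h2 0) (h2 0); simpa using this
      linarith
    have hj := P.jet_lower hx
    have h1x' : D * (3 / 16) ≤ |h1 x| := by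
      have := hs x hx
      linarith
    obtain ⟨z, hz, e⟩ := mvt_exists P.d0 hx hy hxy
    have hz' : z ∈ Icc 0 c0 := ⟨hx.1.trans hz.1.le, hz.2.le.trans hy.2⟩
    have a2 := mvt_abs P.d1 hs hx hz'
    have hb : |x - z| ≤ 1 / 16 := by
      rw [abs_le]; constructor <;> linarith [hx.1, hx.2, hz'.1, hz'.2, P.hc1]
    have hD := P.D_nonneg
    have a3 : |h1 x - h1 z| ≤ 3 / 16 * D * (1 / 16) :=
      a2.trans (mul_le_mul_of_nonneg_left hb (by linarith))
    have a4 : D / 8 ≤ |h1 z| := by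
      have := abs_sub_abs_le_abs_sub (h1 x) (h1 z)
      linarith
    have : |h y - h x| ≤ 2 * δ := by
      have := abs_le.1 h0x; have := abs_le.1 h0y; rw [abs_le]; constructor <;> linarith
    rw [e, abs_mul, abs_of_pos (sub_pos.2 hxy)] at this
    have h5 : D / 8 * (y - x) ≤ 2 * δ :=
      (mul_le_mul_of_nonneg_right a4 (by linarith)).trans this
    rw [le_div_iff₀ hκ]
    have h6 : (y - x) * κ ≤ (y - x) * (8 * D) :=
      mul_le_mul_of_nonneg_left (by linarith) (by linarith)
    nlinarith

/-- near tangency: convexity and lower bound -/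
lemma tangent_sign (P : PairFn c0 h h1 h2 D) {δ κ ρ : ℝ}
    (hDδ : 8 * δ ≤ D) (hρ : ρ / 2 ≤ D) (hκρ : κ ≤ ρ / 16)
    {x : ℝ} (hx : x ∈ Icc 0 c0) (h0x : |h x| ≤ δ) (h1x : |h1 x| ≤ κ) : D / 4 ≤ |h2 x| := by
  have := P.jet_lower hx
  linarith

lemma tangent_lower (P : PairFn c0 h h1 h2 D) {δ κ ρ τ : ℝ} (hρ0 : 0 < ρ)
    (hDδ : 8 * δ ≤ D) (hρ : ρ / 2 ≤ D) (hκρ : κ ≤ ρ / 16) (hτ : κ ^ 2 ≤ τ * ρ) (hδτ : δ ≤ τ)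
    {x : ℝ} (hx : x ∈ Icc 0 c0) (h0x : |h x| ≤ δ) (h1x : |h1 x| ≤ κ) (hs : 0 < h2 x)
    {z : ℝ} (hz : z ∈ Icc 0 c0) : -(9 * τ) ≤ h z := by
  have hq := P.tangent_sign hDδ hρ hκρ hx h0x h1x
  rw [abs_of_pos hs] at hq
  have hm : ∀ t ∈ Icc 0 c0, D / 8 ≤ h2 t := by
    intro t ht
    have := (abs_le.1 (P.h2_diff hx ht)).2
    linarith
  have T := taylor2_lower P.d0 P.d1 hm hx hz
  have a := (abs_le.1 h0x).1
  set e := z - x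
  -- h1 x * e ≥ -κ|e|; κ|e| ≤ D/16 e² + 4κ²/D
  have b : -(κ * |e|) ≤ h1 x * e := by
    have : |h1 x * e| ≤ κ * |e| := by
      rw [abs_mul]; exact mul_le_mul_of_nonneg_right h1x (abs_nonneg _)
    exact (abs_le.1 this).1
  have c : κ * |e| ≤ ρ / 32 * |e| ^ 2 + 8 * τ := by
    have h1 : 0 ≤ (ρ * |e| - 16 * κ) ^ 2 := sq_nonneg _
    have h2 : ρ * (κ * |e|) ≤ ρ * (ρ / 32 * |e| ^ 2 + 8 * τ) := by nlinarith
    exact le_of_mul_le_mul_left h2 hρ0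
  have d : ρ / 32 * |e| ^ 2 ≤ D / 8 / 2 * e ^ 2 := by
    rw [sq_abs]; exact mul_le_mul_of_nonneg_right (by linarith) (sq_nonneg _)
  linarith

/-- three almost-zeros, sorted -/
lemma three_sorted (P : PairFn c0 h h1 h2 D) {T t : ℝ} (ht : 0 < t)
    {z1 z2 z3 : ℝ} (m1 : z1 ∈ Icc 0 c0) (m2 : z2 ∈ Icc 0 c0) (m3 : z3 ∈ Icc 0 c0)
    (h12 : t ≤ z2 - z1) (h23 : t ≤ z3 - z2)
    (g1 : |h z1| ≤ T) (g2 : |h z2| ≤ T) (g3 : |h z3| ≤ T) : D ≤ 64 * T / t ^ 2 := by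
  have hT : 0 ≤ T := (abs_nonneg _).trans g1
  have hD := P.D_nonneg
  have ht1 : t ≤ 1 / 16 := by linarith [m1.1, m2.2, P.hc1]
  -- convex claim
  have conv : ∀ {h h1 h2 : ℝ → ℝ}, PairFn c0 h h1 h2 D → |h z1| ≤ T → |h z2| ≤ T → |h z3| ≤ T →
      D / 8 ≤ h2 0 → D ≤ 64 * T / t ^ 2 := by
    intro h h1 h2 P g1 g2 g3 hc
    have hm : ∀ t ∈ Icc 0 c0, D / 16 ≤ h2 t := by
      intro t ht
      have := (abs_le.1 (P.p2 t ht)).1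
      linarith
    have A := taylor2_lower P.d0 P.d1 hm m2 m1
    have B := taylor2_lower P.d0 P.d1 hm m2 m3
    set a := z2 - z1
    set b := z3 - z2
    have ea : z1 - z2 = -a := by simp [a]
    rw [ea] at A
    have a0 : 0 < a := by linarith
    have b0 : 0 < b := by linarith
    have g1' := (abs_le.1 g1).2
    have g2' := (abs_le.1 g2).1
    have g3' := (abs_le.1 g3).2
    -- b*A + a*B
    have S1 : b * (h z2 + h1 z2 * -a + D / 16 / 2 * (-a) ^ 2) ≤ b * T :=
      mul_le_mul_of_nonneg_left (A.trans g1') b0.le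
    have S2 : a * (h z2 + h1 z2 * b + D / 16 / 2 * b ^ 2) ≤ a * T :=
      mul_le_mul_of_nonneg_left (B.trans g3') a0.le
    have S3 : (a + b) * (-T) ≤ (a + b) * h z2 := mul_le_mul_of_nonneg_left g2' (by linarith)
    have S4 : (a + b) * (D / 32 * (a * b)) ≤ (a + b) * (2 * T) := by nlinarith
    have S5 : D / 32 * (a * b) ≤ 2 * T := le_of_mul_le_mul_left S4 (by linarith)
    have S6 : t ^ 2 ≤ a * b := by
      rw [sq]; exact mul_le_mul h12 h23 ht.le a0.le
    rw [le_div_iff₀ (by positivity)]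
    have : D * t ^ 2 ≤ D * (a * b) := mul_le_mul_of_nonneg_left S6 hD
    linarith
  by_cases hc : D / 8 ≤ |h2 0|
  · rcases le_or_gt 0 (h2 0) with hp | hn
    · rw [abs_of_nonneg hp] at hc
      exact conv P g1 g2 g3 hc
    · rw [abs_of_neg hn] at hc
      exact conv P.neg (by simpa) (by simpa) (by simpa) hc
  · push Not at hc
    have hs : ∀ z ∈ Icc 0 c0, |h2 z| ≤ 3 / 16 * D := by
      intro z hz
      have := P.p2 z hz
      have h3 : |h2 z| ≤ |h2 z - h2 0| + |h2 0| := by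
        have := abs_add_le (h2 z - h2 0) (h2 0); simpa using this
      linarith
    have hj := P.jet_lower m1
    obtain ⟨z, hz, e⟩ := mvt_exists P.d0 m1 m2 (by linarith)
    have hz' : z ∈ Icc 0 c0 := ⟨m1.1.trans hz.1.le, hz.2.le.trans m2.2⟩
    have a2 := mvt_abs P.d1 hs m1 hz'
    have hb : |z1 - z| ≤ 1 / 16 := by
      rw [abs_le]; constructor <;> linarith [m1.1, m1.2, hz'.1, hz'.2, P.hc1]
    have a3 : |h1 z1 - h1 z| ≤ 3 / 16 * D * (1 / 16) :=
      a2.trans (mul_le_mul_of_nonneg_left hb (by linarith))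
    have : |h z2 - h z1| ≤ 2 * T := by
      have := abs_le.1 g1; have := abs_le.1 g2; rw [abs_le]; constructor <;> linarith
    rw [e, abs_mul, abs_of_pos (by linarith : 0 < z2 - z1)] at this
    have h5 : |h1 z| * t ≤ 2 * T :=
      (mul_le_mul_of_nonneg_left h12 (abs_nonneg _)).trans this
    have h6 := abs_sub_abs_le_abs_sub (h1 z1) (h1 z)
    have h7 := hs z1 m1
    have h8 : D * (1/4) ≤ T + |h1 z| := by linarith
    have h9 : D * (1/4) * t ≤ T * t + 2 * T := by nlinarith
    rw [le_div_iff₀ (by positivity)]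
    nlinarith

lemma three (P : PairFn c0 h h1 h2 D) {T t : ℝ} (ht : 0 < t)
    {z1 z2 z3 : ℝ} (m1 : z1 ∈ Icc 0 c0) (m2 : z2 ∈ Icc 0 c0) (m3 : z3 ∈ Icc 0 c0)
    (h12 : t ≤ |z1 - z2|) (h23 : t ≤ |z2 - z3|) (h13 : t ≤ |z1 - z3|)
    (g1 : |h z1| ≤ T) (g2 : |h z2| ≤ T) (g3 : |h z3| ≤ T) : D ≤ 64 * T / t ^ 2 := by
  rcases le_abs.1 h12 with a | a <;> rcases le_abs.1 h23 with b | b <;>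
    rcases le_abs.1 h13 with c | c
  · exact P.three_sorted ht m3 m2 m1 (by linarith) (by linarith) g3 g2 g1
  · linarith
  · exact P.three_sorted ht m2 m3 m1 (by linarith) (by linarith) g2 g3 g1
  · exact P.three_sorted ht m2 m1 m3 (by linarith) (by linarith) g2 g1 g3
  · exact P.three_sorted ht m3 m1 m2 (by linarith) (by linarith) g3 g1 g2
  · exact P.three_sorted ht m1 m3 m2 (by linarith) (by linarith) g1 g3 g2
  · linarith
  · exact P.three_sorted ht m1 m2 m3 (by linarith) (by linarith) g1 g2 g3

/-- derivative bound from two almost zeros -/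
lemma deriv_small (P : PairFn c0 h h1 h2 D) {T t l : ℝ} (ht : 0 < t)
    {z1 z2 : ℝ} (m1 : z1 ∈ Icc 0 c0) (m2 : z2 ∈ Icc 0 c0)
    (h12 : t ≤ |z1 - z2|) (hl : |z1 - z2| ≤ l) (hD : D ≤ 64 * T / t ^ 2)
    (g1 : |h z1| ≤ T) (g2 : |h z2| ≤ T) : |h1 z1| ≤ 70 * T * l / t ^ 2 := by
  have hT : 0 ≤ T := (abs_nonneg _).trans g1
  -- there is a point z between with |h1 z| ≤ 2 T / t
  obtain ⟨z, hz, hzl, hz1⟩ : ∃ z ∈ Icc 0 c0, |z1 - z| ≤ l ∧ |h1 z| * t ≤ 2 * T := by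
    have hh : |h z2 - h z1| ≤ 2 * T := by
      have := abs_le.1 g1; have := abs_le.1 g2; rw [abs_le]; constructor <;> linarith
    rcases lt_trichotomy z1 z2 with hlt | heq | hlt
    · obtain ⟨z, hz, e⟩ := mvt_exists P.d0 m1 m2 hlt
      refine ⟨z, ⟨m1.1.trans hz.1.le, hz.2.le.trans m2.2⟩, ?_, ?_⟩
      · refine le_trans ?_ hl
        rw [abs_sub_comm z1, abs_sub_comm z1, abs_of_pos (sub_pos.2 hz.1), abs_of_pos (sub_pos.2 hlt)]
        linarith [hz.2]
      · rw [e, abs_mul, abs_sub_comm z2] at hh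
        exact (mul_le_mul_of_nonneg_left h12 (abs_nonneg _)).trans hh
    · rw [heq] at h12; simp at h12; linarith
    · obtain ⟨z, hz, e⟩ := mvt_exists P.d0 m2 m1 hlt
      refine ⟨z, ⟨m2.1.trans hz.1.le, hz.2.le.trans m1.2⟩, ?_, ?_⟩
      · refine le_trans ?_ hl
        rw [abs_of_pos (sub_pos.2 hz.2), abs_of_pos (sub_pos.2 hlt)]
        linarith [hz.1]
      · rw [abs_sub_comm, e, abs_mul] at hh
        exact (mul_le_mul_of_nonneg_left h12 (abs_nonneg _)).trans hh
  have hd := P.h1_diff m1 hz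
  have htl : t ≤ l := h12.trans hl
  have l0 : 0 < l := by linarith
  have e1 : |h1 z1 - h1 z| ≤ 17 / 16 * (64 * T / t ^ 2) * l :=
    hd.trans (mul_le_mul (by linarith) hzl (abs_nonneg _) (by positivity))
  have e2 : |h1 z1| - |h1 z| ≤ |h1 z1 - h1 z| := abs_sub_abs_le_abs_sub _ _
  have e3 : |h1 z| ≤ 2 * T * l / t ^ 2 := by
    rw [le_div_iff₀ (by positivity)]
    have : |h1 z| * t * t ≤ 2 * T * l := mul_le_mul hz1 htl ht.le (by linarith)
    linarith
  have e4 : 17 / 16 * (64 * T / t ^ 2) * l = 68 * T * l / t ^ 2 := by ring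
  have e5 : 70 * T * l / t ^ 2 = 68 * T * l / t ^ 2 + 2 * T * l / t ^ 2 := by ring
  linarith

end PairFn

/-- A finite set of integers of diameter at most `P` has at most `P+1` elements. -/
lemma card_int_diam (S : Finset ℤ) {P : ℝ} (hP : 0 ≤ P)
    (h : ∀ a ∈ S, ∀ b ∈ S, (b : ℝ) - a ≤ P) : (S.card : ℝ) ≤ P + 1 := by
  rcases S.eq_empty_or_nonempty with rfl | hne
  · simp; linarith
  · set m := S.min' hne
    set M := S.max' hne
    have hsub : S ⊆ Finset.Icc m M := fun x hx =>
      Finset.mem_Icc.2 ⟨S.min'_le x hx, S.le_max' x hx⟩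
    have h1 := Finset.card_le_card hsub
    rw [Int.card_Icc] at h1
    have h2 := h m (S.min'_mem hne) M (S.max'_mem hne)
    have hmM : m ≤ M := S.min'_le M (S.max'_mem hne)
    have h3 : (((M + 1 - m).toNat : ℕ) : ℝ) = (M : ℝ) + 1 - m := by
      have : (((M + 1 - m).toNat : ℕ) : ℤ) = M + 1 - m := Int.toNat_of_nonneg (by linarith)
      exact_mod_cast this
    have h4 : (S.card : ℝ) ≤ ((M + 1 - m).toNat : ℕ) := by exact_mod_cast h1
    rw [h3] at h4
    linarith

/-- counting points in a box. -/
lemma card_box (S : Finset (ℤ × ℤ)) {P Q : ℝ} (hP : 0 ≤ P) (hQ : 0 ≤ Q)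
    (h1 : ∀ a ∈ S, ∀ b ∈ S, (b.1 : ℝ) - a.1 ≤ P)
    (h2 : ∀ a ∈ S, ∀ b ∈ S, a.1 = b.1 → (b.2 : ℝ) - a.2 ≤ Q) :
    (S.card : ℝ) ≤ (P + 1) * (Q + 1) := by
  classical
  have hI : ((S.image Prod.fst).card : ℝ) ≤ P + 1 := by
    apply card_int_diam _ hP
    intro a ha b hb
    obtain ⟨a', ha', rfl⟩ := Finset.mem_image.1 ha
    obtain ⟨b', hb', rfl⟩ := Finset.mem_image.1 hb
    exact h1 a' ha' b' hb'
  have hF : ∀ x ∈ S.image Prod.fst, ((S.filter (fun k => k.1 = x)).card : ℝ) ≤ Q + 1 := by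
    intro x _
    have : (S.filter (fun k => k.1 = x)).card
        = ((S.filter (fun k => k.1 = x)).image Prod.snd).card := by
      rw [Finset.card_image_of_injOn]
      intro a ha b hb hab
      rw [Finset.mem_coe, Finset.mem_filter] at ha hb
      exact Prod.ext (ha.2.trans hb.2.symm) hab
    rw [this]
    apply card_int_diam _ hQ
    intro a ha b hb
    obtain ⟨a', ha', rfl⟩ := Finset.mem_image.1 ha
    obtain ⟨b', hb', rfl⟩ := Finset.mem_image.1 hb
    simp only [Finset.mem_filter] at ha' hb'
    exact h2 a' ha'.1 b' hb'.1 (ha'.2.trans hb'.2.symm)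
  have := Finset.card_eq_sum_card_image Prod.fst S
  rw [this]
  push_cast
  calc ∑ b ∈ S.image Prod.fst, ((S.filter (fun k => k.1 = b)).card : ℝ)
      ≤ ∑ b ∈ S.image Prod.fst, (Q + 1) := Finset.sum_le_sum hF
    _ = ((S.image Prod.fst).card : ℝ) * (Q + 1) := by rw [Finset.sum_const, nsmul_eq_mul]
    _ ≤ _ := by gcongr

/-- weighted pigeonhole. -/
lemma weighted_pigeon {ι τ : Type*} [DecidableEq τ] (S : Finset ι) (hS : S.Nonempty) (f : ι → τ)
    (w : τ → ℝ) (hw : ∀ T : Finset τ, ∑ t ∈ T, w t ≤ 1) :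
    ∃ t, w t * S.card ≤ (S.filter (fun i => f i = t)).card ∧
      (S.filter (fun i => f i = t)).Nonempty := by
  by_contra! hcon
  have hlt : ∀ t ∈ S.image f, ((S.filter (fun i => f i = t)).card : ℝ) < w t * S.card := by
    intro t ht
    by_contra! h
    have h1 := hcon t h
    obtain ⟨i, hi, rfl⟩ := Finset.mem_image.1 ht
    have : i ∈ S.filter (fun j => f j = f i) := by simp [hi]
    rw [h1] at this
    simp at this
  have h1 := Finset.card_eq_sum_card_image f S
  have h2 : (S.card : ℝ) < ∑ t ∈ S.image f, w t * S.card := by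
    conv_lhs => rw [h1]
    push_cast
    exact Finset.sum_lt_sum_of_nonempty (hS.image f) hlt
  rw [← Finset.sum_mul] at h2
  have := hw (S.image f)
  have h3 : (0 : ℝ) ≤ S.card := by positivity
  nlinarith

lemma geom_fin_le {θ : ℝ} (h0 : 0 ≤ θ) (h1 : θ < 1) (T : Finset ℕ) :
    ∑ n ∈ T, (1 - θ) * θ ^ n ≤ 1 := by
  rw [← Finset.mul_sum]
  have hs := summable_geometric_of_lt_one h0 h1
  have : ∑ n ∈ T, θ ^ n ≤ (1 - θ)⁻¹ := by
    rw [← tsum_geometric_of_lt_one h0 h1]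
    exact hs.sum_le_tsum T (fun i _ => by positivity)
  calc (1 - θ) * ∑ n ∈ T, θ ^ n ≤ (1 - θ) * (1 - θ)⁻¹ := by
        apply mul_le_mul_of_nonneg_left this; linarith
    _ = 1 := mul_inv_cancel₀ (by linarith)

lemma geom2_fin_le {θ : ℝ} (h0 : 0 ≤ θ) (h1 : θ < 1) (T : Finset (ℕ × ℕ)) :
    ∑ t ∈ T, (1 - θ) ^ 2 * θ ^ (t.1 + t.2) ≤ 1 := by
  classical
  have hnn : ∀ n : ℕ, 0 ≤ (1 - θ) * θ ^ n := fun n => mul_nonneg (by linarith) (by positivity)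
  have hsub : T ⊆ T.image Prod.fst ×ˢ T.image Prod.snd := by
    intro t ht
    exact Finset.mem_product.2 ⟨Finset.mem_image_of_mem _ ht, Finset.mem_image_of_mem _ ht⟩
  calc ∑ t ∈ T, (1 - θ) ^ 2 * θ ^ (t.1 + t.2)
      = ∑ t ∈ T, ((1 - θ) * θ ^ t.1) * ((1 - θ) * θ ^ t.2) := by
        apply Finset.sum_congr rfl; intro t _; ring
    _ ≤ ∑ t ∈ T.image Prod.fst ×ˢ T.image Prod.snd, ((1 - θ) * θ ^ t.1) * ((1 - θ) * θ ^ t.2) :=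
        Finset.sum_le_sum_of_subset_of_nonneg hsub
          (fun t _ _ => mul_nonneg (hnn _) (hnn _))
    _ = (∑ n ∈ T.image Prod.fst, (1 - θ) * θ ^ n) * (∑ n ∈ T.image Prod.snd, (1 - θ) * θ ^ n) := by
        rw [Finset.sum_product, Finset.sum_mul_sum]
    _ ≤ 1 * 1 := mul_le_mul (geom_fin_le h0 h1 _) (geom_fin_le h0 h1 _)
        (Finset.sum_nonneg (fun n _ => hnn n)) zero_le_one
    _ = 1 := one_mul 1

/-- dyadic scale of a positive number. -/
lemma exists_dyadic {x C : ℝ} (hx : 0 < x) (hxC : x ≤ C) :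
    ∃ n : ℕ, C * (1 / 2) ^ n / 2 < x ∧ x ≤ C * (1 / 2) ^ n := by
  have hC : 0 < C := hx.trans_le hxC
  obtain ⟨n, h1, h2⟩ := exists_nat_pow_near (x := C / x) (y := 2)
    (by rw [le_div_iff₀ hx]; linarith) (by norm_num)
  refine ⟨n, ?_, ?_⟩
  · rw [div_lt_iff₀ hx] at h2
    rw [one_div, inv_pow, ← div_eq_mul_inv, div_div, div_lt_iff₀ (by positivity)]
    rw [pow_succ] at h2; linarith
  · rw [le_div_iff₀ hx] at h1
    rw [one_div, inv_pow, ← div_eq_mul_inv, le_div_iff₀ (by positivity)]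
    linarith

/-- Double counting: a relation with at least `m` on one side and at most `M` on the other. -/
lemma double_count {ι κ : Type*} [DecidableEq ι] [DecidableEq κ] (S : Finset ι) (T : Finset κ)
    (R : ι → κ → Prop) [∀ i k, Decidable (R i k)]
    {m M : ℝ} (h1 : ∀ i ∈ S, m ≤ ((T.filter (fun k => R i k)).card : ℝ))
    (h2 : ∀ k ∈ T, ((S.filter (fun i => R i k)).card : ℝ) ≤ M) :
    (S.card : ℝ) * m ≤ T.card * M := by
  have h := Finset.sum_card_bipartiteAbove_eq_sum_card_bipartiteBelow (s := S) (t := T) R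
  calc (S.card : ℝ) * m = ∑ i ∈ S, m := by simp
    _ ≤ ∑ i ∈ S, ((T.filter (fun k => R i k)).card : ℝ) := Finset.sum_le_sum h1
    _ = ∑ k ∈ T, ((S.filter (fun i => R i k)).card : ℝ) := by
        have : (∑ a ∈ S, (T.filter (fun k => R a k)).card)
          = ∑ b ∈ T, (S.filter (fun i => R i b)).card := h
        exact_mod_cast this
    _ ≤ ∑ k ∈ T, M := Finset.sum_le_sum h2
    _ = _ := by simp

/-- jet distance at zero. -/
noncomputable def jetd (H0 H1 H2 : ℤ × ℤ → ℝ → ℝ) (k k' : ℤ × ℤ) : ℝ :=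
  |H0 k 0 - H0 k' 0| + |H1 k 0 - H1 k' 0| + |H2 k 0 - H2 k' 0|

/-- A family of curves (graphs over `[0,c0]`) indexed by grid points. -/
structure CurveFam (δ c0 C0 : ℝ) (Y : Finset (ℤ × ℤ)) (H0 H1 H2 : ℤ × ℤ → ℝ → ℝ) : Prop where
  hδ0 : 0 < δ
  hδ1 : δ ≤ 1 / 16
  hc0 : 0 < c0
  hc1 : c0 ≤ 1 / 16
  hC0 : 1 ≤ C0
  d0 : ∀ k ∈ Y, ∀ x ∈ Icc 0 c0, HasDerivAt (H0 k) (H1 k x) x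
  d1 : ∀ k ∈ Y, ∀ x ∈ Icc 0 c0, HasDerivAt (H1 k) (H2 k x) x
  p2 : ∀ k ∈ Y, ∀ k' ∈ Y, ∀ x ∈ Icc 0 c0,
    |(H2 k x - H2 k' x) - (H2 k 0 - H2 k' 0)| ≤ jetd H0 H1 H2 k k' / 16
  p4 : ∀ k ∈ Y, ∀ k' ∈ Y, k.1 = k'.1 → ∀ x ∈ Icc 0 c0,
    δ * |(k.2 : ℝ) - k'.2| ≤ C0 * (|H0 k x - H0 k' x| + |H1 k x - H1 k' x|)
  p5 : ∀ k ∈ Y, ∀ k' ∈ Y, δ * |(k.1 : ℝ) - k'.1| ≤ C0 * jetd H0 H1 H2 k k' ∧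
    δ * |(k.2 : ℝ) - k'.2| ≤ C0 * jetd H0 H1 H2 k k'
  p6 : ∀ k ∈ Y, ∀ k' ∈ Y, ∀ x ∈ Icc 0 c0, |H0 k x - H0 k' x| ≤ 1 → jetd H0 H1 H2 k k' ≤ C0

/-- row of the curve `k` in column `i`. -/
noncomputable def rowOf (δ : ℝ) (H0 : ℤ × ℤ → ℝ → ℝ) (k : ℤ × ℤ) (i : ℤ) : ℤ := ⌊H0 k (δ * i) / δ⌋

lemma rowOf_eq {δ : ℝ} (hδ : 0 < δ) {H0 : ℤ × ℤ → ℝ → ℝ} {k k' : ℤ × ℤ} {i : ℤ}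
    (h : rowOf δ H0 k i = rowOf δ H0 k' i) : |H0 k (δ * i) - H0 k' (δ * i)| ≤ δ := by
  have := Int.abs_sub_lt_one_of_floor_eq_floor h
  rw [← sub_div, abs_div, abs_of_pos hδ, div_lt_one hδ] at this
  exact this.le

lemma jetd_comm (H0 H1 H2 : ℤ × ℤ → ℝ → ℝ) (k k' : ℤ × ℤ) :
    jetd H0 H1 H2 k k' = jetd H0 H1 H2 k' k := by
  unfold jetd
  rw [abs_sub_comm (H0 k 0), abs_sub_comm (H1 k 0), abs_sub_comm (H2 k 0)]

lemma jetd_tri (H0 H1 H2 : ℤ × ℤ → ℝ → ℝ) (a b c : ℤ × ℤ) :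
    jetd H0 H1 H2 a c ≤ jetd H0 H1 H2 a b + jetd H0 H1 H2 b c := by
  unfold jetd
  have h1 := abs_sub_le (H0 a 0) (H0 b 0) (H0 c 0)
  have h2 := abs_sub_le (H1 a 0) (H1 b 0) (H1 c 0)
  have h3 := abs_sub_le (H2 a 0) (H2 b 0) (H2 c 0)
  linarith

lemma jetd_nonneg (H0 H1 H2 : ℤ × ℤ → ℝ → ℝ) (a b : ℤ × ℤ) : 0 ≤ jetd H0 H1 H2 a b := by
  unfold jetd; positivity

/-- The type relation between curves `k`, `k'` at column `i`, with jet distance `~ρ` and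
slope `~κ`. -/
structure Typ (δ ρ κ : ℝ) (H0 H1 H2 : ℤ × ℤ → ℝ → ℝ) (k k' : ℤ × ℤ) (i : ℤ) : Prop where
  row : rowOf δ H0 k i = rowOf δ H0 k' i
  far : 8 * δ ≤ jetd H0 H1 H2 k k'
  lo : ρ / 2 ≤ jetd H0 H1 H2 k k'
  hi : jetd H0 H1 H2 k k' ≤ ρ
  sl : |H1 k (δ * i) - H1 k' (δ * i)| ≤ κ
  alt : κ ^ 2 ≤ 4 * δ * ρ ∨ κ / 2 ≤ |H1 k (δ * i) - H1 k' (δ * i)|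

namespace CurveFam
variable {δ c0 C0 : ℝ} {Y : Finset (ℤ × ℤ)} {H0 H1 H2 : ℤ × ℤ → ℝ → ℝ}

lemma pair (F : CurveFam δ c0 C0 Y H0 H1 H2) {k k' : ℤ × ℤ} (hk : k ∈ Y) (hk' : k' ∈ Y) :
    PairFn c0 (fun x => H0 k x - H0 k' x) (fun x => H1 k x - H1 k' x)
      (fun x => H2 k x - H2 k' x) (jetd H0 H1 H2 k k') where
  hc0 := F.hc0
  hc1 := F.hc1
  d0 := fun x hx => (F.d0 k hk x hx).sub (F.d0 k' hk' x hx)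
  d1 := fun x hx => (F.d1 k hk x hx).sub (F.d1 k' hk' x hx)
  hD := rfl
  p2 := fun x hx => F.p2 k hk k' hk' x hx

/-- G2: counting curves close to each other. -/
lemma count_close (F : CurveFam δ c0 C0 Y H0 H1 H2) {S : Finset (ℤ × ℤ)} (hS : S ⊆ Y)
    {ρ κ : ℝ} (hρ : δ ≤ ρ) (hκ : δ ≤ κ)
    (h1 : ∀ k ∈ S, ∀ k' ∈ S, jetd H0 H1 H2 k k' ≤ ρ)
    (h2 : ∀ k ∈ S, ∀ k' ∈ S, ∃ x ∈ Icc 0 c0, |H0 k x - H0 k' x| + |H1 k x - H1 k' x| ≤ κ) :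
    (S.card : ℝ) ≤ 4 * C0 ^ 2 * (ρ * κ) / δ ^ 2 := by
  have hδ := F.hδ0
  have hC0 := F.hC0
  have hb := card_box S (P := C0 * ρ / δ) (Q := C0 * κ / δ)
    (by have := hδ.trans_le hρ; positivity) (by have := hδ.trans_le hκ; positivity)
    (by
      intro a ha b hb
      have := (F.p5 b (hS hb) a (hS ha)).1
      rw [le_div_iff₀ hδ]
      have h3 := h1 b hb a ha
      have h4 := le_abs_self ((b.1 : ℝ) - a.1)
      nlinarith)
    (by
      intro a ha b hb hab
      obtain ⟨x, hx, hx2⟩ := h2 b hb a ha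
      have := F.p4 b (hS hb) a (hS ha) hab.symm x hx
      rw [le_div_iff₀ hδ]
      have h4 := le_abs_self ((b.2 : ℝ) - a.2)
      nlinarith)
  have e1 : C0 * ρ / δ + 1 ≤ 2 * C0 * ρ / δ := by
    have : 1 ≤ C0 * ρ / δ := by rw [le_div_iff₀ hδ]; nlinarith
    have e : 2 * C0 * ρ / δ = C0 * ρ / δ + C0 * ρ / δ := by ring
    linarith
  have e2 : C0 * κ / δ + 1 ≤ 2 * C0 * κ / δ := by
    have : 1 ≤ C0 * κ / δ := by rw [le_div_iff₀ hδ]; nlinarith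
    have e : 2 * C0 * κ / δ = C0 * κ / δ + C0 * κ / δ := by ring
    linarith
  calc (S.card : ℝ) ≤ _ := hb
    _ ≤ (2 * C0 * ρ / δ) * (2 * C0 * κ / δ) := by
        apply mul_le_mul e1 e2
        · have := hδ.trans_le hκ; positivity
        · have := hδ.trans_le hρ; positivity
    _ = _ := by field_simp; ring

/-- G1: counting the columns of a given type for a pair. -/
lemma count_cols (F : CurveFam δ c0 C0 Y H0 H1 H2) {k k' : ℤ × ℤ} (hk : k ∈ Y) (hk' : k' ∈ Y)
    {ρ κ : ℝ} (hκ : 0 < κ) (hκρ : κ ≤ 4 * ρ) (hρ : ρ ≤ C0) (S : Finset ℤ)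
    (hS : ∀ i ∈ S, (δ * i : ℝ) ∈ Icc 0 c0 ∧ Typ δ ρ κ H0 H1 H2 k k' i) :
    (S.card : ℝ) ≤ 520 * C0 / κ := by
  classical
  have hδ := F.hδ0
  have hC0 := F.hC0
  have P := F.pair hk hk'
  have gen : ∀ T : Finset ℤ, T ⊆ S → (∀ i ∈ T, ∀ j ∈ T,
      0 ≤ (H1 k (δ * i) - H1 k' (δ * i)) * (H1 k (δ * j) - H1 k' (δ * j))) →
      (T.card : ℝ) ≤ 256 / κ + 1 := by
    intro T hT hsg
    apply card_int_diam _ (by positivity)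
    intro i hi j hj
    rcases le_or_gt ((j : ℝ) - i) 0 with h | h
    · exact h.trans (by positivity)
    · obtain ⟨ix, it⟩ := hS i (hT hi)
      obtain ⟨jx, jt⟩ := hS j (hT hj)
      have hlt : (δ * i : ℝ) < δ * j := by nlinarith
      have := P.inter hκ hκρ hδ it.far it.lo ix jx hlt (rowOf_eq hδ it.row) (rowOf_eq hδ jt.row)
        it.sl jt.sl (hsg i hi j hj) (by
          rcases it.alt with h1 | h1
          · exact Or.inl h1
          · rcases jt.alt with h2 | h2
            · exact Or.inl h2
            · exact Or.inr ⟨h1, h2⟩)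
      rw [← mul_sub] at this
      have e : δ * ((j : ℝ) - i) ≤ δ * (256 / κ) := by
        calc _ ≤ 256 * δ / κ := this
          _ = _ := by ring
      exact le_of_mul_le_mul_left e hδ
  have s1 := gen (S.filter (fun i => 0 ≤ H1 k (δ * i) - H1 k' (δ * i)))
    (Finset.filter_subset _ _) (by
      intro i hi j hj
      exact mul_nonneg (Finset.mem_filter.1 hi).2 (Finset.mem_filter.1 hj).2)
  have s2 := gen (S.filter (fun i => ¬ 0 ≤ H1 k (δ * i) - H1 k' (δ * i)))
    (Finset.filter_subset _ _) (by
      intro i hi j hj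
      exact mul_nonneg_of_nonpos_of_nonpos (not_le.1 (Finset.mem_filter.1 hi).2).le
        (not_le.1 (Finset.mem_filter.1 hj).2).le)
  have hsum := Finset.card_filter_add_card_filter_not (s := S)
    (fun i : ℤ => 0 ≤ H1 k (δ * i) - H1 k' (δ * i))
  have hsum' : (S.card : ℝ) = ((S.filter (fun i : ℤ => 0 ≤ H1 k (δ * i) - H1 k' (δ * i))).card : ℝ)
      + ((S.filter (fun i : ℤ => ¬ 0 ≤ H1 k (δ * i) - H1 k' (δ * i))).card : ℝ) := by
    exact_mod_cast hsum.symm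
  rw [hsum', le_div_iff₀ hκ]
  have e : (256 / κ + 1) * κ = 256 + κ := by field_simp
  nlinarith [mul_le_mul_of_nonneg_right s1 hκ.le, mul_le_mul_of_nonneg_right s2 hκ.le]

end CurveFam

namespace CurveFam
variable {δ c0 C0 : ℝ} {Y : Finset (ℤ × ℤ)} {H0 H1 H2 : ℤ × ℤ → ℝ → ℝ}

/-- Typ gives a one-sided bound everywhere (convexity). -/
lemma typ_lower (F : CurveFam δ c0 C0 Y H0 H1 H2) {k k1 : ℤ × ℤ} (hk : k ∈ Y) (hk1 : k1 ∈ Y)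
    {ρ κ τ : ℝ} (hρ : 0 < ρ) (hκρ : κ ≤ ρ / 16) (hτ : κ ^ 2 ≤ τ * ρ) (hδτ : δ ≤ τ) {i : ℤ}
    (hi : (δ * i : ℝ) ∈ Icc 0 c0) (T : Typ δ ρ κ H0 H1 H2 k k1 i) {z : ℝ} (hz : z ∈ Icc 0 c0) :
    (0 < H2 k (δ * i) - H2 k1 (δ * i) → -(9 * τ) ≤ H0 k z - H0 k1 z) ∧
    (¬ 0 < H2 k (δ * i) - H2 k1 (δ * i) → H0 k z - H0 k1 z ≤ 9 * τ) := by
  have P := F.pair hk hk1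
  have hδ := F.hδ0
  have hrow := rowOf_eq hδ T.row
  constructor
  · intro h
    exact P.tangent_lower hρ T.far T.lo hκρ hτ hδτ hi hrow T.sl h hz
  · intro h
    have h4 := P.tangent_sign T.far T.lo hκρ hi hrow T.sl
    have hD : 0 < jetd H0 H1 H2 k k1 := by linarith [T.far]
    have hneg : H2 k (δ * i) - H2 k1 (δ * i) < 0 := by
      rcases lt_trichotomy (H2 k (δ * i) - H2 k1 (δ * i)) 0 with h5 | h5 | h5
      · exact h5
      · simp only [h5] at h4; simp at h4; linarith
      · exact absurd h5 h
    have Q := P.neg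
    have := Q.tangent_lower hρ T.far T.lo hκρ hτ hδτ hi (by simpa [abs_sub_comm] using hrow)
      (by simpa [abs_sub_comm] using T.sl) (by linarith) hz
    linarith

/-- Two curves tangent (same side) to a common curve at nearby points nearly meet. -/
lemma nearly_meet (F : CurveFam δ c0 C0 Y H0 H1 H2) {k k' k1 : ℤ × ℤ} (hk : k ∈ Y) (hk' : k' ∈ Y)
    (hk1 : k1 ∈ Y)
    {ρ κ τ : ℝ} (hρ : 0 < ρ) (hκρ : κ ≤ ρ / 16) (hτ : κ ^ 2 ≤ τ * ρ) (hδτ : δ ≤ τ) {i i' : ℤ}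
    (hi : (δ * i : ℝ) ∈ Icc 0 c0) (hi' : (δ * i' : ℝ) ∈ Icc 0 c0)
    (T : Typ δ ρ κ H0 H1 H2 k k1 i) (T' : Typ δ ρ κ H0 H1 H2 k' k1 i')
    (hs : (0 < H2 k (δ * i) - H2 k1 (δ * i)) ↔ (0 < H2 k' (δ * i') - H2 k1 (δ * i'))) :
    ∃ z ∈ uIcc (δ * i : ℝ) (δ * i'), z ∈ Icc 0 c0 ∧ |H0 k z - H0 k' z| ≤ 10 * τ := by
  have P := F.pair hk hk'
  have hδ := F.hδ0
  have r1 := abs_le.1 (rowOf_eq hδ T.row)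
  have r2 := abs_le.1 (rowOf_eq hδ T'.row)
  have L1 := F.typ_lower hk hk1 hρ hκρ hτ hδτ hi T hi'
  have L2 := F.typ_lower hk' hk1 hρ hκρ hτ hδτ hi' T' hi
  have hsub : uIcc (δ * i : ℝ) (δ * i') ⊆ Icc 0 c0 := by
    intro z hz
    exact (convex_Icc 0 c0).ordConnected.uIcc_subset hi hi' hz
  have hcont : ContinuousOn (fun x => H0 k x - H0 k' x) (uIcc (δ * i : ℝ) (δ * i')) := fun z hz =>
    (P.d0 z (hsub hz)).continuousAt.continuousWithinAt
  by_cases hp : 0 < H2 k (δ * i) - H2 k1 (δ * i)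
  · have l1 := L1.1 hp
    have l2 := L2.1 (hs.1 hp)
    -- g(x) ≤ 10τ, g(x') ≥ -10τ
    by_cases c1 : -(10 * τ) ≤ H0 k (δ * i) - H0 k' (δ * i)
    · exact ⟨_, left_mem_uIcc, hi, abs_le.2 ⟨c1, by linarith⟩⟩
    by_cases c2 : H0 k (δ * i') - H0 k' (δ * i') ≤ 10 * τ
    · exact ⟨_, right_mem_uIcc, hi', abs_le.2 ⟨by linarith, c2⟩⟩
    push Not at c1 c2
    have h0 : (0 : ℝ) ∈ uIcc (H0 k (δ * i) - H0 k' (δ * i)) (H0 k (δ * i') - H0 k' (δ * i')) :=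
      mem_uIcc.2 (Or.inl ⟨by linarith, by linarith⟩)
    obtain ⟨z, hz, h⟩ := intermediate_value_uIcc hcont h0
    refine ⟨z, hz, hsub hz, ?_⟩
    simp only at h
    rw [h, abs_zero]; linarith
  · have l1 := L1.2 hp
    have l2 := L2.2 (fun h => hp (hs.2 h))
    by_cases c1 : H0 k (δ * i) - H0 k' (δ * i) ≤ 10 * τ
    · exact ⟨_, left_mem_uIcc, hi, abs_le.2 ⟨by linarith, c1⟩⟩
    by_cases c2 : -(10 * τ) ≤ H0 k (δ * i') - H0 k' (δ * i')
    · exact ⟨_, right_mem_uIcc, hi', abs_le.2 ⟨c2, by linarith⟩⟩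
    push Not at c1 c2
    have h0 : (0 : ℝ) ∈ uIcc (H0 k (δ * i) - H0 k' (δ * i)) (H0 k (δ * i') - H0 k' (δ * i')) :=
      mem_uIcc.2 (Or.inr ⟨by linarith, by linarith⟩)
    obtain ⟨z, hz, h⟩ := intermediate_value_uIcc hcont h0
    refine ⟨z, hz, hsub hz, ?_⟩
    simp only at h
    rw [h, abs_zero]; linarith

/-- Two curves tangent to three common curves at nearby separated points are close. -/
lemma three_tangent (F : CurveFam δ c0 C0 Y H0 H1 H2) {k k' : ℤ × ℤ} (hk : k ∈ Y) (hk' : k' ∈ Y)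
    {κs : Fin 3 → ℤ × ℤ} (hκs : ∀ j, κs j ∈ Y)
    {ρ κ τ s s' : ℝ} (hρ : 0 < ρ) (hκρ : κ ≤ ρ / 16) (hτ : κ ^ 2 ≤ τ * ρ) (hδτ : δ ≤ τ)
    (hs' : 0 < s') (hss' : s' ≤ s) (hs1 : s ≤ 1)
    {i i' : Fin 3 → ℤ}
    (hi : ∀ j, (δ * i j : ℝ) ∈ Icc 0 c0) (hi' : ∀ j, (δ * i' j : ℝ) ∈ Icc 0 c0)
    (T : ∀ j, Typ δ ρ κ H0 H1 H2 k (κs j) (i j)) (T' : ∀ j, Typ δ ρ κ H0 H1 H2 k' (κs j) (i' j))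
    (hs : ∀ j, (0 < H2 k (δ * i j) - H2 (κs j) (δ * i j)) ↔
      (0 < H2 k' (δ * i' j) - H2 (κs j) (δ * i' j)))
    (hcl : ∀ j, |(δ * i j : ℝ) - δ * i' j| ≤ s' / 4)
    (hsep : ∀ j l, j ≠ l → s' ≤ |(δ * i j : ℝ) - δ * i l|)
    (hle : ∀ j l, |(δ * i j : ℝ) - δ * i l| ≤ s) :
    jetd H0 H1 H2 k k' ≤ 2560 * τ / s' ^ 2 ∧
    ∃ x ∈ Icc 0 c0, |H0 k x - H0 k' x| + |H1 k x - H1 k' x| ≤ 5610 * (τ * s) / s' ^ 2 := by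
  have hz : ∀ j, ∃ z ∈ uIcc (δ * i j : ℝ) (δ * i' j), z ∈ Icc 0 c0 ∧ |H0 k z - H0 k' z| ≤ 10 * τ :=
    fun j => F.nearly_meet hk hk' (hκs j) hρ hκρ hτ hδτ (hi j) (hi' j) (T j) (T' j) (hs j)
  choose z hz1 hz2 hz3 using hz
  have P := F.pair hk hk'
  have hzi : ∀ j, |z j - δ * i j| ≤ s' / 4 := fun j =>
    (abs_sub_left_of_mem_uIcc (hz1 j)).trans (by rw [abs_sub_comm]; exact hcl j)
  have hzs : ∀ j l, j ≠ l → s' / 2 ≤ |z j - z l| := by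
    intro j l hjl
    have h1 := hsep j l hjl
    have h2 : |(δ * i j : ℝ) - δ * i l| ≤ |z j - δ * i j| + |z j - z l| + |z l - δ * i l| := by
      have : (δ * i j : ℝ) - δ * i l = -(z j - δ * i j) + (z j - z l) + (z l - δ * i l) := by ring
      rw [this]
      refine (abs_add_le _ _).trans (add_le_add ((abs_add_le _ _).trans ?_) le_rfl)
      rw [abs_neg]
    have := hzi j
    have := hzi l
    linarith
  have hzl : |z 0 - z 1| ≤ 2 * s := by
    have h1 := hle 0 1
    have h2 : |z 0 - z 1| ≤ |z 0 - δ * i 0| + |(δ * i 0 : ℝ) - δ * i 1| + |z 1 - δ * i 1| := by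
      have : z 0 - z 1 = (z 0 - δ * i 0) + ((δ * i 0 : ℝ) - δ * i 1) + -(z 1 - δ * i 1) := by ring
      rw [this]
      refine (abs_add_le _ _).trans (add_le_add (abs_add_le _ _) ?_)
      rw [abs_neg]
    have := hzi 0
    have := hzi 1
    linarith
  have hD := P.three (T := 10 * τ) (t := s' / 2) (by linarith) (hz2 0) (hz2 1) (hz2 2)
    (hzs 0 1 (by decide)) (hzs 1 2 (by decide)) (hzs 0 2 (by decide)) (hz3 0) (hz3 1) (hz3 2)
  have hd := P.deriv_small (T := 10 * τ) (t := s' / 2) (l := 2 * s) (by linarith) (hz2 0) (hz2 1)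
    (hzs 0 1 (by decide)) hzl hD (hz3 0) (hz3 1)
  refine ⟨hD.trans (le_of_eq (by field_simp; ring)), z 0, hz2 0, ?_⟩
  have hτ0 : 0 ≤ τ := F.hδ0.le.trans hδτ
  have h3 : 10 * τ ≤ 10 * (τ * s) / s' ^ 2 := by
    rw [le_div_iff₀ (by positivity)]
    have : s' ^ 2 ≤ s := by nlinarith
    nlinarith
  have h4 : 70 * (10 * τ) * (2 * s) / (s' / 2) ^ 2 = 5600 * (τ * s) / s' ^ 2 := by
    field_simp; ring
  rw [h4] at hd
  calc _ ≤ 10 * (τ * s) / s' ^ 2 + 5600 * (τ * s) / s' ^ 2 := add_le_add ((hz3 0).trans h3) hd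
    _ = _ := by ring

/-- moving a Typ pair to another point. -/
lemma typ_move (F : CurveFam δ c0 C0 Y H0 H1 H2) {k k1 : ℤ × ℤ} (hk : k ∈ Y) (hk1 : k1 ∈ Y)
    {ρ κ : ℝ} {i : ℤ}
    (hi : (δ * i : ℝ) ∈ Icc 0 c0) (T : Typ δ ρ κ H0 H1 H2 k k1 i) {z r : ℝ} (hz : z ∈ Icc 0 c0)
    (hr : |z - δ * i| ≤ r) :
    |H0 k z - H0 k1 z| ≤ δ + 2 * ρ * r ∧ |H1 k z - H1 k1 z| ≤ κ + 2 * ρ * r := by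
  have P := F.pair hk hk1
  have h0 := P.h_diff hz hi
  have h1 := P.h1_diff hz hi
  have hD := T.hi
  have hD0 := jetd_nonneg H0 H1 H2 k k1
  have e : 17 / 16 * jetd H0 H1 H2 k k1 * |z - δ * i| ≤ 2 * ρ * r :=
    mul_le_mul (by linarith) hr (abs_nonneg _) (by linarith)
  have a0 := rowOf_eq F.hδ0 T.row
  have a1 := T.sl
  constructor
  · have := abs_sub_abs_le_abs_sub (H0 k z - H0 k1 z) (H0 k (δ * i) - H0 k1 (δ * i))
    linarith
  · have := abs_sub_abs_le_abs_sub (H1 k z - H1 k1 z) (H1 k (δ * i) - H1 k1 (δ * i))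
    linarith

end CurveFam

lemma sep_triples (δ s' : ℝ) (β : Finset ℤ)
    (h : ∀ a : ℤ, ((β.filter (fun b : ℤ => |(δ * a : ℝ) - δ * b| < s')).card : ℝ) ≤ β.card / 4) :
    (β.card : ℝ) ^ 3 / 4 ≤ (((Fintype.piFinset (fun _ : Fin 3 => β)).filter
      (fun i => ∀ j l, j ≠ l → s' ≤ |(δ * i j : ℝ) - δ * i l|)).card : ℝ) := by
  classical
  set Q := Fintype.piFinset (fun _ : Fin 3 => β) with hQ
  have hbad : ∀ j l : Fin 3, j ≠ l →
      ((Q.filter (fun i => |(δ * i j : ℝ) - δ * i l| < s')).card : ℝ) ≤ (β.card : ℝ) ^ 3 / 4 := by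
    intro j l hjl
    obtain ⟨m, hm⟩ : ∃ m : Fin 3, ∀ x, x = j ∨ x = l ∨ x = m := by
      revert j l; decide
    have := double_count (Q.filter (fun i => |(δ * i j : ℝ) - δ * i l| < s')) (β ×ˢ β)
      (fun i p => i j = p.1 ∧ i m = p.2) (m := 1) (M := β.card / 4) (by
        intro i hi
        have hi' := Fintype.mem_piFinset.1 (Finset.mem_filter.1 hi).1
        have : (i j, i m) ∈ (β ×ˢ β).filter (fun p => i j = p.1 ∧ i m = p.2) := by
          simp [hi' j, hi' m]
        exact_mod_cast Finset.card_pos.2 ⟨_, this⟩) (by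
        intro p hp
        refine le_trans ?_ (h p.1)
        norm_cast
        apply Finset.card_le_card_of_injOn (fun i => i l)
        · intro i hi
          rw [Finset.mem_coe, Finset.mem_filter, Finset.mem_filter] at hi
          rw [Finset.mem_coe, Finset.mem_filter]
          refine ⟨Fintype.mem_piFinset.1 hi.1.1 l, ?_⟩
          rw [← hi.2.1]; exact hi.1.2
        · intro i hi i' hi' hii
          rw [Finset.mem_coe, Finset.mem_filter, Finset.mem_filter] at hi hi'
          funext x
          rcases hm x with rfl | rfl | rfl
          · rw [hi.2.1, hi'.2.1]
          · exact hii
          · rw [hi.2.2, hi'.2.2])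
    rw [mul_one, Finset.card_product] at this
    push_cast at this
    linarith
  have hcov : Q ⊆ (Q.filter (fun i => ∀ j l, j ≠ l → s' ≤ |(δ * i j : ℝ) - δ * i l|)) ∪
      ((Q.filter (fun i => |(δ * i 0 : ℝ) - δ * i 1| < s')) ∪
      ((Q.filter (fun i => |(δ * i 0 : ℝ) - δ * i 2| < s')) ∪
      (Q.filter (fun i => |(δ * i 1 : ℝ) - δ * i 2| < s')))) := by
    intro i hi
    simp only [Finset.mem_union, Finset.mem_filter, hi, true_and]
    by_contra! hc
    obtain ⟨⟨j, l, hjl, hlt⟩, h1, h2, h3⟩ := hc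
    have h1' := h1
    have h2' := h2
    have h3' := h3
    rw [abs_sub_comm] at h1' h2' h3'
    fin_cases j <;> fin_cases l <;> first
      | exact hjl rfl
      | exact not_lt.2 h1 hlt
      | exact not_lt.2 h2 hlt
      | exact not_lt.2 h3 hlt
      | exact not_lt.2 h1' hlt
      | exact not_lt.2 h2' hlt
      | exact not_lt.2 h3' hlt
  have hc := Finset.card_le_card hcov
  have hc2 := hc.trans ((Finset.card_union_le _ _).trans (add_le_add le_rfl
    ((Finset.card_union_le _ _).trans (add_le_add le_rfl (Finset.card_union_le _ _)))))
  have hQc : (Q.card : ℝ) = (β.card : ℝ) ^ 3 := by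
    rw [hQ, Fintype.card_piFinset]; simp
  have hc3 : (Q.card : ℝ) ≤ _ := Nat.cast_le.2 hc2
  push_cast at hc3
  have b1 := hbad 0 1 (by decide)
  have b2 := hbad 0 2 (by decide)
  have b3 := hbad 1 2 (by decide)
  rw [hQc] at hc3
  linarith

/-- column data -/
structure ColData (δ c0 s : ℝ) (Y : Finset (ℤ × ℤ)) (B : ℤ × ℤ → Finset ℤ) (aL : ℤ × ℤ → ℝ) :
    Prop where
  hcol : ∀ k ∈ Y, ∀ i ∈ B k, (δ * i : ℝ) ∈ Icc 0 c0
  haL : ∀ k ∈ Y, aL k ∈ Icc 0 c0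
  hJ : ∀ k ∈ Y, ∀ i ∈ B k, aL k ≤ δ * i ∧ δ * i ≤ aL k + s

namespace CurveFam
variable {δ c0 C0 s : ℝ} {Y : Finset (ℤ × ℤ)} {H0 H1 H2 : ℤ × ℤ → ℝ → ℝ}
  {B : ℤ × ℤ → Finset ℤ} {aL : ℤ × ℤ → ℝ}

open Classical in
/-- Transversal counting. -/
lemma transversal (F : CurveFam δ c0 C0 Y H0 H1 H2) (G : ColData δ c0 s Y B aL)
    {ρ κ : ℝ} (hκ : δ ≤ κ) (hκρ : κ ≤ 4 * ρ) (hρ : ρ ≤ C0) (hδρ : δ ≤ ρ)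
    (hs : ρ * s ≤ 32 * κ) {k : ℤ × ℤ} (hk : k ∈ Y) {β : Finset ℤ} (hβ : β ⊆ B k) {m : ℝ}
    (hm : ∀ i ∈ β, m ≤ ((Y.filter (fun k' => i ∈ B k' ∧ Typ δ ρ κ H0 H1 H2 k k' i)).card : ℝ)) :
    β.card * m ≤ min (Y.card : ℝ) (2112 * C0 ^ 2 * (ρ * κ) / δ ^ 2) * (520 * C0 / κ) := by
  have hδ := F.hδ0
  have hκ0 : 0 < κ := hδ.trans_le hκ
  have hC0 := F.hC0
  set T := Y.filter (fun k' => ∃ i ∈ β, Typ δ ρ κ H0 H1 H2 k k' i) with hT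
  have hTY : T ⊆ Y := Finset.filter_subset _ _
  have h1 := double_count β T (fun i k' => Typ δ ρ κ H0 H1 H2 k k' i) (m := m)
    (M := 520 * C0 / κ) (by
      intro i hi
      refine (hm i hi).trans ?_
      norm_cast
      apply Finset.card_le_card
      intro k' hk'
      rw [Finset.mem_filter] at hk' ⊢
      exact ⟨Finset.mem_filter.2 ⟨hk'.1, i, hi, hk'.2.2⟩, hk'.2.2⟩) (by
      intro k' hk'
      apply F.count_cols hk (hTY hk') hκ0 hκρ hρ
      intro i hi
      rw [Finset.mem_filter] at hi
      exact ⟨G.hcol k hk i (hβ hi.1), hi.2⟩)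
  have hx0 := G.haL k hk
  have mv : ∀ k' ∈ T, jetd H0 H1 H2 k k' ≤ ρ ∧ |H0 k (aL k) - H0 k' (aL k)| ≤ 66 * κ ∧
      |H1 k (aL k) - H1 k' (aL k)| ≤ 66 * κ := by
    intro k' hk'
    obtain ⟨hk'Y, i, hi, ht⟩ := Finset.mem_filter.1 hk'
    have hJ := G.hJ k hk i (hβ hi)
    have := F.typ_move hk hk'Y (G.hcol k hk i (hβ hi)) ht hx0 (r := s)
      (by rw [abs_le]; constructor <;> linarith)
    refine ⟨ht.hi, ?_, ?_⟩ <;> nlinarith [this.1, this.2]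
  have hc := F.count_close hTY (ρ := 2 * ρ) (κ := 264 * κ) (by linarith) (by linarith)
    (by
      intro a ha b hb
      have := jetd_tri H0 H1 H2 a k b
      rw [jetd_comm H0 H1 H2 a k] at this
      linarith [(mv a ha).1, (mv b hb).1])
    (by
      intro a ha b hb
      refine ⟨aL k, hx0, ?_⟩
      have e1 := abs_sub_le (H0 a (aL k)) (H0 k (aL k)) (H0 b (aL k))
      have e2 := abs_sub_le (H1 a (aL k)) (H1 k (aL k)) (H1 b (aL k))
      rw [abs_sub_comm (H0 a (aL k)) (H0 k (aL k))] at e1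
      rw [abs_sub_comm (H1 a (aL k)) (H1 k (aL k))] at e2
      linarith [(mv a ha).2.1, (mv a ha).2.2, (mv b hb).2.1, (mv b hb).2.2])
  refine h1.trans (mul_le_mul_of_nonneg_right (le_min ?_ ?_) (by positivity))
  · exact_mod_cast Finset.card_le_card hTY
  · exact hc.trans (le_of_eq (by ring))

end CurveFam

/-- The relation: `k` is of the given type with three curves at three separated columns. -/
structure Tri (δ ρ κ s' : ℝ) (H0 H1 H2 : ℤ × ℤ → ℝ → ℝ) (B B2 : ℤ × ℤ → Finset ℤ)
    (k : ℤ × ℤ) (t : Fin 3 → ℤ × ℤ) (i : Fin 3 → ℤ) : Prop where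
  mem2 : ∀ j, i j ∈ B2 k
  mem : ∀ j, i j ∈ B (t j)
  sep : ∀ j l, j ≠ l → s' ≤ |(δ * i j : ℝ) - δ * i l|
  typ : ∀ j, Typ δ ρ κ H0 H1 H2 k (t j) (i j)

namespace CurveFam
variable {δ c0 C0 s : ℝ} {Y : Finset (ℤ × ℤ)} {H0 H1 H2 : ℤ × ℤ → ℝ → ℝ}
  {B : ℤ × ℤ → Finset ℤ} {aL : ℤ × ℤ → ℝ}

open Classical in
/-- lower bound for the number of triples -/
lemma tri_lower (F : CurveFam δ c0 C0 Y H0 H1 H2) (G : ColData δ c0 s Y B aL)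
    {ρ κ s' : ℝ} (hκ : δ ≤ κ) (hκρ : κ ≤ 4 * ρ) (hρ : ρ ≤ C0) {B2 : ℤ × ℤ → Finset ℤ}
    {k : ℤ × ℤ} (hk : k ∈ Y) (hB2 : B2 k ⊆ B k) {m : ℝ} (hm0 : 0 ≤ m)
    (hm : ∀ i ∈ B2 k, m ≤ ((Y.filter (fun k' => i ∈ B k' ∧ Typ δ ρ κ H0 H1 H2 k k' i)).card : ℝ))
    (hsep : ∀ a : ℤ, (((B2 k).filter (fun b : ℤ => |(δ * a : ℝ) - δ * b| < s')).card : ℝ)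
      ≤ (B2 k).card / 4) :
    ((B2 k).card : ℝ) ^ 3 / 4 * m ^ 3 ≤ (((Fintype.piFinset (fun _ : Fin 3 => Y)).filter
      (fun t => ∃ i, Tri δ ρ κ s' H0 H1 H2 B B2 k t i)).card : ℝ) * (520 * C0 / κ) ^ 3 := by
  have hδ := F.hδ0
  have hκ0 : 0 < κ := hδ.trans_le hκ
  have hC0 := F.hC0
  have hst := sep_triples δ s' (B2 k) hsep
  set S := (Fintype.piFinset (fun _ : Fin 3 => B2 k)).filter
      (fun i => ∀ j l, j ≠ l → s' ≤ |(δ * i j : ℝ) - δ * i l|) with hS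
  set T := (Fintype.piFinset (fun _ : Fin 3 => Y)).filter
      (fun t => ∃ i, Tri δ ρ κ s' H0 H1 H2 B B2 k t i) with hT
  have h1 := double_count S T (fun i t => Tri δ ρ κ s' H0 H1 H2 B B2 k t i) (m := m ^ 3)
    (M := (520 * C0 / κ) ^ 3) (by
      intro i hi
      obtain ⟨hi1, hi2⟩ := Finset.mem_filter.1 hi
      rw [Fintype.mem_piFinset] at hi1
      have hsub : Fintype.piFinset (fun j : Fin 3 =>
          Y.filter (fun k' => i j ∈ B k' ∧ Typ δ ρ κ H0 H1 H2 k k' (i j))) ⊆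
          T.filter (fun t => Tri δ ρ κ s' H0 H1 H2 B B2 k t i) := by
        intro t ht
        rw [Fintype.mem_piFinset] at ht
        have ht' := fun j => Finset.mem_filter.1 (ht j)
        have htri : Tri δ ρ κ s' H0 H1 H2 B B2 k t i :=
          ⟨hi1, fun j => (ht' j).2.1, hi2, fun j => (ht' j).2.2⟩
        refine Finset.mem_filter.2 ⟨Finset.mem_filter.2 ⟨?_, i, htri⟩, htri⟩
        rw [Fintype.mem_piFinset]; exact fun j => (ht' j).1
      have hc := Finset.card_le_card hsub
      rw [Fintype.card_piFinset, Fin.prod_univ_three] at hc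
      refine le_trans ?_ (Nat.cast_le.2 hc)
      push_cast
      have a0 := hm (i 0) (hi1 0)
      have a1 := hm (i 1) (hi1 1)
      have a2 := hm (i 2) (hi1 2)
      calc m ^ 3 = m * m * m := by ring
        _ ≤ _ := by gcongr) (by
      intro t ht
      have htY := Fintype.mem_piFinset.1 (Finset.mem_filter.1 ht).1
      have hsub : S.filter (fun i => Tri δ ρ κ s' H0 H1 H2 B B2 k t i) ⊆
          Fintype.piFinset (fun j : Fin 3 => (B2 k).filter
            (fun i => Typ δ ρ κ H0 H1 H2 k (t j) i)) := by
        intro i hi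
        have htri := (Finset.mem_filter.1 hi).2
        rw [Fintype.mem_piFinset]
        intro j
        exact Finset.mem_filter.2 ⟨htri.mem2 j, htri.typ j⟩
      have hc := Finset.card_le_card hsub
      rw [Fintype.card_piFinset, Fin.prod_univ_three] at hc
      refine (Nat.cast_le.2 hc).trans ?_
      push_cast
      have hb : ∀ j, (((B2 k).filter (fun i => Typ δ ρ κ H0 H1 H2 k (t j) i)).card : ℝ)
          ≤ 520 * C0 / κ := by
        intro j
        apply F.count_cols hk (htY j) hκ0 hκρ hρ
        intro i hi
        obtain ⟨u1, u2⟩ := Finset.mem_filter.1 hi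
        exact ⟨G.hcol k hk i (hB2 u1), u2⟩
      have hp : 0 ≤ 520 * C0 / κ := by positivity
      calc _ ≤ (520 * C0 / κ) * (520 * C0 / κ) * (520 * C0 / κ) := by
            gcongr
            · exact hb 0
            · exact hb 1
            · exact hb 2
        _ = _ := by ring)
  refine le_trans ?_ h1
  gcongr

open Classical in
/-- number of `k` for a fixed triple of curves. -/
lemma tri_fiber (F : CurveFam δ c0 C0 Y H0 H1 H2) (G : ColData δ c0 s Y B aL)
    {ρ κ τ s' : ℝ} (hρ0 : 0 < ρ) (hκρ : κ ≤ ρ / 16) (hτ : κ ^ 2 ≤ τ * ρ) (hδτ : δ ≤ τ)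
    (hs' : 0 < s') (hss' : s' ≤ s) (hs1 : s ≤ 1)
    {B2 : ℤ × ℤ → Finset ℤ} {Y2 : Finset (ℤ × ℤ)} (hY2 : Y2 ⊆ Y) (hB2 : ∀ k ∈ Y2, B2 k ⊆ B k)
    {t : Fin 3 → ℤ × ℤ} (ht : ∀ j, t j ∈ Y) :
    ((Y2.filter (fun k => ∃ i, Tri δ ρ κ s' H0 H1 H2 B B2 k t i)).card : ℝ) ≤
      (8 * (14 * (s / s')) ^ 3) * (4 * C0 ^ 2 * 2560 * 5610 * (τ ^ 2 * s) / (s' ^ 4 * δ ^ 2)) := by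
  have hδ := F.hδ0
  have hC0 := F.hC0
  have hτ0 : 0 < τ := hδ.trans_le hδτ
  have hs0 : 0 < s := hs'.trans_le hss'
  set K := Y2.filter (fun k => ∃ i, Tri δ ρ κ s' H0 H1 H2 B B2 k t i) with hK
  have hex : ∀ k, ∃ i, k ∈ K → Tri δ ρ κ s' H0 H1 H2 B B2 k t i := by
    intro k
    by_cases hk : k ∈ K
    · obtain ⟨i, hi⟩ := (Finset.mem_filter.1 hk).2
      exact ⟨i, fun _ => hi⟩
    · exact ⟨fun _ => 0, fun h => absurd h hk⟩
  choose i hi using hex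
  have hKY : ∀ k ∈ K, k ∈ Y := fun k hk => hY2 (Finset.mem_filter.1 hk).1
  have hKB : ∀ k ∈ K, ∀ j, i k j ∈ B k := fun k hk j =>
    hB2 k (Finset.mem_filter.1 hk).1 ((hi k hk).mem2 j)
  -- class map
  set f : ℤ × ℤ → (Fin 3 → Bool) × (Fin 3 → ℤ) := fun k =>
    (fun j => decide (0 < H2 k (δ * i k j) - H2 (t j) (δ * i k j)),
     fun j => ⌊(δ * i k j - aL (t 0)) / (s' / 4)⌋) with hf
  set CC : Finset ℤ := Finset.Icc ⌊-(4 * (s / s'))⌋ ⌊8 * (s / s')⌋ with hCC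
  have hr1 : 1 ≤ s / s' := by rw [le_div_iff₀ hs']; linarith
  have hCCc : (CC.card : ℝ) ≤ 14 * (s / s') := by
    have := card_int_diam CC (P := 12 * (s / s') + 1) (by positivity) (by
      intro a ha b hb
      have ha' := (Finset.mem_Icc.1 ha).1
      have hb' := (Finset.mem_Icc.1 hb).2
      have e1 := Int.lt_floor_add_one (-(4 * (s / s')))
      have e2 := Int.floor_le (8 * (s / s'))
      have e3 : ((⌊-(4 * (s / s'))⌋ : ℤ) : ℝ) ≤ a := by exact_mod_cast ha'
      have e4 : (b : ℝ) ≤ ((⌊8 * (s / s')⌋ : ℤ) : ℝ) := by exact_mod_cast hb'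
      linarith)
    linarith
  set Z : Finset ((Fin 3 → Bool) × (Fin 3 → ℤ)) :=
    Finset.univ ×ˢ Fintype.piFinset (fun _ : Fin 3 => CC) with hZ
  have hZc : (Z.card : ℝ) ≤ 8 * (14 * (s / s')) ^ 3 := by
    rw [hZ, Finset.card_product, Fintype.card_piFinset, Fin.prod_univ_three, Finset.card_univ]
    simp only [Fintype.card_pi, Fintype.card_bool, Finset.prod_const, Finset.card_univ,
      Fintype.card_fin]
    push_cast
    calc (8 : ℝ) * (CC.card * CC.card * CC.card)
        ≤ 8 * ((14 * (s / s')) * (14 * (s / s')) * (14 * (s / s'))) := by gcongr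
      _ = _ := by ring
  have hfZ : ∀ k ∈ K, f k ∈ Z := by
    intro k hk
    rw [hZ, Finset.mem_product]
    refine ⟨Finset.mem_univ _, ?_⟩
    rw [Fintype.mem_piFinset]
    intro j
    have j0 := G.hJ (t 0) (ht 0) (i k 0) ((hi k hk).mem 0)
    have jj := G.hJ k (hKY k hk) (i k j) (hKB k hk j)
    have jk := G.hJ k (hKY k hk) (i k 0) (hKB k hk 0)
    rw [hCC, Finset.mem_Icc]
    constructor
    · apply Int.floor_le_floor
      rw [le_div_iff₀ (by positivity)]
      have : -(4 * (s / s')) * (s' / 4) = -s := by field_simp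
      rw [this]; linarith
    · apply Int.floor_le_floor
      rw [div_le_iff₀ (by positivity)]
      have : (8 * (s / s')) * (s' / 4) = 2 * s := by field_simp; ring
      rw [this]; linarith
  have hfib : ∀ z ∈ Z, ((K.filter (fun k => f k = z)).card : ℝ) ≤
      4 * C0 ^ 2 * 2560 * 5610 * (τ ^ 2 * s) / (s' ^ 4 * δ ^ 2) := by
    intro z _
    have key : ∀ k ∈ K.filter (fun k => f k = z), ∀ k' ∈ K.filter (fun k => f k = z),
        jetd H0 H1 H2 k k' ≤ 2560 * τ / s' ^ 2 ∧
        ∃ x ∈ Icc 0 c0, |H0 k x - H0 k' x| + |H1 k x - H1 k' x| ≤ 5610 * (τ * s) / s' ^ 2 := by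
      intro k hk k' hk'
      obtain ⟨hkK, hkz⟩ := Finset.mem_filter.1 hk
      obtain ⟨hkK', hkz'⟩ := Finset.mem_filter.1 hk'
      have hff : f k = f k' := hkz.trans hkz'.symm
      have f1 : ∀ j, _ := fun j => congrFun (congrArg Prod.fst hff) j
      have f2 : ∀ j, _ := fun j => congrFun (congrArg Prod.snd hff) j
      simp only [hf, decide_eq_decide] at f1 f2
      refine F.three_tangent (hKY k hkK) (hKY k' hkK') ht hρ0 hκρ hτ hδτ hs' hss' hs1
        (i := i k) (i' := i k') (fun j => G.hcol k (hKY k hkK) _ (hKB k hkK j))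
        (fun j => G.hcol k' (hKY k' hkK') _ (hKB k' hkK' j)) (hi k hkK).typ (hi k' hkK').typ f1
        ?_ (hi k hkK).sep ?_
      · intro j
        have := Int.abs_sub_lt_one_of_floor_eq_floor (f2 j)
        rw [← sub_div, abs_div, abs_of_pos (show 0 < s' / 4 by positivity),
          div_lt_one (by positivity)] at this
        have e : δ * (i k j : ℝ) - aL (t 0) - (δ * (i k' j : ℝ) - aL (t 0))
          = δ * i k j - δ * i k' j := by ring
        rw [e] at this
        exact this.le
      · intro j l
        have a1 := G.hJ k (hKY k hkK) (i k j) (hKB k hkK j)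
        have a2 := G.hJ k (hKY k hkK) (i k l) (hKB k hkK l)
        rw [abs_le]; constructor <;> linarith
    have h0 : s' ^ 2 ≤ s := by nlinarith
    have hs'2 : s' ^ 2 ≤ 1 := by linarith
    have hb := F.count_close (S := K.filter (fun k => f k = z))
      (ρ := 2560 * τ / s' ^ 2) (κ := 5610 * (τ * s) / s' ^ 2)
      (fun k hk => hKY k (Finset.mem_filter.1 hk).1)
      (by
        rw [le_div_iff₀ (by positivity)]
        nlinarith [mul_le_mul_of_nonneg_left hs'2 hδ.le])
      (by
        rw [le_div_iff₀ (by positivity)]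
        have : δ * s' ^ 2 ≤ τ * s := mul_le_mul hδτ h0 (by positivity) hτ0.le
        nlinarith [mul_pos hτ0 hs0])
      (fun k hk k' hk' => (key k hk k' hk').1) (fun k hk k' hk' => (key k hk k' hk').2)
    refine hb.trans (le_of_eq ?_)
    field_simp
  have h1 := double_count K Z (fun k z => f k = z) (m := 1) (by
    intro k hk
    have : f k ∈ Z.filter (fun z => f k = z) := Finset.mem_filter.2 ⟨hfZ k hk, rfl⟩
    exact_mod_cast Finset.card_pos.2 ⟨_, this⟩) hfib
  rw [mul_one] at h1
  refine h1.trans ?_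
  gcongr

open Classical in
/-- Tangential counting. -/
lemma tangential (F : CurveFam δ c0 C0 Y H0 H1 H2) (G : ColData δ c0 s Y B aL)
    {ρ κ τ s' : ℝ} (hδκ : δ ≤ κ) (hρ : ρ ≤ C0) (hκs : 32 * κ ≤ ρ * s)
    (hτ : κ ^ 2 ≤ τ * ρ) (hδτ : δ ≤ τ)
    (hs' : 0 < s') (hss' : s' ≤ s) (hs1 : s ≤ 1)
    {B2 : ℤ × ℤ → Finset ℤ} {Y2 : Finset (ℤ × ℤ)} (hY2 : Y2 ⊆ Y) (hB2 : ∀ k ∈ Y2, B2 k ⊆ B k)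
    {n m : ℝ} (hn0 : 0 ≤ n) (hm0 : 0 ≤ m) (hn : ∀ k ∈ Y2, n ≤ (B2 k).card)
    (hm : ∀ k ∈ Y2, ∀ i ∈ B2 k,
      m ≤ ((Y.filter (fun k' => i ∈ B k' ∧ Typ δ ρ κ H0 H1 H2 k k' i)).card : ℝ))
    (hsep : ∀ k ∈ Y2, ∀ a : ℤ,
      (((B2 k).filter (fun b : ℤ => |(δ * a : ℝ) - δ * b| < s')).card : ℝ) ≤ (B2 k).card / 4) :
    (Y2.card : ℝ) * (n * m) ^ 3 ≤ 4 * ((Y.card * min (Y.card : ℝ) (512 * C0 ^ 2 * (ρ ^ 2 * s) / δ ^ 2) ^ 2)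
      * ((8 * (14 * (s / s')) ^ 3) * (4 * C0 ^ 2 * 2560 * 5610 * (τ ^ 2 * s) / (s' ^ 4 * δ ^ 2)))
      * (520 * C0 / κ) ^ 3) := by
  have hδ := F.hδ0
  have hC0 := F.hC0
  have hκ0 : 0 < κ := hδ.trans_le hδκ
  have hs0 : 0 < s := hs'.trans_le hss'
  have hρs : 0 < ρ * s := by linarith
  have hρ0 : 0 < ρ := pos_of_mul_pos_left hρs hs0.le
  have hρs1 : ρ * s ≤ ρ := by nlinarith
  have hκρ : κ ≤ ρ / 16 := by linarith
  have hκρ4 : κ ≤ 4 * ρ := by linarith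
  set V := min (Y.card : ℝ) (512 * C0 ^ 2 * (ρ ^ 2 * s) / δ ^ 2) with hV
  have hV0 : 0 ≤ V := le_min (by positivity) (by positivity)
  set N4 := (8 * (14 * (s / s')) ^ 3) *
    (4 * C0 ^ 2 * 2560 * 5610 * (τ ^ 2 * s) / (s' ^ 4 * δ ^ 2)) with hN4
  have hN40 : 0 ≤ N4 := by positivity
  set W : ℤ × ℤ → Finset (ℤ × ℤ) := fun k1 => Y.filter (fun k' => jetd H0 H1 H2 k1 k' ≤ 2 * ρ ∧
    |H0 k1 (aL k1) - H0 k' (aL k1)| ≤ 8 * (ρ * s) ∧ |H1 k1 (aL k1) - H1 k' (aL k1)| ≤ 8 * (ρ * s))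
    with hW
  have hWc : ∀ k1 ∈ Y, ((W k1).card : ℝ) ≤ V := by
    intro k1 hk1
    have hWY : W k1 ⊆ Y := Finset.filter_subset _ _
    refine le_min (by exact_mod_cast Finset.card_le_card hWY) ?_
    have hx0 := G.haL k1 hk1
    have mv : ∀ k' ∈ W k1, _ := fun k' hk' => (Finset.mem_filter.1 hk').2
    have hc := F.count_close hWY (ρ := 4 * ρ) (κ := 32 * (ρ * s)) (by linarith) (by linarith)
      (by
        intro a ha b hb
        have := jetd_tri H0 H1 H2 a k1 b
        rw [jetd_comm H0 H1 H2 a k1] at this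
        linarith [(mv a ha).1, (mv b hb).1])
      (by
        intro a ha b hb
        refine ⟨aL k1, hx0, ?_⟩
        have e1 := abs_sub_le (H0 a (aL k1)) (H0 k1 (aL k1)) (H0 b (aL k1))
        have e2 := abs_sub_le (H1 a (aL k1)) (H1 k1 (aL k1)) (H1 b (aL k1))
        rw [abs_sub_comm (H0 a (aL k1)) (H0 k1 (aL k1))] at e1
        rw [abs_sub_comm (H1 a (aL k1)) (H1 k1 (aL k1))] at e2
        linarith [(mv a ha).2.1, (mv a ha).2.2, (mv b hb).2.1, (mv b hb).2.2])
    exact hc.trans (le_of_eq (by ring))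
  set T := (Fintype.piFinset (fun _ : Fin 3 => Y)).filter
    (fun t => ∃ k ∈ Y2, ∃ i, Tri δ ρ κ s' H0 H1 H2 B B2 k t i) with hT
  have hTmem : ∀ t ∈ T, ∀ j, t j ∈ Y := fun t ht => Fintype.mem_piFinset.1 (Finset.mem_filter.1 ht).1
  have hTW : ∀ t ∈ T, ∀ j, t j ∈ W (t 0) := by
    intro t ht j
    obtain ⟨k, hk, i, htri⟩ := (Finset.mem_filter.1 ht).2
    have hkY := hY2 hk
    have htY := hTmem t ht
    have hx0 := G.haL (t 0) (htY 0)
    have j0 := G.hJ (t 0) (htY 0) (i 0) (htri.mem 0)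
    have jj := G.hJ k hkY (i j) (hB2 k hk (htri.mem2 j))
    have jk := G.hJ k hkY (i 0) (hB2 k hk (htri.mem2 0))
    have m0 := F.typ_move hkY (htY 0) (G.hcol k hkY _ (hB2 k hk (htri.mem2 0))) (htri.typ 0) hx0
      (r := s) (by rw [abs_le]; constructor <;> linarith)
    have m1 := F.typ_move hkY (htY j) (G.hcol k hkY _ (hB2 k hk (htri.mem2 j))) (htri.typ j) hx0
      (r := 2 * s) (by rw [abs_le]; constructor <;> linarith)
    have hd := jetd_tri H0 H1 H2 (t 0) k (t j)
    rw [jetd_comm H0 H1 H2 (t 0) k] at hd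
    have e1 := abs_sub_le (H0 (t 0) (aL (t 0))) (H0 k (aL (t 0))) (H0 (t j) (aL (t 0)))
    have e2 := abs_sub_le (H1 (t 0) (aL (t 0))) (H1 k (aL (t 0))) (H1 (t j) (aL (t 0)))
    rw [abs_sub_comm (H0 (t 0) (aL (t 0))) (H0 k (aL (t 0)))] at e1
    rw [abs_sub_comm (H1 (t 0) (aL (t 0))) (H1 k (aL (t 0)))] at e2
    refine Finset.mem_filter.2 ⟨htY j, ?_, ?_, ?_⟩
    · linarith [(htri.typ 0).hi, (htri.typ j).hi]
    · nlinarith [m0.1, m1.1]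
    · nlinarith [m0.2, m1.2]
  have hTc : (T.card : ℝ) ≤ Y.card * V ^ 2 := by
    have := double_count T Y (fun t k => t 0 = k) (m := 1) (M := V ^ 2) (by
      intro t ht
      have : t 0 ∈ Y.filter (fun z => t 0 = z) := Finset.mem_filter.2 ⟨hTmem t ht 0, rfl⟩
      exact_mod_cast Finset.card_pos.2 ⟨_, this⟩) (by
      intro k hk
      have hsub : T.filter (fun t => t 0 = k) ⊆
          Fintype.piFinset (![{k}, W k, W k] : Fin 3 → Finset (ℤ × ℤ)) := by
        intro t ht
        obtain ⟨ht1, ht2⟩ := Finset.mem_filter.1 ht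
        rw [Fintype.mem_piFinset]
        have hw := hTW t ht1
        rw [ht2] at hw
        intro j
        fin_cases j
        · simpa using ht2
        · simpa using hw 1
        · simpa using hw 2
      have hc := Finset.card_le_card hsub
      rw [Fintype.card_piFinset, Fin.prod_univ_three] at hc
      simp only [Matrix.cons_val_zero, Matrix.cons_val_one, Matrix.cons_val,
        Finset.card_singleton, one_mul] at hc
      refine (Nat.cast_le.2 hc).trans ?_
      push_cast
      rw [sq]
      exact mul_le_mul (hWc k hk) (hWc k hk) (by positivity) hV0)
    rwa [mul_one] at this
  have h1 := double_count Y2 T (fun k t => ∃ i, Tri δ ρ κ s' H0 H1 H2 B B2 k t i)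
    (m := n ^ 3 / 4 * m ^ 3 / (520 * C0 / κ) ^ 3) (M := N4) (by
      intro k hk
      rw [div_le_iff₀ (by positivity)]
      have hl := F.tri_lower G hδκ hκρ4 hρ (hY2 hk) (hB2 k hk) hm0 (hm k hk) (hsep k hk)
      have hnn := hn k hk
      calc n ^ 3 / 4 * m ^ 3 ≤ ((B2 k).card : ℝ) ^ 3 / 4 * m ^ 3 := by gcongr
        _ ≤ _ := hl
        _ ≤ _ := by
          refine mul_le_mul_of_nonneg_right (Nat.cast_le.2 (Finset.card_le_card ?_)) (by positivity)
          intro t ht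
          obtain ⟨ht1, ht2⟩ := Finset.mem_filter.1 ht
          exact Finset.mem_filter.2 ⟨Finset.mem_filter.2 ⟨ht1, k, hk, ht2⟩, ht2⟩) (by
      intro t ht
      exact F.tri_fiber G hρ0 hκρ hτ hδτ hs' hss' hs1 hY2 hB2 (hTmem t ht))
  have hpos : 0 < (520 * C0 / κ) ^ 3 := by positivity
  have h2 : (Y2.card : ℝ) * (n ^ 3 / 4 * m ^ 3) ≤ T.card * N4 * (520 * C0 / κ) ^ 3 := by
    rw [mul_div_assoc', div_le_iff₀ hpos] at h1
    exact h1
  have h3 : (T.card : ℝ) * N4 * (520 * C0 / κ) ^ 3 ≤ (Y.card * V ^ 2) * N4 * (520 * C0 / κ) ^ 3 := by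
    gcongr
  have e : (Y2.card : ℝ) * (n * m) ^ 3 = 4 * ((Y2.card : ℝ) * (n ^ 3 / 4 * m ^ 3)) := by ring
  rw [e]
  linarith

end CurveFam

/-- nested weighted pigeonhole -/
lemma nested_pigeon {κ τ : Type*} [DecidableEq τ] (Y1 : Finset κ) (hY1 : Y1.Nonempty)
    (G : κ → Finset ℤ) (hG : ∀ k ∈ Y1, (G k).Nonempty)
    (K : κ → ℤ → Finset κ) {M : ℝ} (hK : ∀ k ∈ Y1, ∀ i ∈ G k, (K k i).Nonempty ∧ M ≤ (K k i).card)
    (f : κ → ℤ → κ → τ) (w : τ → ℝ) (hw0 : ∀ t, 0 ≤ w t) (hw : ∀ T : Finset τ, ∑ t ∈ T, w t ≤ 1) :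
    ∃ t, ∃ Y2 ⊆ Y1, Y2.Nonempty ∧ w t * Y1.card ≤ Y2.card ∧ ∃ B2 : κ → Finset ℤ, ∀ k ∈ Y2,
      B2 k ⊆ G k ∧ (B2 k).Nonempty ∧ w t * (G k).card ≤ (B2 k).card ∧
      ∀ i ∈ B2 k, ((K k i).filter (fun k' => f k i k' = t)).Nonempty ∧
        w t * M ≤ ((K k i).filter (fun k' => f k i k' = t)).card := by
  classical
  have h1 : ∀ k i, ∃ t, k ∈ Y1 → i ∈ G k →
      w t * (K k i).card ≤ ((K k i).filter (fun k' => f k i k' = t)).card ∧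
      ((K k i).filter (fun k' => f k i k' = t)).Nonempty := by
    intro k i
    by_cases h : k ∈ Y1 ∧ i ∈ G k
    · obtain ⟨t, ht⟩ := weighted_pigeon (K k i) (hK k h.1 i h.2).1 (f k i) w hw
      exact ⟨t, fun _ _ => ht⟩
    · obtain ⟨k0, hk0⟩ := hY1
      obtain ⟨i0, hi0⟩ := hG k0 hk0
      obtain ⟨k1, _⟩ := (hK k0 hk0 i0 hi0).1
      exact ⟨f k0 i0 k1, fun a b => absurd ⟨a, b⟩ h⟩
  choose t1 ht1 using h1
  have h2 : ∀ k, ∃ t, k ∈ Y1 →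
      w t * (G k).card ≤ ((G k).filter (fun i => t1 k i = t)).card ∧
      ((G k).filter (fun i => t1 k i = t)).Nonempty := by
    intro k
    by_cases h : k ∈ Y1
    · obtain ⟨t, ht⟩ := weighted_pigeon (G k) (hG k h) (t1 k) w hw
      exact ⟨t, fun _ => ht⟩
    · exact ⟨t1 k 0, fun a => absurd a h⟩
  choose t2 ht2 using h2
  obtain ⟨t, hta, htb⟩ := weighted_pigeon Y1 hY1 t2 w hw
  refine ⟨t, Y1.filter (fun k => t2 k = t), Finset.filter_subset _ _, htb, hta,
    fun k => (G k).filter (fun i => t1 k i = t), ?_⟩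
  intro k hk
  obtain ⟨hk1, hk2⟩ := Finset.mem_filter.1 hk
  have h3 := ht2 k hk1
  rw [hk2] at h3
  refine ⟨Finset.filter_subset _ _, h3.2, h3.1, ?_⟩
  intro i hi
  obtain ⟨hi1, hi2⟩ := Finset.mem_filter.1 hi
  have h4 := ht1 k i hk1 hi1
  rw [hi2] at h4
  exact ⟨h4.2, (mul_le_mul_of_nonneg_left (hK k hk1 i hi1).2 (hw0 t)).trans h4.1⟩

open Classical in
/-- multiplicity -/
noncomputable def mult (δ : ℝ) (H0 : ℤ × ℤ → ℝ → ℝ) (Y : Finset (ℤ × ℤ)) (B : ℤ × ℤ → Finset ℤ)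
    (k : ℤ × ℤ) (i : ℤ) : ℕ := (Y.filter (fun k' => i ∈ B k' ∧ rowOf δ H0 k i = rowOf δ H0 k' i)).card

open Classical in
lemma mu_exists (δ : ℝ) (H0 : ℤ × ℤ → ℝ → ℝ) (Y : Finset (ℤ × ℤ)) (B : ℤ × ℤ → Finset ℤ)
    (hY : Y.Nonempty) (hB : ∀ k ∈ Y, (B k).Nonempty) {b : ℝ} (hb : ∀ k ∈ Y, b ≤ (B k).card)
    (hb0 : 0 ≤ b)
    (X : Finset (ℤ × ℤ)) (hX : ∀ k ∈ Y, ∀ i ∈ B k, (i, rowOf δ H0 k i) ∈ X) :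
    ∃ μ : ℕ, 1 ≤ μ ∧ (Y.card : ℝ) * b ≤ 4 * μ * X.card ∧ ∃ Y1 ⊆ Y, Y1.Nonempty ∧
      (Y.card : ℝ) ≤ 2 * Y1.card ∧
      ∀ k ∈ Y1, ((B k).filter (fun i => μ ≤ mult δ H0 Y B k i)).Nonempty ∧
        ((B k).card : ℝ) ≤ 2 * ((B k).filter (fun i => μ ≤ mult δ H0 Y B k i)).card := by
  set P : ℕ → Prop := fun μ => Y.card ≤ 2 * (Y.filter (fun k => (B k).card ≤
    2 * ((B k).filter (fun i => mult δ H0 Y B k i ≤ μ)).card)).card with hP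
  have hmY : ∀ k i, mult δ H0 Y B k i ≤ Y.card := fun k i => Finset.card_le_card (Finset.filter_subset _ _)
  have hex : ∃ μ, P μ := by
    refine ⟨Y.card, ?_⟩
    simp only [hP]
    have : Y.filter (fun k => (B k).card ≤
        2 * ((B k).filter (fun i => mult δ H0 Y B k i ≤ Y.card)).card) = Y := by
      apply Finset.filter_true_of_mem
      intro k _
      rw [Finset.filter_true_of_mem (fun i _ => hmY k i)]
      omega
    rw [this]; omega
  have hm1 : ∀ k ∈ Y, ∀ i ∈ B k, 1 ≤ mult δ H0 Y B k i := by
    intro k hk i hi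
    exact Finset.card_pos.2 ⟨k, Finset.mem_filter.2 ⟨hk, hi, rfl⟩⟩
  have h0 : ¬ P 0 := by
    simp only [hP]
    have : Y.filter (fun k => (B k).card ≤
        2 * ((B k).filter (fun i => mult δ H0 Y B k i ≤ 0)).card) = ∅ := by
      apply Finset.filter_false_of_mem
      intro k hk
      rw [Finset.filter_false_of_mem (fun i hi => by have := hm1 k hk i hi; omega)]
      have := Finset.card_pos.2 (hB k hk)
      simp only [Finset.card_empty]; omega
    rw [this]
    have := Finset.card_pos.2 hY
    simp only [Finset.card_empty]; omega
  set μ := Nat.find hex with hμ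
  have hPμ : P μ := Nat.find_spec hex
  have hμ1 : 1 ≤ μ := by
    by_contra h
    have : μ = 0 := by omega
    rw [this] at hPμ; exact h0 hPμ
  have hnP : ¬ P (μ - 1) := Nat.find_min hex (by omega)
  refine ⟨μ, hμ1, ?_, ?_⟩
  · set Y0 := Y.filter (fun k => (B k).card ≤
      2 * ((B k).filter (fun i => mult δ H0 Y B k i ≤ μ)).card) with hY0
    have hPμ' : Y.card ≤ 2 * Y0.card := hPμ
    have hdc := double_count Y0 X (fun k c => c.1 ∈ B k ∧ mult δ H0 Y B k c.1 ≤ μ ∧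
      c.2 = rowOf δ H0 k c.1) (m := b / 2) (M := μ) (by
        intro k hk
        obtain ⟨hkY, hk2⟩ := Finset.mem_filter.1 hk
        have h1 : ((B k).filter (fun i => mult δ H0 Y B k i ≤ μ)).card ≤
            (X.filter (fun c => c.1 ∈ B k ∧ mult δ H0 Y B k c.1 ≤ μ ∧
              c.2 = rowOf δ H0 k c.1)).card := by
          apply Finset.card_le_card_of_injOn (fun i => (i, rowOf δ H0 k i))
          · intro i hi
            rw [Finset.mem_coe, Finset.mem_filter] at hi
            rw [Finset.mem_coe, Finset.mem_filter]
            exact ⟨hX k hkY i hi.1, hi.1, hi.2, rfl⟩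
          · intro i _ j _ hij
            exact (Prod.ext_iff.1 hij).1
        have h2 := hb k hkY
        have h3 : ((B k).card : ℝ) ≤ 2 * ((B k).filter (fun i => mult δ H0 Y B k i ≤ μ)).card := by
          exact_mod_cast hk2
        have h4 : (((B k).filter (fun i => mult δ H0 Y B k i ≤ μ)).card : ℝ) ≤ _ := Nat.cast_le.2 h1
        linarith) (by
        intro c hc
        rcases (Y0.filter (fun k => c.1 ∈ B k ∧ mult δ H0 Y B k c.1 ≤ μ ∧
            c.2 = rowOf δ H0 k c.1)).eq_empty_or_nonempty with he | ⟨k, hk⟩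
        · rw [he]; simp
        · obtain ⟨_, _, hk3, hk4⟩ := Finset.mem_filter.1 hk
          refine Nat.cast_le.2 (le_trans (Finset.card_le_card ?_) hk3)
          intro k' hk'
          obtain ⟨a1, a2, _, a4⟩ := Finset.mem_filter.1 hk'
          exact Finset.mem_filter.2 ⟨(Finset.mem_filter.1 a1).1, a2, hk4.symm.trans a4⟩)
    have h5 : (Y.card : ℝ) ≤ 2 * Y0.card := by exact_mod_cast hPμ'
    nlinarith
  · refine ⟨Y.filter (fun k => ¬ (B k).card ≤
      2 * ((B k).filter (fun i => mult δ H0 Y B k i ≤ μ - 1)).card), Finset.filter_subset _ _, ?_⟩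
    have hsum := Finset.card_filter_add_card_filter_not (s := Y) (fun k => (B k).card ≤
      2 * ((B k).filter (fun i => mult δ H0 Y B k i ≤ μ - 1)).card)
    simp only [hP] at hnP
    have hYp := Finset.card_pos.2 hY
    refine ⟨?_, ?_, ?_⟩
    · rw [← Finset.card_pos]; omega
    · have : Y.card ≤ 2 * (Y.filter (fun k => ¬ (B k).card ≤
        2 * ((B k).filter (fun i => mult δ H0 Y B k i ≤ μ - 1)).card)).card := by omega
      exact_mod_cast this
    · intro k hk
      obtain ⟨hkY, hk2⟩ := Finset.mem_filter.1 hk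
      have hs2 := Finset.card_filter_add_card_filter_not (s := B k)
        (fun i => mult δ H0 Y B k i ≤ μ - 1)
      have he : (B k).filter (fun i => ¬ mult δ H0 Y B k i ≤ μ - 1)
          = (B k).filter (fun i => μ ≤ mult δ H0 Y B k i) := by
        apply Finset.filter_congr; intro i _; omega
      rw [he] at hs2
      refine ⟨?_, ?_⟩
      · rw [← Finset.card_pos]; omega
      · have : (B k).card ≤ 2 * ((B k).filter (fun i => μ ≤ mult δ H0 Y B k i)).card := by omega
        exact_mod_cast this

namespace CurveFam
variable {δ c0 C0 s : ℝ} {Y : Finset (ℤ × ℤ)} {H0 H1 H2 : ℤ × ℤ → ℝ → ℝ}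
  {B : ℤ × ℤ → Finset ℤ} {aL : ℤ × ℤ → ℝ}

lemma typ_exists (F : CurveFam δ c0 C0 Y H0 H1 H2) {k k' : ℤ × ℤ} (hk : k ∈ Y) (hk' : k' ∈ Y)
    {i : ℤ} (hi : (δ * i : ℝ) ∈ Icc 0 c0) (hrow : rowOf δ H0 k i = rowOf δ H0 k' i)
    (hfar : 8 * δ < jetd H0 H1 H2 k k') :
    ∃ t : ℕ × ℕ, Typ δ (C0 * (1 / 2) ^ t.1) (C0 * (1 / 2) ^ t.1 * (4 * (1 / 2) ^ t.2)) H0 H1 H2 k k' i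
      ∧ δ * (C0 * (1 / 2) ^ t.1) ≤ (C0 * (1 / 2) ^ t.1 * (4 * (1 / 2) ^ t.2)) ^ 2 := by
  have hδ := F.hδ0
  have hC0 := F.hC0
  have P := F.pair hk hk'
  have hr := rowOf_eq hδ hrow
  have hd := F.p6 k hk k' hk' _ hi (hr.trans (F.hδ1.trans (by norm_num)))
  obtain ⟨p, hp1, hp2⟩ := exists_dyadic (x := jetd H0 H1 H2 k k') (by linarith) hd
  set ρ := C0 * (1 / 2) ^ p with hρ
  have hρ0 : 0 < ρ := by positivity
  have h1 := P.h1_le hi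
  have hsq : 0 < √(δ / ρ) := Real.sqrt_pos.2 (by positivity)
  have hsq1 : √(δ / ρ) ≤ 1 := by
    rw [Real.sqrt_le_left (by norm_num), one_pow, div_le_one hρ0]; linarith
  set x := max (|H1 k (δ * i) - H1 k' (δ * i)| / ρ) (√(δ / ρ)) with hx
  obtain ⟨q, hq1, hq2⟩ := exists_dyadic (x := x) (C := 4) (lt_max_of_lt_right hsq)
    (max_le (by rw [div_le_iff₀ hρ0]; linarith) (by linarith))
  refine ⟨(p, q), ⟨hrow, hfar.le, by simp only; linarith, hp2, ?_, ?_⟩, ?_⟩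
  · simp only
    have := (le_max_left _ _).trans hq2
    rw [div_le_iff₀ hρ0] at this
    linarith
  · simp only
    rcases max_choice (|H1 k (δ * i) - H1 k' (δ * i)| / ρ) (√(δ / ρ)) with h | h
    · right
      rw [← hx] at h
      rw [h, lt_div_iff₀ hρ0] at hq1
      linarith
    · left
      rw [← hx] at h
      rw [h] at hq1
      have h3 : (4 * (1 / 2) ^ q / 2 : ℝ) ^ 2 ≤ δ / ρ := by
        rw [← Real.sq_sqrt (show 0 ≤ δ / ρ by positivity)]
        exact pow_le_pow_left₀ (by positivity) hq1.le 2
      rw [le_div_iff₀ hρ0] at h3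
      nlinarith
  · simp only
    have h2 := (le_max_right _ _).trans hq2
    have h3 : δ / ρ ≤ (4 * (1 / 2) ^ q : ℝ) ^ 2 := by
      rw [← Real.sq_sqrt (show 0 ≤ δ / ρ by positivity)]
      exact pow_le_pow_left₀ (by positivity) h2 2
    rw [div_le_iff₀ hρ0] at h3
    nlinarith

open Classical in
/-- number of near curves. -/
lemma near_count (F : CurveFam δ c0 C0 Y H0 H1 H2) {k : ℤ × ℤ} {r : ℝ} (hr : δ ≤ r) (S : Finset (ℤ × ℤ))
    (hS : S ⊆ Y) (h : ∀ k' ∈ S, jetd H0 H1 H2 k k' ≤ r) :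
    (S.card : ℝ) ≤ 20 * C0 ^ 2 * (r * r) / δ ^ 2 := by
  have hδ := F.hδ0
  have hC0 := F.hC0
  have hr0 := hδ.trans_le hr
  have hP : 1 ≤ C0 * r / δ := by rw [le_div_iff₀ hδ]; nlinarith
  have hd : ∀ a ∈ S, ∀ b ∈ S, jetd H0 H1 H2 b a ≤ 2 * r := by
    intro a ha b hb
    have := jetd_tri H0 H1 H2 b k a
    rw [jetd_comm H0 H1 H2 b k] at this
    linarith [h a ha, h b hb]
  have hb := card_box S (P := 2 * (C0 * r / δ)) (Q := 2 * (C0 * r / δ)) (by linarith) (by linarith)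
    (by
      intro a ha b hb
      have := (F.p5 b (hS hb) a (hS ha)).1
      have h4 := le_abs_self ((b.1 : ℝ) - a.1)
      have h5 := hd a ha b hb
      rw [mul_div_assoc', le_div_iff₀ hδ]
      nlinarith)
    (by
      intro a ha b hb _
      have := (F.p5 b (hS hb) a (hS ha)).2
      have h4 := le_abs_self ((b.2 : ℝ) - a.2)
      have h5 := hd a ha b hb
      rw [mul_div_assoc', le_div_iff₀ hδ]
      nlinarith)
  have e : 20 * C0 ^ 2 * (r * r) / δ ^ 2 = 20 * (C0 * r / δ) ^ 2 := by field_simp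
  rw [e]
  nlinarith

end CurveFam

lemma min_le_rpow_mul {x y a b : ℝ} (hx : 0 ≤ x) (hy : 0 ≤ y) (ha : 0 ≤ a) (hb : 0 ≤ b)
    (hab : a + b ≠ 0) :
    (min x y) ^ (a + b) ≤ x ^ a * y ^ b := by
  have h0 : 0 ≤ min x y := le_min hx hy
  rw [Real.rpow_add' h0 hab]
  exact mul_le_mul (Real.rpow_le_rpow h0 (min_le_left _ _) ha)
    (Real.rpow_le_rpow h0 (min_le_right _ _) hb) (Real.rpow_nonneg h0 _) (Real.rpow_nonneg hx _)

/-- numerology, transversal case -/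
lemma num_trans {α ε ε1 C0 c1 K L : ℝ} (hα : 1 / 2 < α) (hα1 : α ≤ 1)
    (he1 : 2 * ε1 ≤ 2 * α - 1) (he2 : 2 * ε1 ≤ ε) (he0 : 0 < ε1) (hC0 : 1 ≤ C0) (hc1 : 0 < c1)
    (hK : 0 < K) (hL : 0 < L) :
    ∃ A > 0, ∀ κ ρ s F w z : ℝ, 0 < κ → 0 < ρ → ρ ≤ C0 → ρ * s ≤ 32 * κ → 0 < s → s ≤ 1 → 0 < F →
      w = c1 * κ ^ ε1 → 0 ≤ z → w ^ 2 * z ≤ K * min F (L * (ρ * κ)) / κ →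
      z ≤ A * F ^ (1 - α) * s ^ (α - 1 - ε) := by
  refine ⟨K * L ^ α * c1⁻¹ ^ 2 * 32⁻¹ ^ (α - 1 - 2 * ε1) * C0 ^ (2 * α - 1 - 2 * ε1), by positivity, ?_⟩
  intro κ ρ s F w z hκ hρ hρC hρs hs hs1 hF hw hz h
  have hmin : min F (L * (ρ * κ)) ≤ F ^ (1 - α) * (L * (ρ * κ)) ^ α := by
    have := min_le_rpow_mul (x := F) (y := L * (ρ * κ)) (a := 1 - α) (b := α) hF.le (by positivity)
      (by linarith) (by linarith) (by norm_num)
    simpa using this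
  have hwpos : 0 < w ^ 2 := by rw [hw]; positivity
  have h1 : z ≤ K * (F ^ (1 - α) * (L * (ρ * κ)) ^ α) / κ / w ^ 2 := by
    rw [le_div_iff₀ hwpos, mul_comm]
    refine h.trans ?_
    gcongr
  have e1 : K * (F ^ (1 - α) * (L * (ρ * κ)) ^ α) / κ / w ^ 2
      = K * L ^ α * c1⁻¹ ^ 2 * F ^ (1 - α) * ρ ^ α * κ ^ (α - 1 - 2 * ε1) := by
    rw [hw, Real.mul_rpow hL.le (by positivity), Real.mul_rpow hρ.le hκ.le, mul_pow,
      ← Real.rpow_natCast (κ ^ ε1) 2, ← Real.rpow_mul hκ.le, Real.rpow_sub hκ, Real.rpow_sub hκ,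
      Real.rpow_one, mul_comm ε1]
    push_cast
    field_simp
  have h2 : κ ^ (α - 1 - 2 * ε1) ≤ (32⁻¹ * (ρ * s)) ^ (α - 1 - 2 * ε1) :=
    Real.rpow_le_rpow_of_nonpos (by positivity) (by linarith) (by linarith)
  have e2 : (32⁻¹ * (ρ * s)) ^ (α - 1 - 2 * ε1) =
      32⁻¹ ^ (α - 1 - 2 * ε1) * (ρ ^ (α - 1 - 2 * ε1) * s ^ (α - 1 - 2 * ε1)) := by
    rw [Real.mul_rpow (by positivity) (by positivity), Real.mul_rpow hρ.le hs.le]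
  have e3 : ρ ^ α * ρ ^ (α - 1 - 2 * ε1) = ρ ^ (2 * α - 1 - 2 * ε1) := by
    rw [← Real.rpow_add hρ]; congr 1; ring
  have h3 : ρ ^ (2 * α - 1 - 2 * ε1) ≤ C0 ^ (2 * α - 1 - 2 * ε1) :=
    Real.rpow_le_rpow hρ.le hρC (by linarith)
  have h4 : s ^ (α - 1 - 2 * ε1) ≤ s ^ (α - 1 - ε) :=
    Real.rpow_le_rpow_of_exponent_ge hs hs1 (by linarith)
  calc z ≤ _ := h1
    _ = _ := e1
    _ ≤ K * L ^ α * c1⁻¹ ^ 2 * F ^ (1 - α) * ρ ^ α * (32⁻¹ ^ (α - 1 - 2 * ε1) *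
          (ρ ^ (α - 1 - 2 * ε1) * s ^ (α - 1 - 2 * ε1))) := by
        rw [← e2]; gcongr
    _ = K * L ^ α * c1⁻¹ ^ 2 * F ^ (1 - α) * 32⁻¹ ^ (α - 1 - 2 * ε1) *
          ((ρ ^ α * ρ ^ (α - 1 - 2 * ε1)) * s ^ (α - 1 - 2 * ε1)) := by ring
    _ ≤ K * L ^ α * c1⁻¹ ^ 2 * F ^ (1 - α) * 32⁻¹ ^ (α - 1 - 2 * ε1) *
          (C0 ^ (2 * α - 1 - 2 * ε1) * s ^ (α - 1 - ε)) := by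
        rw [e3]; gcongr
    _ = _ := by ring

/-- numerology, tangential case -/
lemma num_tang {α ε ε1 C0 c1 K L : ℝ} (hα : 1 / 2 < α) (hα1 : α ≤ 1) (he : 0 < ε)
    (hm1 : ε1 * (7 + 7 / ε) ≤ 6 * α - 3) (hm2 : ε1 * (7 + 7 / ε) ≤ 3 * ε)
    (hm3 : ε1 * (7 + 7 / ε) ≤ 1) (hC0 : 1 ≤ C0) (hc1 : 0 < c1)
    (hK : 0 < K) (hL : 0 < L) :
    ∃ A > 0, ∀ κ ρ s s' F w z : ℝ, 0 < κ → 0 < ρ → ρ ≤ C0 → 32 * κ ≤ ρ * s → 0 < s → s ≤ 1 → 0 < F →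
      w = c1 * κ ^ ε1 → 0 ≤ z → s' = s / 6 * (w / 8) ^ (1 / ε) →
      w ^ 7 * z ^ 3 ≤ K * (min F (L * (ρ ^ 2 * s))) ^ 2 * (s / s') ^ 7 / s ^ 3 * (κ / ρ ^ 2) →
      z ≤ A * F ^ (1 - α) * s ^ (α - 1 - ε) := by
  set M := 7 + 7 / ε with hM
  set A3 := K * L ^ (3 * α - 1) * (6 * 8 ^ (1 / ε)) ^ 7 * c1⁻¹ ^ M * C0 ^ (6 * α - 3 - ε1 * M) with hA3
  have hA3pos : 0 < A3 := by positivity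
  refine ⟨A3 ^ (1 / 3 : ℝ), by positivity, ?_⟩
  intro κ ρ s s' F w z hκ hρ hρC hκs hs hs1 hF hw hz hs' h
  have hw0 : 0 < w := by rw [hw]; positivity
  have hmin : (min F (L * (ρ ^ 2 * s))) ^ 2 ≤ F ^ (3 * (1 - α)) * (L * (ρ ^ 2 * s)) ^ (3 * α - 1) := by
    have := min_le_rpow_mul (x := F) (y := L * (ρ ^ 2 * s)) (a := 3 * (1 - α)) (b := 3 * α - 1) hF.le
      (by positivity) (by linarith) (by linarith) (by norm_num; intro h; linarith)
    have e : 3 * (1 - α) + (3 * α - 1) = ((2 : ℕ) : ℝ) := by push_cast; ring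
    rw [e, Real.rpow_natCast] at this
    exact this
  have hss : (s / s') ^ 7 = (6 * 8 ^ (1 / ε)) ^ 7 * w ^ (-(7 / ε)) := by
    have : s / s' = (6 * 8 ^ (1 / ε)) * w ^ (-(1 / ε)) := by
      rw [hs', Real.div_rpow hw0.le (by norm_num), Real.rpow_neg hw0.le]
      field_simp
    rw [this, mul_pow, ← Real.rpow_natCast (w ^ (-(1 / ε))) 7, ← Real.rpow_mul hw0.le]
    congr 2
    push_cast; ring
  have hw7 : 0 < w ^ 7 := by positivity
  have h1 : z ^ 3 ≤ K * (F ^ (3 * (1 - α)) * (L * (ρ ^ 2 * s)) ^ (3 * α - 1)) *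
      ((6 * 8 ^ (1 / ε)) ^ 7 * w ^ (-(7 / ε))) / s ^ 3 * (κ / ρ ^ 2) / w ^ 7 := by
    rw [le_div_iff₀ hw7, mul_comm (z ^ 3)]
    refine h.trans ?_
    rw [hss]
    gcongr
  have ew : w ^ (-(7 / ε)) / w ^ 7 = c1⁻¹ ^ M * κ ^ (-(ε1 * M)) := by
    have : w ^ (-(7 / ε)) / w ^ 7 = w ^ (-M) := by
      rw [← Real.rpow_natCast w 7, ← Real.rpow_sub hw0]; congr 1; rw [hM]; push_cast; ring
    rw [this, hw, Real.mul_rpow hc1.le (by positivity), ← Real.rpow_mul hκ.le, Real.rpow_neg hc1.le,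
      Real.inv_rpow hc1.le]
    congr 2; ring
  have ek : κ ^ (-(ε1 * M)) * κ = κ ^ (1 - ε1 * M) := by
    rw [← Real.rpow_add_one hκ.ne']; congr 1; ring
  have h2 : κ ^ (1 - ε1 * M) ≤ (ρ * s) ^ (1 - ε1 * M) :=
    Real.rpow_le_rpow hκ.le (by linarith) (by linarith)
  have e3 : (L * (ρ ^ 2 * s)) ^ (3 * α - 1) * (ρ * s) ^ (1 - ε1 * M) / s ^ 3 / ρ ^ 2
      = L ^ (3 * α - 1) * (ρ ^ (6 * α - 3 - ε1 * M) * s ^ (3 * α - 3 - ε1 * M)) := by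
    rw [Real.mul_rpow hL.le (by positivity), Real.mul_rpow (by positivity) hs.le,
      Real.mul_rpow hρ.le hs.le, ← Real.rpow_natCast ρ 2, ← Real.rpow_mul hρ.le,
      ← Real.rpow_natCast s 3]
    have r1 : ρ ^ (6 * α - 3 - ε1 * M) = ρ ^ (((2 : ℕ) : ℝ) * (3 * α - 1)) * ρ ^ (1 - ε1 * M)
        / ρ ^ ((2 : ℕ) : ℝ) := by
      rw [← Real.rpow_add hρ, ← Real.rpow_sub hρ]; congr 1; push_cast; ring
    have r2 : s ^ (3 * α - 3 - ε1 * M) = s ^ (3 * α - 1) * s ^ (1 - ε1 * M)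
        / s ^ ((3 : ℕ) : ℝ) := by
      rw [← Real.rpow_add hs, ← Real.rpow_sub hs]; congr 1; push_cast; ring
    rw [r1, r2]
    have p1 : 0 < ρ ^ ((2 : ℕ) : ℝ) := by positivity
    have p2 : 0 < s ^ ((3 : ℕ) : ℝ) := by positivity
    field_simp
  have h3 : ρ ^ (6 * α - 3 - ε1 * M) ≤ C0 ^ (6 * α - 3 - ε1 * M) :=
    Real.rpow_le_rpow hρ.le hρC (by linarith)
  have h4 : s ^ (3 * α - 3 - ε1 * M) ≤ s ^ (3 * (α - 1 - ε)) :=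
    Real.rpow_le_rpow_of_exponent_ge hs hs1 (by linarith)
  have h5 : z ^ 3 ≤ A3 * F ^ (3 * (1 - α)) * s ^ (3 * (α - 1 - ε)) := by
    calc z ^ 3 ≤ _ := h1
      _ = K * F ^ (3 * (1 - α)) * (6 * 8 ^ (1 / ε)) ^ 7 * (L * (ρ ^ 2 * s)) ^ (3 * α - 1) *
          ((w ^ (-(7 / ε)) / w ^ 7) * κ) / s ^ 3 / ρ ^ 2 := by ring
      _ = K * F ^ (3 * (1 - α)) * (6 * 8 ^ (1 / ε)) ^ 7 * (L * (ρ ^ 2 * s)) ^ (3 * α - 1) *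
          (c1⁻¹ ^ M * κ ^ (1 - ε1 * M)) / s ^ 3 / ρ ^ 2 := by rw [ew, mul_assoc (c1⁻¹ ^ M), ek]
      _ ≤ K * F ^ (3 * (1 - α)) * (6 * 8 ^ (1 / ε)) ^ 7 * (L * (ρ ^ 2 * s)) ^ (3 * α - 1) *
          (c1⁻¹ ^ M * (ρ * s) ^ (1 - ε1 * M)) / s ^ 3 / ρ ^ 2 := by gcongr
      _ = K * F ^ (3 * (1 - α)) * (6 * 8 ^ (1 / ε)) ^ 7 * c1⁻¹ ^ M *
          ((L * (ρ ^ 2 * s)) ^ (3 * α - 1) * (ρ * s) ^ (1 - ε1 * M) / s ^ 3 / ρ ^ 2) := by ring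
      _ = K * F ^ (3 * (1 - α)) * (6 * 8 ^ (1 / ε)) ^ 7 * c1⁻¹ ^ M * (L ^ (3 * α - 1) *
          (ρ ^ (6 * α - 3 - ε1 * M) * s ^ (3 * α - 3 - ε1 * M))) := by rw [e3]
      _ ≤ K * F ^ (3 * (1 - α)) * (6 * 8 ^ (1 / ε)) ^ 7 * c1⁻¹ ^ M * (L ^ (3 * α - 1) *
          (C0 ^ (6 * α - 3 - ε1 * M) * s ^ (3 * (α - 1 - ε)))) := by gcongr
      _ = _ := by rw [hA3]; ring
  have h6 : (A3 ^ (1 / 3 : ℝ) * F ^ (1 - α) * s ^ (α - 1 - ε)) ^ 3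
      = A3 * F ^ (3 * (1 - α)) * s ^ (3 * (α - 1 - ε)) := by
    rw [mul_pow, mul_pow, ← Real.rpow_natCast, ← Real.rpow_natCast, ← Real.rpow_natCast,
      ← Real.rpow_mul hA3pos.le, ← Real.rpow_mul hF.le, ← Real.rpow_mul hs.le]
    push_cast
    rw [mul_comm (1 - α), mul_comm (α - 1 - ε)]
    norm_num
  rw [← h6] at h5
  exact le_of_pow_le_pow_left₀ (by norm_num) (by positivity) h5

namespace CurveFam
variable {δ c0 C0 s : ℝ} {Y : Finset (ℤ × ℤ)} {H0 H1 H2 : ℤ × ℤ → ℝ → ℝ}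
  {B : ℤ × ℤ → Finset ℤ} {aL : ℤ × ℤ → ℝ}

open Classical in
lemma typed (F : CurveFam δ c0 C0 Y H0 H1 H2) (G : ColData δ c0 s Y B aL) {μ : ℕ}
    {Y1 : Finset (ℤ × ℤ)} (hY1 : Y1 ⊆ Y) (hne : Y1.Nonempty) (hc : (Y.card : ℝ) ≤ 2 * Y1.card)
    (hμ : ∀ k ∈ Y1, ((B k).filter (fun i => μ ≤ mult δ H0 Y B k i)).Nonempty ∧
        ((B k).card : ℝ) ≤ 2 * ((B k).filter (fun i => μ ≤ mult δ H0 Y B k i)).card)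
    {θ : ℝ} (hθ0 : 0 < θ) (hθ1 : θ < 1) :
    (μ : ℝ) ≤ 2560 * C0 ^ 2 ∨ ∃ t : ℕ × ℕ, ∃ ρ κ w : ℝ, ρ = C0 * (1 / 2) ^ t.1 ∧
      κ = C0 * (1 / 2) ^ t.1 * (4 * (1 / 2) ^ t.2) ∧ w = (1 - θ) ^ 2 * θ ^ (t.1 + t.2) ∧
      8 * δ ≤ ρ ∧ δ * ρ ≤ κ ^ 2 ∧
      ∃ Y2 ⊆ Y, Y2.Nonempty ∧ w / 2 * Y.card ≤ Y2.card ∧ ∃ B2 : ℤ × ℤ → Finset ℤ, ∀ k ∈ Y2,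
        B2 k ⊆ B k ∧ w / 2 * (B k).card ≤ (B2 k).card ∧
        ∀ i ∈ B2 k, w / 2 * μ ≤
          ((Y.filter (fun k' => i ∈ B k' ∧ Typ δ ρ κ H0 H1 H2 k k' i)).card : ℝ) := by
  by_cases hsm : (μ : ℝ) ≤ 2560 * C0 ^ 2
  · exact Or.inl hsm
  right
  push Not at hsm
  have hδ := F.hδ0
  have hC0 := F.hC0
  set R : ℤ × ℤ → ℤ → ℤ × ℤ → ℕ × ℕ → Prop := fun k i k' t =>
    Typ δ (C0 * (1 / 2) ^ t.1) (C0 * (1 / 2) ^ t.1 * (4 * (1 / 2) ^ t.2)) H0 H1 H2 k k' i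
      ∧ δ * (C0 * (1 / 2) ^ t.1) ≤ (C0 * (1 / 2) ^ t.1 * (4 * (1 / 2) ^ t.2)) ^ 2 with hR
  set f : ℤ × ℤ → ℤ → ℤ × ℤ → ℕ × ℕ := fun k i k' =>
    if h : ∃ t, R k i k' t then h.choose else (0, 0) with hf
  have hfs : ∀ k i k', (∃ t, R k i k' t) → R k i k' (f k i k') := by
    intro k i k' h
    simp only [hf, dif_pos h]
    exact h.choose_spec
  set K : ℤ × ℤ → ℤ → Finset (ℤ × ℤ) := fun k i => Y.filter (fun k' =>
    (i ∈ B k' ∧ rowOf δ H0 k i = rowOf δ H0 k' i) ∧ 8 * δ < jetd H0 H1 H2 k k') with hKdef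
  have hKt : ∀ k ∈ Y1, ∀ i ∈ B k, ∀ k' ∈ K k i, R k i k' (f k i k') := by
    intro k hk i hi k' hk'
    simp only [hKdef, Finset.mem_filter] at hk'
    exact hfs k i k' (F.typ_exists (hY1 hk) hk'.1 (G.hcol k (hY1 hk) i hi) hk'.2.1.2 hk'.2.2)
  have hKc : ∀ k ∈ Y1, ∀ i ∈ (B k).filter (fun i => μ ≤ mult δ H0 Y B k i),
      (K k i).Nonempty ∧ (μ : ℝ) / 2 ≤ (K k i).card := by
    intro k hk i hi
    rw [Finset.mem_filter] at hi
    have h2 : (μ : ℝ) ≤ mult δ H0 Y B k i := by exact_mod_cast hi.2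
    unfold mult at h2
    have h3 := Finset.card_filter_add_card_filter_not (s := Y.filter (fun k' => i ∈ B k' ∧ rowOf δ H0 k i = rowOf δ H0 k' i))
      (fun k' => 8 * δ < jetd H0 H1 H2 k k')
    rw [Finset.filter_filter] at h3
    have h4 := F.near_count (k := k) (r := 8 * δ) (by linarith)
      ((Y.filter (fun k' => i ∈ B k' ∧ rowOf δ H0 k i = rowOf δ H0 k' i)).filter
        (fun k' => ¬ 8 * δ < jetd H0 H1 H2 k k'))
      ((Finset.filter_subset _ _).trans (Finset.filter_subset _ _))
      (by
        intro k' hk'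
        rw [Finset.mem_filter] at hk'
        exact not_lt.1 hk'.2)
    have e : 20 * C0 ^ 2 * (8 * δ * (8 * δ)) / δ ^ 2 = 1280 * C0 ^ 2 := by field_simp; ring
    rw [e] at h4
    have h5 := congrArg (Nat.cast : ℕ → ℝ) h3
    push_cast at h5
    have h6 : (μ : ℝ) / 2 ≤ (K k i).card := by simp only [hKdef]; linarith
    refine ⟨?_, h6⟩
    rw [← Finset.card_pos]
    have : (0 : ℝ) < (K k i).card := lt_of_lt_of_le (by nlinarith) h6
    exact_mod_cast this
  obtain ⟨t, Y2, hY2, hY2n, hw2, B2, hB2⟩ := nested_pigeon Y1 hne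
    (fun k => (B k).filter (fun i => μ ≤ mult δ H0 Y B k i)) (fun k hk => (hμ k hk).1) K hKc f
    (fun t : ℕ × ℕ => (1 - θ) ^ 2 * θ ^ (t.1 + t.2)) (fun t => by positivity)
    (fun T => geom2_fin_le hθ0.le hθ1 T)
  refine ⟨t, _, _, _, rfl, rfl, rfl, ?_⟩
  have hw0 : 0 ≤ (1 - θ) ^ 2 * θ ^ (t.1 + t.2) := by positivity
  obtain ⟨k0, hk0⟩ := hY2n
  obtain ⟨hb1, ⟨i0, hi0⟩, hb2, hb3⟩ := hB2 k0 hk0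
  obtain ⟨⟨k1, hk1⟩, _⟩ := hb3 i0 hi0
  rw [Finset.mem_filter] at hk1
  have hr := hKt k0 (hY2 hk0) i0 (Finset.mem_filter.1 (hb1 hi0)).1 k1 hk1.1
  rw [hk1.2] at hr
  refine ⟨hr.1.far.trans hr.1.hi, hr.2, Y2, hY2.trans hY1, ⟨k0, hk0⟩, ?_, B2, ?_⟩
  · calc (1 - θ) ^ 2 * θ ^ (t.1 + t.2) / 2 * (Y.card : ℝ)
        ≤ (1 - θ) ^ 2 * θ ^ (t.1 + t.2) / 2 * (2 * Y1.card) := by gcongr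
      _ = (1 - θ) ^ 2 * θ ^ (t.1 + t.2) * Y1.card := by ring
      _ ≤ _ := hw2
  · intro k hk
    obtain ⟨hb1, _, hb2, hb3⟩ := hB2 k hk
    refine ⟨hb1.trans (Finset.filter_subset _ _), ?_, ?_⟩
    · calc (1 - θ) ^ 2 * θ ^ (t.1 + t.2) / 2 * ((B k).card : ℝ)
        ≤ (1 - θ) ^ 2 * θ ^ (t.1 + t.2) / 2 *
            (2 * ((B k).filter (fun i => μ ≤ mult δ H0 Y B k i)).card) := by
              have := (hμ k (hY2 hk)).2
              exact mul_le_mul_of_nonneg_left this (by positivity)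
      _ = (1 - θ) ^ 2 * θ ^ (t.1 + t.2) * ((B k).filter (fun i => μ ≤ mult δ H0 Y B k i)).card := by ring
      _ ≤ _ := hb2
    · intro i hi
      have h4 := (hb3 i hi).2
      have e : (1 - θ) ^ 2 * θ ^ (t.1 + t.2) / 2 * (μ : ℝ) = (1 - θ) ^ 2 * θ ^ (t.1 + t.2) * (μ / 2) := by ring
      rw [e]
      refine h4.trans (Nat.cast_le.2 (Finset.card_le_card ?_))
      intro k' hk'
      rw [Finset.mem_filter] at hk'
      have hr := hKt k (hY2 hk) i (Finset.mem_filter.1 (hb1 hi)).1 k' hk'.1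
      rw [hk'.2] at hr
      have h5 := hk'.1
      simp only [hKdef, Finset.mem_filter] at h5
      rw [Finset.mem_filter]
      exact ⟨h5.1, h5.2.1.1, hr.1⟩

end CurveFam

lemma aux_s_low {δ κ ρ s C0 : ℝ} (hκ0 : 0 < κ) (hρ0 : 0 < ρ) (hρC : ρ ≤ C0) (hC0 : 1 ≤ C0)
    (hδκ : δ * ρ ≤ κ ^ 2) (htg : 32 * κ ≤ ρ * s) : δ ≤ (s * C0) ^ 2 := by
  have j1 : (32 * κ) ^ 2 ≤ (ρ * s) ^ 2 := pow_le_pow_left₀ (by positivity) htg 2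
  have j2 : δ * ρ ≤ (ρ * s ^ 2) * ρ := by nlinarith [sq_nonneg κ]
  have j3 : δ ≤ ρ * s ^ 2 := le_of_mul_le_mul_right j2 hρ0
  have j4 : ρ * s ^ 2 ≤ C0 * s ^ 2 := by gcongr
  have j5 : C0 * s ^ 2 ≤ (C0 * C0) * s ^ 2 := by
    have := sq_nonneg s
    gcongr
    nlinarith
  nlinarith

namespace CurveFam
variable {δ c0 C0 s : ℝ} {Y : Finset (ℤ × ℤ)} {H0 H1 H2 : ℤ × ℤ → ℝ → ℝ}
  {B : ℤ × ℤ → Finset ℤ} {aL : ℤ × ℤ → ℝ}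

lemma card_B (F : CurveFam δ c0 C0 Y H0 H1 H2) (G : ColData δ c0 s Y B aL) (hδs : δ ≤ s) (hs1 : s ≤ 1)
    {k : ℤ × ℤ} (hk : k ∈ Y) : ((B k).card : ℝ) ≤ 2 / δ := by
  have hδ := F.hδ0
  have h := card_int_diam (S := B k) (P := s / δ) (by have := hδ.le.trans hδs; positivity) (by
    intro a ha b hb
    have h1 := G.hJ k hk a ha
    have h2 := G.hJ k hk b hb
    rw [le_div_iff₀ hδ]
    nlinarith)
  refine h.trans ?_
  rw [div_add_one hδ.ne']
  gcongr
  linarith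

lemma F_ge (F : CurveFam δ c0 C0 Y H0 H1 H2) (hne : Y.Nonempty) {α ε : ℝ} (hα : 1 / 2 < α) (hα1 : α ≤ 1)
    (hε : 0 < ε) (hs : 0 < s) (hs1 : s ≤ 1) :
    δ ≤ (δ ^ 2 * Y.card) ^ (1 - α) * s ^ (α - 1 - ε) := by
  have hδ := F.hδ0
  have h1 : (1 : ℝ) ≤ Y.card := by exact_mod_cast hne.card_pos
  have h2 : δ ≤ (δ ^ 2 * Y.card) ^ (1 - α) := by
    calc δ = δ ^ (1 : ℝ) := (Real.rpow_one _).symm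
      _ ≤ δ ^ (2 * (1 - α)) := Real.rpow_le_rpow_of_exponent_ge hδ (F.hδ1.trans (by norm_num)) (by linarith)
      _ = (δ ^ 2) ^ (1 - α) := by
        rw [Real.rpow_mul hδ.le]; norm_num
      _ ≤ _ := Real.rpow_le_rpow (by positivity) (by nlinarith [sq_nonneg δ]) (by linarith)
  have h3 : 1 ≤ s ^ (α - 1 - ε) := Real.one_le_rpow_of_pos_of_le_one_of_nonpos hs hs1 (by linarith)
  nlinarith

set_option maxHeartbeats 1000000 in
open Classical in
lemma mult_bound {C0 α ε : ℝ} (hC0 : 1 ≤ C0) (hα : 1 / 2 < α) (hα1 : α ≤ 1) (hε : 0 < ε) :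
    ∃ A > 0, ∀ (δ c0 s : ℝ) (Y : Finset (ℤ × ℤ)) (H0 H1 H2 : ℤ × ℤ → ℝ → ℝ)
      (B : ℤ × ℤ → Finset ℤ) (aL : ℤ × ℤ → ℝ) (μ : ℕ) (Y1 : Finset (ℤ × ℤ)) (b : ℝ),
      CurveFam δ c0 C0 Y H0 H1 H2 → ColData δ c0 s Y B aL → δ ≤ s → s ≤ 1 →
      Y1 ⊆ Y → Y1.Nonempty → (Y.card : ℝ) ≤ 2 * Y1.card →
      (∀ k ∈ Y1, ((B k).filter (fun i => μ ≤ mult δ H0 Y B k i)).Nonempty ∧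
        ((B k).card : ℝ) ≤ 2 * ((B k).filter (fun i => μ ≤ mult δ H0 Y B k i)).card) →
      (∀ k ∈ Y, ∀ a : ℤ, ∀ r : ℝ, δ ≤ r →
        (((B k).filter (fun b : ℤ => |(δ * a : ℝ) - δ * b| < r)).card : ℝ) ≤ (B k).card * (6 * r / s) ^ ε) →
      (∀ k ∈ Y, b ≤ (B k).card) → 0 ≤ b →
      b * μ * δ ^ 2 ≤ A * ((δ ^ 2 * Y.card) ^ (1 - α) * s ^ (α - 1 - ε)) := by
  set M := 7 + 7 / ε with hM
  have hM7 : 7 ≤ M := by have : 0 < 7 / ε := by positivity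
                         linarith
  set ν := min (2 * α - 1) (min ε 1) with hν
  have hν0 : 0 < ν := lt_min (by linarith) (lt_min hε one_pos)
  have hν1 : ν ≤ 2 * α - 1 := min_le_left _ _
  have hν2 : ν ≤ ε := (min_le_right _ _).trans (min_le_left _ _)
  have hν3 : ν ≤ 1 := (min_le_right _ _).trans (min_le_right _ _)
  set ε1 := ν / (4 * M) with hε1
  have hε10 : 0 < ε1 := by positivity
  have hεM : ε1 * M = ν / 4 := by rw [hε1]; field_simp
  have h7 : 7 * ε1 ≤ ν / 4 := by nlinarith
  have hεε : ε1 / ε ≤ 1 / 4 := by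
    have : ε1 * M = 7 * ε1 + 7 * (ε1 / ε) := by rw [hM]; ring
    linarith
  set θ : ℝ := (1 / 2) ^ ε1 with hθ
  have hθ0 : 0 < θ := by positivity
  have hθ1 : θ < 1 := Real.rpow_lt_one (by norm_num) (by norm_num) hε10
  set c1 := (1 - θ) ^ 2 * (4 * C0)⁻¹ ^ ε1 with hc1
  have h1θ : 0 < 1 - θ := by linarith
  have hc10 : 0 < c1 := by positivity
  obtain ⟨At, hAt0, hAt⟩ := num_trans (α := α) (ε := ε) (ε1 := ε1) (C0 := C0) (c1 := c1)
    (K := 4 * (520 * C0)) (L := 2112 * C0 ^ 2) hα hα1 (by linarith) (by linarith) hε10 hC0 hc10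
    (by positivity) (by positivity)
  obtain ⟨Ag, hAg0, hAg⟩ := num_tang (α := α) (ε := ε) (ε1 := ε1) (C0 := C0) (c1 := c1)
    (K := 128 * 4 * 8 * 14 ^ 3 * 4 * 2560 * 5610 * 520 ^ 3 * C0 ^ 5) (L := 512 * C0 ^ 2) hα hα1 hε
    (by rw [← hM]; linarith) (by rw [← hM]; linarith) (by rw [← hM]; linarith) hC0 hc10
    (by positivity) (by positivity)
  set c2 := (c1 / 8) ^ (1 / ε) / (6 * C0) with hc2
  have hc20 : 0 < c2 := by positivity
  set δ0 := c2 ^ 4 with hδ0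
  have hδ00 : 0 < δ0 := by positivity
  refine ⟨5120 * C0 ^ 2 + 40 * C0 ^ 4 / δ0 ^ 2 + At + Ag, by positivity, ?_⟩
  intro δ c0 s Y H0 H1 H2 B aL μ Y1 b F G hδs hs1 hY1 hne hc hμ hTE hb hb0
  have hδ := F.hδ0
  have hs0 : 0 < s := hδ.trans_le hδs
  have hYne : Y.Nonempty := hne.mono hY1
  have hFg := F.F_ge (s := s) hYne hα hα1 hε hs0 hs1
  set R := (δ ^ 2 * (Y.card : ℝ)) ^ (1 - α) * s ^ (α - 1 - ε) with hR
  have hR0 : 0 < R := hδ.trans_le hFg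
  have hYc : (0 : ℝ) < Y.card := by exact_mod_cast hYne.card_pos
  obtain ⟨k0, hk0⟩ := hne
  have hb2 : b ≤ 2 / δ := (hb k0 (hY1 hk0)).trans (F.card_B G hδs hs1 (hY1 hk0))
  have hμ0 : (0 : ℝ) ≤ μ := Nat.cast_nonneg _
  suffices H : b * μ * δ ^ 2 ≤ 5120 * C0 ^ 2 * R ∨ b * μ * δ ^ 2 ≤ 40 * C0 ^ 4 / δ0 ^ 2 * R ∨
      b * μ * δ ^ 2 ≤ At * R ∨ b * μ * δ ^ 2 ≤ Ag * R by
    have i1 : 0 ≤ 5120 * C0 ^ 2 * R := by positivity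
    have i2 : 0 ≤ 40 * C0 ^ 4 / δ0 ^ 2 * R := by positivity
    have i3 : 0 ≤ At * R := by positivity
    have i4 : 0 ≤ Ag * R := by positivity
    rcases H with H | H | H | H <;> linarith
  have hbδ : b * δ ≤ 2 := by rwa [le_div_iff₀ hδ] at hb2
  rcases F.typed G hY1 ⟨k0, hk0⟩ hc hμ hθ0 hθ1 with hnear | ⟨t, ρ, κ, w, hρ, hκ, hw, hδρ, hδκ, Y2, hY2, ⟨k2, hk2⟩, hY2c, B2, hB2⟩
  · left
    calc b * μ * δ ^ 2 = (b * δ) * μ * δ := by ring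
      _ ≤ 2 * (2560 * C0 ^ 2) * R := by gcongr
      _ = _ := by ring
  right
  by_cases hbig : δ0 ≤ δ
  · left
    obtain ⟨⟨i, hi⟩, _⟩ := hμ k0 hk0
    rw [Finset.mem_filter] at hi
    have h1 : (μ : ℝ) ≤ mult δ H0 Y B k0 i := by exact_mod_cast hi.2
    have h2 : (mult δ H0 Y B k0 i : ℝ) ≤ 20 * C0 ^ 2 * (C0 * C0) / δ ^ 2 := by
      unfold mult
      refine F.near_count (k := k0) (F.hδ1.trans (by linarith)) _ (Finset.filter_subset _ _) ?_
      intro k' hk'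
      rw [Finset.mem_filter] at hk'
      exact F.p6 k0 (hY1 hk0) k' hk'.1 _ (G.hcol k0 (hY1 hk0) i hi.1)
        ((rowOf_eq hδ hk'.2.2).trans (F.hδ1.trans (by norm_num)))
    have h3 : (μ : ℝ) * δ ^ 2 ≤ 20 * C0 ^ 4 := by
      have := h1.trans h2
      rw [le_div_iff₀ (by positivity)] at this
      linarith
    have hb3 : b ≤ 2 / δ0 := hb2.trans (by gcongr)
    calc b * μ * δ ^ 2 = b * (μ * δ ^ 2) := by ring
      _ ≤ (2 / δ0) * (20 * C0 ^ 4) := by gcongr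
      _ = 40 * C0 ^ 4 / δ0 ^ 2 * δ0 := by field_simp; ring
      _ ≤ _ := by gcongr; linarith
  push Not at hbig
  right
  have hρ0 : 0 < ρ := by linarith
  have hρC : ρ ≤ C0 := by
    rw [hρ]
    exact mul_le_of_le_one_right (by linarith) (pow_le_one₀ (by norm_num) (by norm_num))
  have hκ0 : 0 < κ := by rw [hκ]; positivity
  have hκρ : κ ≤ 4 * ρ := by
    rw [hκ, ← hρ]
    have : (1 / 2 : ℝ) ^ t.2 ≤ 1 := pow_le_one₀ (by norm_num) (by norm_num)
    calc ρ * (4 * (1 / 2) ^ t.2) ≤ ρ * (4 * 1) := by gcongr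
      _ = 4 * ρ := by ring
  have hδκ1 : δ ≤ κ := by
    by_contra hh
    push Not at hh
    have h1 : κ ^ 2 < δ ^ 2 := pow_lt_pow_left₀ hh hκ0.le (by norm_num)
    have h2 : δ * δ ≤ δ * ρ := by gcongr; linarith
    linarith [sq δ]
  have hwc : w = c1 * κ ^ ε1 := by
    have e1 : κ = (4 * C0) * (1 / 2) ^ (t.1 + t.2) := by rw [hκ, pow_add]; ring
    have e2 : κ ^ ε1 = (4 * C0) ^ ε1 * θ ^ (t.1 + t.2) := by
      rw [e1, Real.mul_rpow (by positivity) (by positivity), hθ, ← Real.rpow_natCast, ← Real.rpow_natCast,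
        ← Real.rpow_mul (by norm_num), ← Real.rpow_mul (by norm_num), mul_comm ε1]
    rw [hw, hc1, e2, Real.inv_rpow (by positivity)]
    have : (4 * C0) ^ ε1 ≠ 0 := by positivity
    field_simp
  have hw0 : 0 < w := by rw [hwc]; positivity
  have hw1 : w ≤ 1 := by
    rw [hw]
    have i1 : (1 - θ) ^ 2 ≤ 1 := pow_le_one₀ h1θ.le (by linarith)
    have i2 : θ ^ (t.1 + t.2) ≤ 1 := pow_le_one₀ hθ0.le hθ1.le
    have i3 : 0 < θ ^ (t.1 + t.2) := by positivity
    calc _ ≤ (1 : ℝ) * 1 := by gcongr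
      _ = 1 := one_mul 1
  set Fv := δ ^ 2 * (Y.card : ℝ) with hFv
  have hFv0 : 0 < Fv := by positivity
  have hn : ∀ k ∈ Y2, w / 2 * b ≤ (B2 k).card := fun k hk =>
    (mul_le_mul_of_nonneg_left (hb k (hY2 hk)) (by positivity)).trans (hB2 k hk).2.1
  have hz0 : 0 ≤ b * μ * δ ^ 2 := by positivity
  rcases le_total (ρ * s) (32 * κ) with htr | htg
  · left
    have h1 := F.transversal G hδκ1 hκρ hρC (by linarith) htr (hY2 hk2) (hB2 k2 hk2).1 (hB2 k2 hk2).2.2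
    have h2 : w / 2 * b * (w / 2 * μ) ≤ _ := (mul_le_mul_of_nonneg_right (hn k2 hk2) (by positivity)).trans h1
    have h3 := hAt κ ρ s Fv w (b * μ * δ ^ 2) hκ0 hρ0 hρC htr hs0 hs1 hFv0 hwc hz0 (by
      have e : min Fv (2112 * C0 ^ 2 * (ρ * κ)) = δ ^ 2 * min (Y.card : ℝ) (2112 * C0 ^ 2 * (ρ * κ) / δ ^ 2) := by
        rw [mul_min_of_nonneg _ _ (by positivity)]
        congr 1
        field_simp
      rw [e]
      calc w ^ 2 * (b * μ * δ ^ 2) = 4 * δ ^ 2 * (w / 2 * b * (w / 2 * μ)) := by ring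
        _ ≤ 4 * δ ^ 2 * (min (Y.card : ℝ) (2112 * C0 ^ 2 * (ρ * κ) / δ ^ 2) * (520 * C0 / κ)) := by gcongr
        _ = _ := by ring)
    rw [hR]; linarith
  · right
    set s' := s / 6 * (w / 8) ^ (1 / ε) with hs'
    have hs'0 : 0 < s' := by positivity
    have hs's : s' ≤ s := by
      have : (w / 8) ^ (1 / ε) ≤ 1 := Real.rpow_le_one (by positivity) (by linarith) (by positivity)
      rw [hs']
      calc s / 6 * (w / 8) ^ (1 / ε) ≤ s / 6 * 1 := by gcongr
        _ ≤ s := by linarith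
    have hδs' : δ ≤ s' := by
      have g1 : δ ≤ 1 := F.hδ1.trans (by norm_num)
      have g2 : c1 / 8 * δ ^ ε1 ≤ w / 8 := by
        have : δ ^ ε1 ≤ κ ^ ε1 := Real.rpow_le_rpow hδ.le hδκ1 hε10.le
        have h8 : 0 ≤ c1 / 8 := by positivity
        have := mul_le_mul_of_nonneg_left this h8
        rw [hwc]; linarith
      have g3 : (c1 / 8) ^ (1 / ε) * δ ^ (1 / 4 : ℝ) ≤ (w / 8) ^ (1 / ε) := by
        calc (c1 / 8) ^ (1 / ε) * δ ^ (1 / 4 : ℝ) ≤ (c1 / 8) ^ (1 / ε) * δ ^ (ε1 * (1 / ε)) := by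
              have := Real.rpow_le_rpow_of_exponent_ge hδ g1 (show ε1 * (1 / ε) ≤ 1 / 4 by
                rw [mul_one_div]; exact hεε)
              gcongr
          _ = (c1 / 8 * δ ^ ε1) ^ (1 / ε) := by
              rw [Real.mul_rpow (by positivity) (by positivity), ← Real.rpow_mul hδ.le]
          _ ≤ _ := Real.rpow_le_rpow (by positivity) g2 (by positivity)
      have g4 : δ ^ (1 / 2 : ℝ) / C0 ≤ s := by
        rw [div_le_iff₀ (by linarith)]
        have : δ ≤ (s * C0) ^ 2 := aux_s_low hκ0 hρ0 hρC hC0 hδκ htg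
        rw [← Real.sqrt_eq_rpow]
        exact Real.sqrt_le_iff.2 ⟨by positivity, this⟩
      have g5 : δ ^ (1 / 4 : ℝ) ≤ c2 := by
        calc δ ^ (1 / 4 : ℝ) ≤ δ0 ^ (1 / 4 : ℝ) := Real.rpow_le_rpow hδ.le hbig.le (by norm_num)
          _ = c2 := by
            rw [hδ0, ← Real.rpow_natCast, ← Real.rpow_mul hc20.le]; norm_num
      have g6 : δ = δ ^ (1 / 2 : ℝ) * δ ^ (1 / 4 : ℝ) * δ ^ (1 / 4 : ℝ) := by
        rw [← Real.rpow_add hδ, ← Real.rpow_add hδ]; norm_num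
      calc δ = δ ^ (1 / 2 : ℝ) * δ ^ (1 / 4 : ℝ) * δ ^ (1 / 4 : ℝ) := g6
        _ ≤ δ ^ (1 / 2 : ℝ) * δ ^ (1 / 4 : ℝ) * c2 := by gcongr
        _ = (δ ^ (1 / 2 : ℝ) / C0) / 6 * ((c1 / 8) ^ (1 / ε) * δ ^ (1 / 4 : ℝ)) := by
          rw [hc2]; field_simp
        _ ≤ s / 6 * (w / 8) ^ (1 / ε) := by gcongr
    have hτ : δ ≤ κ ^ 2 / ρ := by rwa [le_div_iff₀ hρ0]
    have h1 := F.tangential G (τ := κ ^ 2 / ρ) hδκ1 hρC htg (by field_simp; rfl) hτ hs'0 hs's hs1 hY2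
      (fun k hk => (hB2 k hk).1) (n := w / 2 * b) (m := w / 2 * μ) (by positivity) (by positivity) hn
      (fun k hk => (hB2 k hk).2.2) (by
        intro k hk a
        have h1 := hTE k (hY2 hk) a s' hδs'
        have e : (6 * s' / s) ^ ε = w / 8 := by
          have : 6 * s' / s = (w / 8) ^ (1 / ε) := by rw [hs']; field_simp
          rw [this, ← Real.rpow_mul (by positivity), one_div, inv_mul_cancel₀ hε.ne', Real.rpow_one]
        rw [e] at h1
        have h2 := (hB2 k hk).2.1
        have h3 : (((B2 k).filter (fun b : ℤ => |(δ * a : ℝ) - δ * b| < s')).card : ℝ) ≤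
          ((B k).filter (fun b : ℤ => |(δ * a : ℝ) - δ * b| < s')).card :=
          Nat.cast_le.2 (Finset.card_le_card (Finset.filter_subset_filter _ (hB2 k hk).1))
        linarith)
    set V := min (Y.card : ℝ) (512 * C0 ^ 2 * (ρ ^ 2 * s) / δ ^ 2) with hV
    have hV0 : 0 ≤ V := le_min (by positivity) (by positivity)
    have h3 := hAg κ ρ s s' Fv w (b * μ * δ ^ 2) hκ0 hρ0 hρC htg hs0 hs1 hFv0 hwc hz0 hs' (by
      have e : min Fv (512 * C0 ^ 2 * (ρ ^ 2 * s)) = δ ^ 2 * V := by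
        rw [hV, mul_min_of_nonneg _ _ (by positivity)]
        congr 1
        field_simp
      rw [e]
      have h2 : (w / 2 * (Y.card : ℝ)) * (w / 2 * b * (w / 2 * μ)) ^ 3 ≤ _ :=
        (mul_le_mul_of_nonneg_right hY2c (by positivity)).trans h1
      have h4 : w / 2 * (w / 2 * b * (w / 2 * μ)) ^ 3 ≤ 4 * (V ^ 2
        * ((8 * (14 * (s / s')) ^ 3) * (4 * C0 ^ 2 * 2560 * 5610 * ((κ ^ 2 / ρ) ^ 2 * s) / (s' ^ 4 * δ ^ 2)))
        * (520 * C0 / κ) ^ 3) := by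
        refine le_of_mul_le_mul_left ?_ hYc
        calc _ = (w / 2 * (Y.card : ℝ)) * (w / 2 * b * (w / 2 * μ)) ^ 3 := by ring
          _ ≤ _ := h2
          _ = _ := by ring
      calc w ^ 7 * (b * μ * δ ^ 2) ^ 3 = 128 * δ ^ 6 * (w / 2 * (w / 2 * b * (w / 2 * μ)) ^ 3) := by ring
        _ ≤ 128 * δ ^ 6 * (4 * (V ^ 2
        * ((8 * (14 * (s / s')) ^ 3) * (4 * C0 ^ 2 * 2560 * 5610 * ((κ ^ 2 / ρ) ^ 2 * s) / (s' ^ 4 * δ ^ 2)))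
        * (520 * C0 / κ) ^ 3)) := by gcongr
        _ = _ := by field_simp)
    rw [hR]; linarith

end CurveFam

/-- two-ends reduction for a single finite set of columns. -/
lemma two_ends {δ ε : ℝ} (hδ : 0 < δ) (hε : 0 < ε) {N : ℤ} (hN : 0 ≤ N) (hN1 : δ * (N + 1) ≤ 1)
    (S : Finset ℤ) (hS : S ⊆ Finset.Icc 0 N) (hne : S.Nonempty) :
    ∃ j l : ℤ, 0 ≤ j ∧ j ≤ l ∧ l ≤ N ∧
      (S.card : ℝ) * (δ * (l - j + 1)) ^ ε ≤ (S.filter (fun i => i ∈ Finset.Icc j l)).card ∧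
      ∀ (a : ℤ) (r : ℝ), δ ≤ r →
        (((S.filter (fun i => i ∈ Finset.Icc j l)).filter (fun b : ℤ => |(δ * a : ℝ) - δ * b| < r)).card : ℝ)
          ≤ (S.filter (fun i => i ∈ Finset.Icc j l)).card * (3 * r / (δ * (l - j + 1))) ^ ε := by
  classical
  set P : Finset (ℤ × ℤ) := (Finset.Icc 0 N ×ˢ Finset.Icc 0 N).filter (fun t => t.1 ≤ t.2) with hP
  have hPne : (0, N) ∈ P := by simp [hP, hN]
  obtain ⟨⟨j, l⟩, hjl, hmax⟩ := Finset.exists_max_image P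
    (fun t : ℤ × ℤ => ((S.filter (fun i => i ∈ Finset.Icc t.1 t.2)).card : ℝ) / (δ * (t.2 - t.1 + 1)) ^ ε)
    ⟨_, hPne⟩
  simp only [hP, Finset.mem_filter, Finset.mem_product, Finset.mem_Icc] at hjl
  have hjl' : (j : ℝ) ≤ l := by exact_mod_cast hjl.2
  have hs0 : 0 < δ * ((l : ℝ) - j + 1) := by
    have : (0 : ℝ) < (l : ℝ) - j + 1 := by linarith
    positivity
  refine ⟨j, l, hjl.1.1.1, hjl.2, hjl.1.2.2, ?_, ?_⟩
  · have h := hmax _ hPne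
    simp only at h
    have e : S.filter (fun i => i ∈ Finset.Icc 0 N) = S := Finset.filter_true_of_mem (fun i hi => hS hi)
    rw [e] at h
    have hNR : (0 : ℝ) ≤ N := by exact_mod_cast hN
    have h1 : (δ * ((N : ℝ) - (0 : ℤ) + 1)) ^ ε ≤ 1 :=
      Real.rpow_le_one (by simp; positivity) (by simpa using hN1) hε.le
    have h1' : 0 < (δ * ((N : ℝ) - (0 : ℤ) + 1)) ^ ε := by
      apply Real.rpow_pos_of_pos; simp; positivity
    have h2 : (S.card : ℝ) ≤ S.card / (δ * ((N : ℝ) - (0 : ℤ) + 1)) ^ ε := by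
      rw [le_div_iff₀ h1']
      have : (0 : ℝ) ≤ S.card := by positivity
      nlinarith
    have h3 := h2.trans h
    rwa [le_div_iff₀ (by positivity)] at h3
  · intro a r hr
    set T := (S.filter (fun i => i ∈ Finset.Icc j l)).filter (fun b : ℤ => |(δ * a : ℝ) - δ * b| < r) with hT
    rcases T.eq_empty_or_nonempty with h0 | h0
    · rw [h0]; simp only [Finset.card_empty, Nat.cast_zero]
      have := hδ.le.trans hr
      positivity
    have hTS : T ⊆ S := (Finset.filter_subset _ _).trans (Finset.filter_subset _ _)
    have hm := Finset.min'_mem T h0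
    have hM := Finset.max'_mem T h0
    set m := T.min' h0
    set m' := T.max' h0
    have hmm : m ≤ m' := Finset.min'_le T _ hM
    have hmP : (m, m') ∈ P := by
      have h1 := Finset.mem_Icc.1 (hS (hTS hm))
      have h2 := Finset.mem_Icc.1 (hS (hTS hM))
      simp only [hP, Finset.mem_filter, Finset.mem_product, Finset.mem_Icc]
      exact ⟨⟨h1, h2⟩, hmm⟩
    have h := hmax _ hmP
    simp only at h
    have hmmR : (m : ℝ) ≤ m' := by exact_mod_cast hmm
    have hlen0 : 0 < δ * ((m' : ℝ) - m + 1) := by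
      have : (0 : ℝ) < (m' : ℝ) - m + 1 := by linarith
      positivity
    have hlen : δ * ((m' : ℝ) - m + 1) ≤ 3 * r := by
      have h1 := (abs_lt.1 (Finset.mem_filter.1 hm).2)
      have h2 := (abs_lt.1 (Finset.mem_filter.1 hM).2)
      nlinarith
    have hsub : T ⊆ S.filter (fun i => i ∈ Finset.Icc m m') := by
      intro i hi
      rw [Finset.mem_filter, Finset.mem_Icc]
      exact ⟨hTS hi, Finset.min'_le T _ hi, Finset.le_max' T _ hi⟩
    have hc : (T.card : ℝ) ≤ (S.filter (fun i => i ∈ Finset.Icc m m')).card :=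
      Nat.cast_le.2 (Finset.card_le_card hsub)
    rw [div_le_iff₀ (by positivity)] at h
    refine hc.trans (h.trans ?_)
    rw [div_mul_eq_mul_div, mul_div_assoc, ← Real.div_rpow hlen0.le hs0.le]
    gcongr

open Classical in
/-- the columns at which curve `k` hits `X` -/
noncomputable def hits (δ c0 : ℝ) (H0 : ℤ × ℤ → ℝ → ℝ) (X : Finset (ℤ × ℤ)) (k : ℤ × ℤ) : Finset ℤ :=
  (Finset.Icc 0 ⌊c0 / δ⌋).filter (fun i => (i, rowOf δ H0 k i) ∈ X)

lemma core_num {α ε ε' lam s F Fm c A x : ℝ} (hα : 1 / 2 < α) (hα1 : α ≤ 1) (hε : 0 < ε) (hε1 : ε ≤ 1 / 2)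
    (hεε' : 10 * ε ≤ ε') (hl : 0 < lam) (hl1 : lam ≤ 1) (hs : 0 < s) (hs1 : s ≤ 1)
    (hls : lam ≤ s ^ (1 - ε)) (hF : 0 < F) (hc : 0 < c) (hFm : c * s ^ ε * F ≤ Fm)
    (hA : 0 < A) (hx : 0 ≤ x)
    (h : Fm * (lam * (s / 2) ^ ε) ^ 2 ≤ 4 * (A * (Fm ^ (1 - α) * s ^ (α - 1 - ε))) * x) :
    F ^ α * lam ^ (3 - α + ε') ≤ (4 * A * 4 ^ ε * c⁻¹ ^ α) * x := by
  have hFm0 : 0 < Fm := lt_of_lt_of_le (by positivity) hFm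
  have e1 : Fm = Fm ^ α * Fm ^ (1 - α) := by rw [← Real.rpow_add hFm0]; norm_num
  have hp : 0 < Fm ^ (1 - α) := by positivity
  have h1 : Fm ^ α * (lam * (s / 2) ^ ε) ^ 2 ≤ 4 * (A * s ^ (α - 1 - ε)) * x := by
    refine le_of_mul_le_mul_right ?_ hp
    calc Fm ^ α * (lam * (s / 2) ^ ε) ^ 2 * Fm ^ (1 - α)
        = (Fm ^ α * Fm ^ (1 - α)) * (lam * (s / 2) ^ ε) ^ 2 := by ring
      _ = Fm * (lam * (s / 2) ^ ε) ^ 2 := by rw [← e1]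
      _ ≤ _ := h
      _ = _ := by ring
  have h2 : (c * s ^ ε * F) ^ α ≤ Fm ^ α := Real.rpow_le_rpow (by positivity) hFm (by linarith)
  have h3 : (c * s ^ ε * F) ^ α = c ^ α * s ^ (ε * α) * F ^ α := by
    rw [Real.mul_rpow (by positivity) hF.le, Real.mul_rpow hc.le (by positivity), ← Real.rpow_mul hs.le]
  have h4 : ((s / 2) ^ ε) ^ 2 = s ^ (2 * ε) * (4 ^ ε)⁻¹ := by
    rw [Real.div_rpow hs.le (by norm_num), div_pow, ← Real.rpow_natCast, ← Real.rpow_natCast,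
      ← Real.rpow_mul hs.le, ← Real.rpow_mul (by norm_num), div_eq_mul_inv]
    congr 2
    · push_cast; ring
    · rw [mul_comm, Real.rpow_mul (by norm_num)]; norm_num
  have h5 : s ^ (1 - α + ε) * s ^ (α - 1 - ε) = 1 := by
    rw [← Real.rpow_add hs]; norm_num
  have h6 : c ^ α * F ^ α * lam ^ 2 * (s ^ (ε * α) * s ^ (2 * ε) * s ^ (1 - α + ε)) * (4 ^ ε)⁻¹ ≤ 4 * A * x := by
    calc c ^ α * F ^ α * lam ^ 2 * (s ^ (ε * α) * s ^ (2 * ε) * s ^ (1 - α + ε)) * (4 ^ ε)⁻¹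
        = (c ^ α * s ^ (ε * α) * F ^ α) * (lam ^ 2 * (s ^ (2 * ε) * (4 ^ ε)⁻¹)) * s ^ (1 - α + ε) := by ring
      _ ≤ Fm ^ α * (lam ^ 2 * (s ^ (2 * ε) * (4 ^ ε)⁻¹)) * s ^ (1 - α + ε) := by
          rw [← h3]; gcongr
      _ = (Fm ^ α * (lam * (s / 2) ^ ε) ^ 2) * s ^ (1 - α + ε) := by rw [mul_pow, h4]
      _ ≤ (4 * (A * s ^ (α - 1 - ε)) * x) * s ^ (1 - α + ε) := by gcongr
      _ = 4 * A * x * (s ^ (1 - α + ε) * s ^ (α - 1 - ε)) := by ring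
      _ = _ := by rw [h5, mul_one]
  have h7 : lam ^ (1 - α + ε') ≤ s ^ (ε * α) * s ^ (2 * ε) * s ^ (1 - α + ε) := by
    calc lam ^ (1 - α + ε') ≤ (s ^ (1 - ε)) ^ (1 - α + ε') := Real.rpow_le_rpow hl.le hls (by linarith)
      _ = s ^ ((1 - ε) * (1 - α + ε')) := by rw [Real.rpow_mul hs.le]
      _ ≤ s ^ (ε * α + 2 * ε + (1 - α + ε)) := by
          apply Real.rpow_le_rpow_of_exponent_ge hs hs1
          nlinarith
      _ = _ := by rw [Real.rpow_add hs, Real.rpow_add hs]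
  have h8 : lam ^ (3 - α + ε') = lam ^ 2 * lam ^ (1 - α + ε') := by
    rw [← Real.rpow_natCast, ← Real.rpow_add hl]; congr 1; push_cast; ring
  have hca : c⁻¹ ^ α = (c ^ α)⁻¹ := Real.inv_rpow hc.le _
  rw [h8, hca]
  have p1 : 0 < c ^ α := by positivity
  have p2 : (0 : ℝ) < 4 ^ ε := by positivity
  calc F ^ α * (lam ^ 2 * lam ^ (1 - α + ε'))
      ≤ F ^ α * (lam ^ 2 * (s ^ (ε * α) * s ^ (2 * ε) * s ^ (1 - α + ε))) := by gcongr
    _ = 4 ^ ε * (c ^ α)⁻¹ * (c ^ α * F ^ α * lam ^ 2 * (s ^ (ε * α) * s ^ (2 * ε) * s ^ (1 - α + ε)) * (4 ^ ε)⁻¹) := by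
        field_simp
    _ ≤ 4 ^ ε * (c ^ α)⁻¹ * (4 * A * x) := by gcongr
    _ = _ := by ring

set_option maxHeartbeats 1000000 in
open Classical in
theorem core {C0 α ε' : ℝ} (hC0 : 1 ≤ C0) (hα : 1 / 2 < α) (hα1 : α ≤ 1) (hε' : 0 < ε') :
    ∃ A > 0, ∀ (δ c0 : ℝ) (Y : Finset (ℤ × ℤ)) (H0 H1 H2 : ℤ × ℤ → ℝ → ℝ) (X : Finset (ℤ × ℤ)) (lam : ℝ),
      CurveFam δ c0 C0 Y H0 H1 H2 → 0 < lam → lam ≤ 1 →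
      (∀ k ∈ Y, lam ≤ δ * (hits δ c0 H0 X k).card) →
      (δ ^ 2 * Y.card) ^ α * lam ^ (3 - α + ε') ≤ A * (δ ^ 2 * X.card) := by
  set ε := min (ε' / 10) (1 / 2) with hεd
  have hε : 0 < ε := lt_min (by positivity) (by norm_num)
  have hε1 : ε ≤ 1 / 2 := min_le_right _ _
  have hεε' : 10 * ε ≤ ε' := by have := min_le_left (ε' / 10) (1 / 2 : ℝ); linarith
  obtain ⟨A, hA0, hA⟩ := CurveFam.mult_bound hC0 hα hα1 hε
  set θ : ℝ := (1 / 2) ^ ε with hθ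
  have hθ0 : 0 < θ := by positivity
  have hθ1 : θ < 1 := Real.rpow_lt_one (by norm_num) (by norm_num) hε
  have hc : 0 < 1 - θ := by linarith
  refine ⟨4 * A * 4 ^ ε * (1 - θ)⁻¹ ^ α, by positivity, ?_⟩
  intro δ c0 Y H0 H1 H2 X lam F hl hl1 hY
  have hδ := F.hδ0
  rcases Y.eq_empty_or_nonempty with h0 | hYne
  · rw [h0]
    simp only [Finset.card_empty, Nat.cast_zero, mul_zero]
    rw [Real.zero_rpow (by linarith), zero_mul]
    positivity
  set N := ⌊c0 / δ⌋ with hN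
  have hN0 : 0 ≤ N := Int.floor_nonneg.2 (by have := F.hc0; positivity)
  have hNc : δ * (N : ℝ) ≤ c0 := by
    have := Int.floor_le (c0 / δ)
    rw [le_div_iff₀ hδ] at this
    rw [hN]; linarith
  have hN1 : δ * ((N : ℝ) + 1) ≤ 1 := by have := F.hc1; have := F.hδ1; linarith
  have hSne : ∀ k ∈ Y, (hits δ c0 H0 X k).Nonempty := by
    intro k hk
    rw [Finset.nonempty_iff_ne_empty]
    intro h
    have := hY k hk
    rw [h] at this
    simp at this
    linarith
  have hT : ∀ k, ∃ t : ℤ × ℤ, k ∈ Y → 0 ≤ t.1 ∧ t.1 ≤ t.2 ∧ t.2 ≤ N ∧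
      ((hits δ c0 H0 X k).card : ℝ) * (δ * (t.2 - t.1 + 1)) ^ ε ≤
        ((hits δ c0 H0 X k).filter (fun i => i ∈ Finset.Icc t.1 t.2)).card ∧
      ∀ (a : ℤ) (r : ℝ), δ ≤ r →
        ((((hits δ c0 H0 X k).filter (fun i => i ∈ Finset.Icc t.1 t.2)).filter (fun b : ℤ => |(δ * a : ℝ) - δ * b| < r)).card : ℝ)
          ≤ ((hits δ c0 H0 X k).filter (fun i => i ∈ Finset.Icc t.1 t.2)).card * (3 * r / (δ * (t.2 - t.1 + 1))) ^ ε := by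
    intro k
    by_cases hk : k ∈ Y
    · obtain ⟨j, l, h⟩ := two_ends hδ hε hN0 hN1 (hits δ c0 H0 X k) (Finset.filter_subset _ _) (hSne k hk)
      exact ⟨(j, l), fun _ => h⟩
    · exact ⟨(0, 0), fun h => absurd h hk⟩
  choose T hT using hT
  set B : ℤ × ℤ → Finset ℤ := fun k => (hits δ c0 H0 X k).filter (fun i => i ∈ Finset.Icc (T k).1 (T k).2) with hB
  set sk : ℤ × ℤ → ℝ := fun k => δ * (((T k).2 : ℝ) - (T k).1 + 1) with hsk
  have hskδ : ∀ k ∈ Y, δ ≤ sk k := by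
    intro k hk
    have : ((T k).1 : ℝ) ≤ (T k).2 := by exact_mod_cast (hT k hk).2.1
    simp only [hsk]; nlinarith
  have hsk1 : ∀ k ∈ Y, sk k ≤ 1 := by
    intro k hk
    have h1 : ((T k).2 : ℝ) ≤ N := by exact_mod_cast (hT k hk).2.2.1
    have h2 : (0 : ℝ) ≤ (T k).1 := by exact_mod_cast (hT k hk).1
    simp only [hsk]; nlinarith
  have hn : ∀ k, ∃ n : ℕ, k ∈ Y → (1 / 2 : ℝ) ^ n / 2 < sk k ∧ sk k ≤ (1 / 2) ^ n := by
    intro k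
    by_cases hk : k ∈ Y
    · obtain ⟨n, h1, h2⟩ := exists_dyadic (x := sk k) (C := 1) (hδ.trans_le (hskδ k hk)) (hsk1 k hk)
      exact ⟨n, fun _ => ⟨by linarith, by linarith⟩⟩
    · exact ⟨0, fun h => absurd h hk⟩
  choose n hn using hn
  obtain ⟨m, hm⟩ := weighted_pigeon Y hYne n (fun m : ℕ => (1 - θ) * θ ^ m) (fun T => geom_fin_le hθ0.le hθ1 T)
  obtain ⟨hmc, hmne⟩ : (1 - θ) * θ ^ m * (Y.card : ℝ) ≤ (Y.filter (fun k => n k = m)).card ∧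
      (Y.filter (fun k => n k = m)).Nonempty := by
    refine ⟨by simpa using hm.1, by simpa using hm.2⟩
  set Ym := Y.filter (fun k => n k = m) with hYm
  have hYmY : Ym ⊆ Y := Finset.filter_subset _ _
  set s : ℝ := (1 / 2) ^ m with hs
  have hs0 : 0 < s := by positivity
  have hs1 : s ≤ 1 := pow_le_one₀ (by norm_num) (by norm_num)
  have hsks : ∀ k ∈ Ym, s / 2 < sk k ∧ sk k ≤ s := by
    intro k hk
    have h1 := hn k (hYmY hk)
    rw [(Finset.mem_filter.1 hk).2] at h1
    exact h1
  have hBc : ∀ k ∈ Ym, lam / δ * (sk k) ^ ε ≤ (B k).card := by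
    intro k hk
    have h1 := (hT k (hYmY hk)).2.2.2.1
    have h2 := hY k (hYmY hk)
    have h3 : lam / δ ≤ (hits δ c0 H0 X k).card := by rw [div_le_iff₀ hδ]; linarith
    refine le_trans ?_ h1
    have := hδ.le.trans (hskδ k (hYmY hk))
    simp only [hsk] at this ⊢
    gcongr
  set b := lam / δ * (s / 2) ^ ε with hb
  have hb0 : 0 ≤ b := by positivity
  have hbB : ∀ k ∈ Ym, b ≤ (B k).card := by
    intro k hk
    refine le_trans ?_ (hBc k hk)
    have := (hsks k hk).1.le
    rw [hb]
    gcongr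
  have hbpos : 0 < b := by positivity
  have hBne : ∀ k ∈ Ym, (B k).Nonempty := by
    intro k hk
    rw [← Finset.card_pos]
    have := hbpos.trans_le (hbB k hk)
    exact_mod_cast this
  obtain ⟨μ, _, hμX, Y1, hY1, hY1n, hY1c, hμ⟩ := mu_exists δ H0 Ym B hmne hBne hbB hb0 X (by
    intro k hk i hi
    simp only [hB, hits, Finset.mem_filter] at hi
    exact hi.1.2)
  have Fm : CurveFam δ c0 C0 Ym H0 H1 H2 :=
    { hδ0 := F.hδ0, hδ1 := F.hδ1, hc0 := F.hc0, hc1 := F.hc1, hC0 := F.hC0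
      d0 := fun k hk => F.d0 k (hYmY hk)
      d1 := fun k hk => F.d1 k (hYmY hk)
      p2 := fun k hk k' hk' => F.p2 k (hYmY hk) k' (hYmY hk')
      p4 := fun k hk k' hk' => F.p4 k (hYmY hk) k' (hYmY hk')
      p5 := fun k hk k' hk' => F.p5 k (hYmY hk) k' (hYmY hk')
      p6 := fun k hk k' hk' => F.p6 k (hYmY hk) k' (hYmY hk') }
  have hBi : ∀ k ∈ Ym, ∀ i ∈ B k, 0 ≤ i ∧ i ≤ N ∧ (T k).1 ≤ i ∧ i ≤ (T k).2 := by
    intro k hk i hi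
    simp only [hB, hits, Finset.mem_filter, Finset.mem_Icc] at hi
    exact ⟨hi.1.1.1, hi.1.1.2, hi.2.1, hi.2.2⟩
  have G : ColData δ c0 s Ym B (fun k => δ * (T k).1) := by
    refine ⟨?_, ?_, ?_⟩
    · intro k hk i hi
      obtain ⟨h1, h2, _⟩ := hBi k hk i hi
      have h1' : (0 : ℝ) ≤ i := by exact_mod_cast h1
      have h2' : (i : ℝ) ≤ N := by exact_mod_cast h2
      exact ⟨by positivity, by nlinarith⟩
    · intro k hk
      obtain ⟨h1, h2, h3, _⟩ := hT k (hYmY hk)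
      have h1' : (0 : ℝ) ≤ (T k).1 := by exact_mod_cast h1
      have h2' : ((T k).1 : ℝ) ≤ N := by exact_mod_cast h2.trans h3
      exact ⟨by positivity, by nlinarith⟩
    · intro k hk i hi
      obtain ⟨_, _, h1, h2⟩ := hBi k hk i hi
      have h1' : ((T k).1 : ℝ) ≤ i := by exact_mod_cast h1
      have h2' : (i : ℝ) ≤ (T k).2 := by exact_mod_cast h2
      have h3 := (hsks k hk).2
      simp only [hsk] at h3
      exact ⟨by gcongr, by nlinarith⟩
  obtain ⟨k0, hk0⟩ := hmne
  have hδs : δ ≤ s := (hskδ k0 (hYmY hk0)).trans (hsks k0 hk0).2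
  have key := hA δ c0 s Ym H0 H1 H2 B _ μ Y1 b Fm G hδs hs1 hY1 hY1n hY1c hμ (by
    intro k hk a r hr
    have h1 := (hT k (hYmY hk)).2.2.2.2 a r hr
    refine h1.trans ?_
    have h2 := (hsks k hk).1
    have h3 := hδ.trans_le (hskδ k (hYmY hk))
    have hr0 := hδ.trans_le hr
    have h4 : 3 * r / sk k ≤ 6 * r / s := by
      rw [div_le_div_iff₀ h3 hs0]; nlinarith
    gcongr
    ) hbB hb0
  have hls : lam ≤ s ^ (1 - ε) := by
    have h1 := hBc k0 hk0
    have hsk0 := hδ.trans_le (hskδ k0 (hYmY hk0))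
    have h2 : ((B k0).card : ℝ) ≤ sk k0 / δ := by
      have h3 : B k0 ⊆ Finset.Icc (T k0).1 (T k0).2 := fun i hi => (Finset.mem_filter.1 hi).2
      have h4 := Finset.card_le_card h3
      rw [Int.card_Icc] at h4
      have h5 : ((B k0).card : ℝ) ≤ (((T k0).2 + 1 - (T k0).1).toNat : ℝ) := by exact_mod_cast h4
      have h6 : ((((T k0).2 + 1 - (T k0).1).toNat : ℤ) : ℝ) = (T k0).2 + 1 - (T k0).1 := by
        rw [Int.toNat_of_nonneg (by have := (hT k0 (hYmY hk0)).2.1; omega)]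
        push_cast; ring
      rw [Int.cast_natCast] at h6
      rw [h6] at h5
      have : sk k0 / δ = (T k0).2 + 1 - (T k0).1 := by simp only [hsk]; field_simp; ring
      linarith
    have h3 := h1.trans h2
    rw [div_mul_eq_mul_div, div_le_div_iff_of_pos_right hδ] at h3
    have h4 : lam ≤ (sk k0) ^ (1 - ε) := by
      rw [Real.rpow_sub hsk0, Real.rpow_one, le_div_iff₀ (by positivity)]
      exact h3
    exact h4.trans (Real.rpow_le_rpow hsk0.le (hsks k0 hk0).2 (by linarith))
  have hYc : (0 : ℝ) < Y.card := by exact_mod_cast hYne.card_pos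
  refine core_num hα hα1 hε hε1 hεε' hl hl1 hs0 hs1 hls (by positivity) hc (Fm := δ ^ 2 * Ym.card) ?_ hA0
    (by positivity) ?_
  · have e : s ^ ε = θ ^ m := by
      rw [hs, hθ, ← Real.rpow_natCast, ← Real.rpow_natCast, ← Real.rpow_mul (by norm_num),
        ← Real.rpow_mul (by norm_num), mul_comm]
    rw [e]
    calc (1 - θ) * θ ^ m * (δ ^ 2 * (Y.card : ℝ)) = δ ^ 2 * ((1 - θ) * θ ^ m * Y.card) := by ring
      _ ≤ _ := by gcongr
  · have e : lam * (s / 2) ^ ε = b * δ := by rw [hb]; field_simp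
    rw [e]
    calc δ ^ 2 * (Ym.card : ℝ) * (b * δ) ^ 2 = (Ym.card * b) * (b * δ ^ 4) := by ring
      _ ≤ (4 * μ * X.card) * (b * δ ^ 4) := by gcongr
      _ = 4 * (b * μ * δ ^ 2) * (δ ^ 2 * X.card) := by ring
      _ ≤ _ := by gcongr

lemma geom_fin_le' {θ : ℝ} (h0 : 0 ≤ θ) (h1 : θ < 1) (T : Finset ℕ) :
    ∑ n ∈ T, θ ^ n ≤ (1 - θ)⁻¹ := by
  have h := geom_fin_le h0 h1 T
  rw [← Finset.mul_sum] at h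
  have : 0 < 1 - θ := by linarith
  rw [inv_eq_one_div, le_div_iff₀ this]; linarith

/-- dyadic sum bound -/
lemma dyadic_sum_le {p : ℝ} (hp : 0 < p) (S : Finset ℤ) {x : ℝ} (hx : 0 ≤ x) :
    ∑ l ∈ S.filter (fun l : ℤ => (2 : ℝ) ^ (l - 1) < x), ((2 : ℝ) ^ l) ^ p ≤
      (2 ^ p * (1 - (1 / 2) ^ p)⁻¹) * x ^ p := by
  set T := S.filter (fun l : ℤ => (2 : ℝ) ^ (l - 1) < x) with hT
  have hθ1 : (1 / 2 : ℝ) ^ p < 1 := Real.rpow_lt_one (by norm_num) (by norm_num) hp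
  have hpos : 0 < 1 - (1 / 2 : ℝ) ^ p := by linarith
  rcases T.eq_empty_or_nonempty with h0 | h0
  · rw [h0, Finset.sum_empty]; positivity
  set l0 := T.max' h0 with hl0
  have hl0m : (2 : ℝ) ^ (l0 - 1) < x := (Finset.mem_filter.1 (Finset.max'_mem T h0)).2
  have hterm : ∀ l ∈ T, ((2 : ℝ) ^ l) ^ p = ((2 : ℝ) ^ l0) ^ p * ((1 / 2 : ℝ) ^ p) ^ ((l0 - l).toNat) := by
    intro l hl
    have hle : l ≤ l0 := Finset.le_max' T l hl
    have e : (2 : ℝ) ^ l = (2 : ℝ) ^ l0 * (1 / 2) ^ ((l0 - l).toNat) := by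
      rw [one_div, inv_pow, ← zpow_natCast, Int.toNat_of_nonneg (by omega), ← zpow_neg,
        ← zpow_add₀ (by norm_num)]
      congr 1; ring
    rw [e, Real.mul_rpow (by positivity) (by positivity)]
    congr 1
    rw [← Real.rpow_natCast, ← Real.rpow_natCast, ← Real.rpow_mul (by norm_num), ← Real.rpow_mul (by norm_num),
      mul_comm]
  rw [Finset.sum_congr rfl hterm, ← Finset.mul_sum]
  have hinj : Set.InjOn (fun l : ℤ => (l0 - l).toNat) T := by
    intro a ha b hb hab
    have h1 : a ≤ l0 := Finset.le_max' T a ha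
    have h2 : b ≤ l0 := Finset.le_max' T b hb
    simp only at hab
    omega
  have h1 : ∑ l ∈ T, ((1 / 2 : ℝ) ^ p) ^ ((l0 - l).toNat) ≤ (1 - (1 / 2) ^ p)⁻¹ := by
    have := Finset.sum_image (f := fun n : ℕ => ((1 / 2 : ℝ) ^ p) ^ n) (g := fun l : ℤ => (l0 - l).toNat) (s := T) hinj
    rw [← this]
    exact geom_fin_le' (by positivity) hθ1 _
  have h2 : ((2 : ℝ) ^ l0) ^ p ≤ 2 ^ p * x ^ p := by
    rw [← Real.mul_rpow (by norm_num) hx]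
    apply Real.rpow_le_rpow (by positivity) _ hp.le
    rw [zpow_sub_one₀ (by norm_num)] at hl0m
    linarith
  calc ((2 : ℝ) ^ l0) ^ p * ∑ l ∈ T, ((1 / 2 : ℝ) ^ p) ^ ((l0 - l).toNat)
      ≤ (2 ^ p * x ^ p) * (1 - (1 / 2) ^ p)⁻¹ := by
        refine mul_le_mul h2 h1 (Finset.sum_nonneg fun _ _ => by positivity) (by positivity)
    _ = _ := by ring

lemma sum_rpow_le {ι : Type*} (S : Finset ι) (a : ι → ℝ) (ha : ∀ i ∈ S, 0 ≤ a i) {β : ℝ} (hβ : 1 ≤ β) :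
    ∑ i ∈ S, (a i) ^ β ≤ (∑ i ∈ S, a i) ^ β := by
  classical
  induction S using Finset.induction_on with
  | empty => simp [Real.zero_rpow (by linarith : β ≠ 0)]
  | insert i S hi ih =>
    rw [Finset.sum_insert hi, Finset.sum_insert hi]
    have h1 := ih (fun j hj => ha j (Finset.mem_insert_of_mem hj))
    have h2 : 0 ≤ ∑ i ∈ S, a i := Finset.sum_nonneg fun j hj => ha j (Finset.mem_insert_of_mem hj)
    have h3 := Real.add_rpow_le_rpow_add (ha i (Finset.mem_insert_self i S)) h2 hβ
    linarith

section
variable {κ ξ : Type*}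

open Classical in
/-- choice of a dyadic level -/
lemma level_exists {δ γ : ℝ} (hδ : 0 < δ) (hγ : 0 < γ) (I : Finset ℤ) (hI : δ * I.card ≤ 1) (c : ℤ → ξ)
    (F : ξ → ℝ) (hF : ∀ x, 0 ≤ F x) (hpos : 0 < δ * ∑ i ∈ I, F (c i)) :
    ∃ (l : ℤ) (j : ℕ), δ * ∑ i ∈ I, F (c i) ≤ 2 ^ (l - j + 1) ∧
      (1 - (1 / 2 : ℝ) ^ γ) / 4 * ((1 / 2 : ℝ) ^ (1 + γ)) ^ j ≤
        δ * (I.filter (fun i => (2 : ℝ) ^ (l - 1) < F (c i))).card := by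
  obtain ⟨m, hm1, hm2⟩ := exists_mem_Ico_zpow hpos (one_lt_two (α := ℝ))
  set Λ : ℝ := 2 ^ m with hΛ
  have hΛ0 : 0 < Λ := by positivity
  set θ : ℝ := (1 / 2 : ℝ) ^ γ with hθ
  have hθ1 : θ < 1 := Real.rpow_lt_one (by norm_num) (by norm_num) hγ
  have hθ0 : 0 < θ := by positivity
  suffices H : ∃ j : ℕ, (1 - θ) / 4 * ((1 / 2 : ℝ) ^ (1 + γ)) ^ j ≤
      δ * (I.filter (fun i => (2 : ℝ) ^ j * Λ / 2 < F (c i))).card by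
    obtain ⟨j, hj⟩ := H
    refine ⟨m + j, j, ?_, ?_⟩
    · have : m + (j : ℤ) - j + 1 = m + 1 := by ring
      rw [this]; exact hm2.le
    · have e : (2 : ℝ) ^ (m + (j : ℤ) - 1) = (2 : ℝ) ^ j * Λ / 2 := by
        rw [zpow_sub_one₀ (by norm_num), zpow_add₀ (by norm_num), zpow_natCast, hΛ]; ring
      rw [e]; exact hj
  by_contra hcon
  push Not at hcon
  have hJ : ∃ J : ℕ, ∀ i ∈ I, F (c i) ≤ 2 ^ J * Λ / 2 := by
    obtain ⟨J, hJ⟩ := pow_unbounded_of_one_lt ((∑ i ∈ I, F (c i)) * 2 / Λ) (one_lt_two (α := ℝ))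
    refine ⟨J, fun i hi => ?_⟩
    rw [div_lt_iff₀ hΛ0] at hJ
    have := Finset.single_le_sum (f := fun i => F (c i)) (fun i _ => hF (c i)) hi
    linarith
  obtain ⟨J, hJ⟩ := hJ
  have hpt : ∀ i ∈ I, F (c i) ≤ Λ / 2 + ∑ j ∈ Finset.range J, if (2 : ℝ) ^ j * Λ / 2 < F (c i) then 2 ^ j * Λ else 0 := by
    intro i hi
    have hnn : ∀ j ∈ Finset.range J, (0 : ℝ) ≤ if (2 : ℝ) ^ j * Λ / 2 < F (c i) then 2 ^ j * Λ else 0 := by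
      intro j _; split_ifs <;> positivity
    rcases le_or_gt (F (c i)) (Λ / 2) with h | h
    · have := Finset.sum_nonneg hnn
      linarith
    · have hex : ∃ j : ℕ, F (c i) ≤ 2 ^ j * Λ / 2 := ⟨J, hJ i hi⟩
      have hfind := Nat.find_spec hex
      have h0 : Nat.find hex ≠ 0 := by
        intro h0; rw [h0] at hfind; simp at hfind; linarith
      obtain ⟨n, hn⟩ := Nat.exists_eq_succ_of_ne_zero h0
      have h1 : (2 : ℝ) ^ n * Λ / 2 < F (c i) := by
        by_contra h2
        exact Nat.find_min hex (show n < Nat.find hex by omega) (not_lt.1 h2)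
      have h2 : Nat.find hex ≤ J := Nat.find_min' hex (hJ i hi)
      have h3 := Finset.single_le_sum hnn (Finset.mem_range.2 (show n < J by omega))
      simp only [if_pos h1] at h3
      rw [hn, pow_succ] at hfind
      linarith
  have hsum : ∑ i ∈ I, F (c i) ≤ I.card * (Λ / 2) + ∑ j ∈ Finset.range J, 2 ^ j * Λ *
      (I.filter (fun i => (2 : ℝ) ^ j * Λ / 2 < F (c i))).card := by
    refine (Finset.sum_le_sum hpt).trans ?_
    rw [Finset.sum_add_distrib, Finset.sum_const, nsmul_eq_mul, Finset.sum_comm]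
    gcongr with j hj
    rw [← Finset.sum_filter, Finset.sum_const, nsmul_eq_mul, mul_comm]
  have h1 : δ * ∑ i ∈ I, F (c i) ≤ Λ / 2 + ∑ j ∈ Finset.range J, Λ / 4 * ((1 - θ) * θ ^ j) := by
    calc δ * ∑ i ∈ I, F (c i) ≤ δ * (I.card * (Λ / 2) + ∑ j ∈ Finset.range J, 2 ^ j * Λ *
      (I.filter (fun i => (2 : ℝ) ^ j * Λ / 2 < F (c i))).card) := by gcongr
      _ = (δ * I.card) * (Λ / 2) + ∑ j ∈ Finset.range J, 2 ^ j * Λ *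
          (δ * (I.filter (fun i => (2 : ℝ) ^ j * Λ / 2 < F (c i))).card) := by
          rw [mul_add, Finset.mul_sum]
          congr 1
          · ring
          · exact Finset.sum_congr rfl fun j _ => by ring
      _ ≤ 1 * (Λ / 2) + ∑ j ∈ Finset.range J, 2 ^ j * Λ *
          ((1 - θ) / 4 * ((1 / 2 : ℝ) ^ (1 + γ)) ^ j) := by
          exact add_le_add (mul_le_mul_of_nonneg_right hI (by positivity))
            (Finset.sum_le_sum fun j _ => mul_le_mul_of_nonneg_left (hcon j).le (by positivity))
      _ = _ := by
          rw [one_mul]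
          congr 1
          refine Finset.sum_congr rfl fun j _ => ?_
          rw [Real.rpow_add (by norm_num), Real.rpow_one, mul_pow, ← hθ]
          have : (2 : ℝ) ^ j * (1 / 2) ^ j = 1 := by rw [← mul_pow]; norm_num
          calc 2 ^ j * Λ * ((1 - θ) / 4 * ((1 / 2) ^ j * θ ^ j))
              = ((2 : ℝ) ^ j * (1 / 2) ^ j) * (Λ / 4 * ((1 - θ) * θ ^ j)) := by ring
            _ = _ := by rw [this, one_mul]
  rw [← Finset.mul_sum] at h1
  have h2 := geom_fin_le hθ0.le hθ1 (Finset.range J)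
  have h3 : Λ / 4 * ∑ j ∈ Finset.range J, (1 - θ) * θ ^ j ≤ Λ / 4 * 1 := by gcongr
  linarith

open Classical in
/-- Discrete restricted-weak-type interpolation with the trivial sup bound. -/
lemma marc {α p p0 A : ℝ} (hα0 : 0 < α) (hα1 : α ≤ 1) (hp0 : 0 < p0) (hpp : p0 < p) (hA : 0 < A) :
    ∃ C > 0, ∀ (δ D : ℝ) (Y : Finset κ) (I : κ → Finset ℤ) (c : κ → ℤ → ξ) (F : ξ → ℝ) (U : Finset ξ),
      0 < δ → 0 < D → (∀ k ∈ Y, δ * (I k).card ≤ 1) → (∀ x, 0 ≤ F x) → (∀ x, x ∉ U → F x = 0) →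
      (∀ Y' ⊆ Y, ∀ (X : Finset ξ) (lam : ℝ), 0 < lam → lam ≤ 1 →
        (∀ k ∈ Y', lam ≤ δ * ((I k).filter (fun i => c k i ∈ X)).card) →
        (D * Y'.card) ^ α * lam ^ p0 ≤ A * (D * X.card)) →
      ∑ k ∈ Y, D * (δ * ∑ i ∈ I k, F (c k i)) ^ (p / α) ≤ C * (D * ∑ x ∈ U, F x ^ p) ^ (1 / α) := by
  set γ := (p - p0) / (2 * p0) with hγd
  have hγ : 0 < γ := by have : 0 < p - p0 := by linarith
                        positivity
  have hpp0 : 0 < p := hp0.trans hpp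
  set θ : ℝ := (1 / 2 : ℝ) ^ γ with hθ
  have hθ1 : θ < 1 := Real.rpow_lt_one (by norm_num) (by norm_num) hγ
  have hθ0 : 0 < θ := by positivity
  set c1 := (1 - θ) / 4 with hc1
  have hc10 : 0 < c1 := by have : 0 < 1 - θ := by linarith
                           positivity
  set ω : ℝ := (1 / 2 : ℝ) ^ ((p - p0) / 2 / α) with hω
  have hω0 : 0 < ω := by positivity
  have hω1 : ω < 1 := Real.rpow_lt_one (by norm_num) (by norm_num)
    (by have : 0 < p - p0 := by linarith
        positivity)
  have hω1' : 0 < 1 - ω := by linarith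
  have hhp : (1 / 2 : ℝ) ^ p < 1 := Real.rpow_lt_one (by norm_num) (by norm_num) hpp0
  have hhp' : 0 < 1 - (1 / 2 : ℝ) ^ p := by linarith
  set E := 2 ^ p * (1 - (1 / 2 : ℝ) ^ p)⁻¹ with hE
  have hE0 : 0 < E := by positivity
  refine ⟨2 ^ (p / α) * (A * c1⁻¹ ^ p0) ^ (1 / α) * (1 - ω)⁻¹ * E ^ (1 / α), by positivity, ?_⟩
  intro δ D Y I c F U hδ hD hI hF hU hweak
  set TF : κ → ℝ := fun k => δ * ∑ i ∈ I k, F (c k i) with hTF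
  have hTF0 : ∀ k, 0 ≤ TF k := fun k => mul_nonneg hδ.le (Finset.sum_nonneg fun i _ => hF _)
  have hlev : ∀ k, ∃ t : ℤ × ℕ, k ∈ Y → 0 < TF k → TF k ≤ 2 ^ (t.1 - t.2 + 1) ∧
      c1 * ((1 / 2 : ℝ) ^ (1 + γ)) ^ t.2 ≤
        δ * ((I k).filter (fun i => (2 : ℝ) ^ (t.1 - 1) < F (c k i))).card := by
    intro k
    by_cases h : k ∈ Y ∧ 0 < TF k
    · obtain ⟨l, j, h1, h2⟩ := level_exists hδ hγ (I k) (hI k h.1) (c k) F hF h.2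
      exact ⟨(l, j), fun _ _ => ⟨h1, h2⟩⟩
    · exact ⟨(0, 0), fun h1 h2 => absurd ⟨h1, h2⟩ h⟩
  choose t ht using hlev
  set Yp := Y.filter (fun k => 0 < TF k) with hYp
  set X : ℤ → Finset ξ := fun l => U.filter (fun x => (2 : ℝ) ^ (l - 1) < F x) with hX
  have hq0 : 0 < p / α := by positivity
  have hα' : 1 ≤ 1 / α := by rw [le_div_iff₀ hα0]; linarith
  have step1 : ∑ k ∈ Y, D * TF k ^ (p / α) = ∑ k ∈ Yp, D * TF k ^ (p / α) := by
    rw [hYp, Finset.sum_filter]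
    refine Finset.sum_congr rfl fun k _ => ?_
    split_ifs with h
    · rfl
    · have : TF k = 0 := le_antisymm (not_lt.1 h) (hTF0 k)
      rw [this, Real.zero_rpow hq0.ne', mul_zero]
  have hfib : ∀ l j, D * ((Yp.filter (fun k => t k = (l, j))).card : ℝ) * (((2 : ℝ) ^ (l - (j : ℤ) + 1)) ^ (p / α)) ≤
      (2 ^ (p / α) * (A * c1⁻¹ ^ p0) ^ (1 / α)) * ((((2 : ℝ) ^ l) ^ p * (D * (X l).card)) ^ (1 / α) * ω ^ j) := by
    intro l j
    set Y' := Yp.filter (fun k => t k = (l, j)) with hY'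
    set lam := c1 * ((1 / 2 : ℝ) ^ (1 + γ)) ^ j with hlam
    have hlam0 : 0 < lam := by positivity
    have hlam1 : lam ≤ 1 := by
      have i1 : ((1 / 2 : ℝ) ^ (1 + γ)) ^ j ≤ 1 := pow_le_one₀ (by positivity)
        (Real.rpow_le_one (by norm_num) (by norm_num) (by linarith))
      have i2 : c1 ≤ 1 := by rw [hc1]; linarith
      calc lam ≤ 1 * 1 := by rw [hlam]; gcongr
        _ = 1 := one_mul 1
    have hw := hweak Y' ((Finset.filter_subset _ _).trans (Finset.filter_subset _ _)) (X l) lam hlam0 hlam1 (by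
      intro k hk
      rw [hY', Finset.mem_filter, hYp, Finset.mem_filter] at hk
      have h2 := (ht k hk.1.1 hk.1.2).2
      rw [hk.2] at h2
      refine h2.trans ?_
      apply mul_le_mul_of_nonneg_left _ hδ.le
      refine Nat.cast_le.2 (Finset.card_le_card ?_)
      intro i hi
      rw [Finset.mem_filter] at hi ⊢
      refine ⟨hi.1, ?_⟩
      rw [hX, Finset.mem_filter]
      refine ⟨?_, hi.2⟩
      by_contra hn
      have h3 := hi.2
      rw [hU _ hn] at h3
      have : (0 : ℝ) < 2 ^ (l - 1) := by positivity
      linarith)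
    have h1 : (D * (Y'.card : ℝ)) ^ α ≤ A * (D * (X l).card) * lam⁻¹ ^ p0 := by
      rw [Real.inv_rpow hlam0.le, ← div_eq_mul_inv, le_div_iff₀ (by positivity)]
      exact hw
    have h2 : D * (Y'.card : ℝ) ≤ (A * (D * (X l).card) * lam⁻¹ ^ p0) ^ (1 / α) := by
      calc D * (Y'.card : ℝ) = ((D * (Y'.card : ℝ)) ^ α) ^ (1 / α) := by
            rw [← Real.rpow_mul (by positivity), mul_one_div_cancel hα0.ne', Real.rpow_one]
        _ ≤ _ := Real.rpow_le_rpow (by positivity) h1 (by positivity)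
    have h3 : ((2 : ℝ) ^ (l - (j : ℤ) + 1)) ^ (p / α) = 2 ^ (p / α) * (((2 : ℝ) ^ l) ^ p) ^ (1 / α) *
        ((((1 / 2 : ℝ) ^ j) ^ p) ^ (1 / α)) := by
      rw [← Real.rpow_mul (by positivity), ← Real.rpow_mul (by positivity), mul_one_div,
        ← Real.mul_rpow (by positivity) (by positivity), ← Real.mul_rpow (by positivity) (by positivity)]
      congr 1
      rw [zpow_add₀ (by norm_num), zpow_sub₀ (by norm_num), zpow_one, zpow_natCast, one_div, inv_pow]
      field_simp
    have h4 : lam⁻¹ ^ p0 * ((1 / 2 : ℝ) ^ j) ^ p = c1⁻¹ ^ p0 * (ω ^ j) ^ α := by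
      rw [hlam, mul_inv, Real.mul_rpow (by positivity) (by positivity), mul_assoc]
      congr 1
      have e1 : (((1 / 2 : ℝ) ^ (1 + γ)) ^ j)⁻¹ ^ p0 = (1 / 2 : ℝ) ^ (-((1 + γ) * p0 * j)) := by
        rw [← Real.rpow_natCast, ← Real.rpow_mul (by norm_num), ← Real.rpow_neg (by norm_num),
          ← Real.rpow_mul (by norm_num)]
        congr 1; ring
      have e2 : ((1 / 2 : ℝ) ^ j) ^ p = (1 / 2 : ℝ) ^ (p * j) := by
        rw [← Real.rpow_natCast, ← Real.rpow_mul (by norm_num), mul_comm]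
      have e3 : (ω ^ j) ^ α = (1 / 2 : ℝ) ^ ((p - p0) / 2 * j) := by
        rw [hω, ← Real.rpow_natCast, ← Real.rpow_mul (by positivity), ← Real.rpow_mul (by positivity)]
        congr 1; field_simp
      rw [e1, e2, e3, ← Real.rpow_add (by norm_num)]
      congr 1
      rw [hγd]; field_simp; ring
    rw [h3]
    calc D * (Y'.card : ℝ) * (2 ^ (p / α) * (((2 : ℝ) ^ l) ^ p) ^ (1 / α) * ((((1 / 2 : ℝ) ^ j) ^ p) ^ (1 / α)))
        ≤ (A * (D * (X l).card) * lam⁻¹ ^ p0) ^ (1 / α) *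
          (2 ^ (p / α) * (((2 : ℝ) ^ l) ^ p) ^ (1 / α) * ((((1 / 2 : ℝ) ^ j) ^ p) ^ (1 / α))) := by
          gcongr
      _ = 2 ^ (p / α) * (A * (((2 : ℝ) ^ l) ^ p * (D * (X l).card)) * (lam⁻¹ ^ p0 * ((1 / 2 : ℝ) ^ j) ^ p)) ^ (1 / α) := by
          rw [mul_left_comm, mul_assoc, ← Real.mul_rpow (by positivity) (by positivity),
            ← Real.mul_rpow (by positivity) (by positivity)]
          congr 2; ring
      _ = _ := by
          have hP : 0 ≤ ((2 : ℝ) ^ l) ^ p * (D * ((X l).card : ℝ)) := by positivity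
          have hQ : 0 ≤ (ω ^ j) ^ α := by positivity
          have hR : 0 ≤ A * c1⁻¹ ^ p0 := by positivity
          have h5 : ((ω ^ j) ^ α) ^ (1 / α) = (ω ^ j) := by
            rw [← Real.rpow_mul (by positivity), mul_one_div_cancel hα0.ne', Real.rpow_one]
          rw [h4]
          have e : A * (((2 : ℝ) ^ l) ^ p * (D * ((X l).card : ℝ))) * (c1⁻¹ ^ p0 * (ω ^ j) ^ α) =
              (A * c1⁻¹ ^ p0) * ((((2 : ℝ) ^ l) ^ p * (D * ((X l).card : ℝ))) * (ω ^ j) ^ α) := by ring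
          rw [e, Real.mul_rpow hR (mul_nonneg hP hQ), Real.mul_rpow hP hQ, h5, mul_assoc]
  rw [step1]
  have step2 : ∑ k ∈ Yp, D * TF k ^ (p / α) ≤
      ∑ s ∈ (Yp.image (fun k => (t k).1)) ×ˢ (Yp.image (fun k => (t k).2)),
        (2 ^ (p / α) * (A * c1⁻¹ ^ p0) ^ (1 / α)) * ((((2 : ℝ) ^ s.1) ^ p * (D * (X s.1).card)) ^ (1 / α) * ω ^ s.2) := by
    have hmaps : ∀ k ∈ Yp, t k ∈ (Yp.image (fun k => (t k).1)) ×ˢ (Yp.image (fun k => (t k).2)) := by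
      intro k hk
      rw [Finset.mem_product]
      exact ⟨Finset.mem_image_of_mem _ hk, Finset.mem_image_of_mem _ hk⟩
    rw [← Finset.sum_fiberwise_of_maps_to hmaps]
    refine Finset.sum_le_sum fun s _ => ?_
    refine le_trans ?_ (hfib s.1 s.2)
    have : ∀ k ∈ Yp.filter (fun k => t k = s), D * TF k ^ (p / α) ≤ D * (((2 : ℝ) ^ (s.1 - (s.2 : ℤ) + 1)) ^ (p / α)) := by
      intro k hk
      rw [Finset.mem_filter, hYp, Finset.mem_filter] at hk
      have h1 := (ht k hk.1.1 hk.1.2).1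
      rw [hk.2] at h1
      have := hTF0 k
      gcongr
    refine (Finset.sum_le_card_nsmul _ _ _ this).trans (le_of_eq ?_)
    rw [nsmul_eq_mul]
    ring
  refine step2.trans ?_
  rw [← Finset.mul_sum, Finset.sum_product]
  simp only []
  rw [← Finset.sum_mul_sum]
  have hJ := geom_fin_le' hω0.le hω1 (Yp.image (fun k => (t k).2))
  have hL : ∑ l ∈ Yp.image (fun k => (t k).1), (((2 : ℝ) ^ l) ^ p * (D * (X l).card)) ^ (1 / α) ≤
      E ^ (1 / α) * (D * ∑ x ∈ U, F x ^ p) ^ (1 / α) := by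
    refine (sum_rpow_le _ _ (fun l _ => by positivity) hα').trans ?_
    have hs0 : 0 ≤ ∑ x ∈ U, F x ^ p := Finset.sum_nonneg fun x _ => Real.rpow_nonneg (hF x) _
    rw [← Real.mul_rpow hE0.le (by positivity)]
    apply Real.rpow_le_rpow (Finset.sum_nonneg fun l _ => by positivity) _ (by positivity)
    calc ∑ l ∈ Yp.image (fun k => (t k).1), ((2 : ℝ) ^ l) ^ p * (D * (X l).card)
        = D * ∑ l ∈ Yp.image (fun k => (t k).1), ∑ x ∈ U, if (2 : ℝ) ^ (l - 1) < F x then ((2 : ℝ) ^ l) ^ p else 0 := by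
          rw [Finset.mul_sum]
          refine Finset.sum_congr rfl fun l _ => ?_
          rw [← Finset.sum_filter, Finset.sum_const, nsmul_eq_mul]
          ring
      _ = D * ∑ x ∈ U, ∑ l ∈ (Yp.image (fun k => (t k).1)).filter (fun l : ℤ => (2 : ℝ) ^ (l - 1) < F x), ((2 : ℝ) ^ l) ^ p := by
          rw [Finset.sum_comm]
          congr 1
          refine Finset.sum_congr rfl fun x _ => ?_
          rw [Finset.sum_filter]
      _ ≤ D * ∑ x ∈ U, E * F x ^ p := by
          gcongr with x hx
          exact dyadic_sum_le hpp0 _ (hF x)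
      _ = _ := by rw [← Finset.mul_sum]; ring
  have hs0 : 0 ≤ ∑ x ∈ U, F x ^ p := Finset.sum_nonneg fun x _ => Real.rpow_nonneg (hF x) _
  calc _ ≤ 2 ^ (p / α) * (A * c1⁻¹ ^ p0) ^ (1 / α) * ((E ^ (1 / α) * (D * ∑ x ∈ U, F x ^ p) ^ (1 / α)) * (1 - ω)⁻¹) := by
        apply mul_le_mul_of_nonneg_left _ (by positivity)
        exact mul_le_mul hL hJ (Finset.sum_nonneg fun _ _ => by positivity) (by positivity)
    _ = _ := by ring
end

open Classical in
lemma strip_pigeon {w L : ℕ} (hw : 1 ≤ w) (k1 : ℤ) (S : Finset ℤ)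
    (hS : S ⊆ Finset.Icc (k1 - 2 * (w * L : ℕ)) (k1 - (w * L : ℕ))) :
    ∃ j : ℤ, (S.card : ℝ) ≤ (L + 1) * (S.filter (fun i => i / (w : ℤ) = j)).card := by
  by_contra hcon
  push Not at hcon
  set J := Finset.Icc ((k1 - 2 * (w * L : ℕ)) / (w : ℤ)) ((k1 - 2 * (w * L : ℕ)) / (w : ℤ) + L) with hJ
  have hw' : (0 : ℤ) < w := by exact_mod_cast hw
  have hmaps : ∀ i ∈ S, i / (w : ℤ) ∈ J := by
    intro i hi
    have h := Finset.mem_Icc.1 (hS hi)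
    rw [hJ, Finset.mem_Icc]
    refine ⟨Int.ediv_le_ediv hw' h.1, ?_⟩
    have e : (k1 - 2 * (w * L : ℕ)) / (w : ℤ) + L = (k1 - (w * L : ℕ)) / (w : ℤ) := by
      have : (k1 - (w * L : ℕ) : ℤ) = (k1 - 2 * (w * L : ℕ)) + L * w := by push_cast; ring
      rw [this, Int.add_mul_ediv_right _ _ hw'.ne']
    rw [e]
    exact Int.ediv_le_ediv hw' h.2
  have hcard : J.card = L + 1 := by rw [hJ, Int.card_Icc]; omega
  have h1 := Finset.card_eq_sum_card_fiberwise hmaps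
  have h2 : (S.card : ℝ) = ∑ j ∈ J, ((S.filter (fun i => i / (w : ℤ) = j)).card : ℝ) := by
    rw [h1]; push_cast; rfl
  have hJne : J.Nonempty := by rw [← Finset.card_pos, hcard]; omega
  have h3 : ∑ j ∈ J, ((L : ℝ) + 1) * ((S.filter (fun i => i / (w : ℤ) = j)).card : ℝ) < ∑ j ∈ J, (S.card : ℝ) :=
    Finset.sum_lt_sum_of_nonempty hJne fun j _ => hcon j
  rw [← Finset.mul_sum, ← h2, Finset.sum_const, hcard, nsmul_eq_mul] at h3
  push_cast at h3
  exact lt_irrefl _ h3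

/-- family hypothesis on all strips -/
def StripFam (δ C0 : ℝ) (w : ℕ) (Y : Finset (ℤ × ℤ)) (H0 H1 H2 : ℤ × ℤ → ℝ → ℝ) : Prop :=
  ∀ j : ℤ, ∀ Y' ⊆ Y, (∀ k ∈ Y', ∀ x ∈ Icc (0 : ℝ) (δ * w), 1 / 4 ≤ δ * k.1 - (x + j * (δ * w)) ∧
      δ * k.1 - (x + j * (δ * w)) ≤ 2) →
    CurveFam δ (δ * w) C0 Y' (fun k x => H0 k (x + j * (δ * w))) (fun k x => H1 k (x + j * (δ * w)))
      (fun k x => H2 k (x + j * (δ * w)))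

open Classical in
lemma strip_weak {C0 α ε' : ℝ} (hC0 : 1 ≤ C0) (hα : 1 / 2 < α) (hα1 : α ≤ 1) (hε : 0 < ε') (L : ℕ) (hL : 8 ≤ L) :
    ∃ A > 0, ∀ (δ : ℝ) (w : ℕ) (Y : Finset (ℤ × ℤ)) (H0 H1 H2 : ℤ × ℤ → ℝ → ℝ), 1 ≤ w → δ = 1 / (2 * (w * L)) →
      StripFam δ C0 w Y H0 H1 H2 → ∀ Y' ⊆ Y, ∀ (X : Finset (ℤ × ℤ)) (lam : ℝ), 0 < lam → lam ≤ 1 →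
        (∀ k ∈ Y', lam ≤ δ * ((Finset.Icc (k.1 - 2 * (w * L : ℕ)) (k.1 - (w * L : ℕ))).filter
          (fun i => (i, rowOf δ H0 k i) ∈ X)).card) →
        (δ ^ 2 * Y'.card) ^ α * lam ^ (3 - α + ε') ≤ A * (δ ^ 2 * X.card) := by
  obtain ⟨A, hA, hcore⟩ := core hC0 hα hα1 hε
  set p0 := 3 - α + ε' with hp0
  refine ⟨A * ((L : ℝ) + 1) ^ p0, by positivity, ?_⟩
  intro δ w Y H0 H1 H2 hw hδe hfam Y' hY' X lam hlam hlam1 hhit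
  have hα0 : 0 < α := by linarith
  have hw0 : (0 : ℝ) < w := by exact_mod_cast hw
  have hL0 : (8 : ℝ) ≤ L := by exact_mod_cast hL
  have hδ : 0 < δ := by rw [hδe]; positivity
  have hδwL : δ * w * L = 1 / 2 := by rw [hδe]; field_simp
  have hδw : δ * w ≤ 1 / 16 := by
    have : 0 ≤ δ * w := by positivity
    nlinarith
  have hwz : (0 : ℤ) < w := by exact_mod_cast hw
  have hpig : ∀ k : ℤ × ℤ, ∃ j : ℤ, _ := fun k => strip_pigeon hw k.1
    ((Finset.Icc (k.1 - 2 * (w * L : ℕ)) (k.1 - (w * L : ℕ))).filter (fun i => (i, rowOf δ H0 k i) ∈ X))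
    (Finset.filter_subset _ _)
  choose jj hjj using hpig
  set J := Y'.image jj with hJ
  set Yj : ℤ → Finset (ℤ × ℤ) := fun j => Y'.filter (fun k => jj k = j) with hYj
  set Xf : ℤ → Finset (ℤ × ℤ) := fun j => X.filter (fun s => s.1 / (w : ℤ) = j) with hXf
  set lam' := lam / ((L : ℝ) + 1) with hlam'
  have hlam'0 : 0 < lam' := by positivity
  have hlam'1 : lam' ≤ 1 := by
    rw [hlam', div_le_one (by positivity)]; linarith
  have hfib : ∀ j, (δ ^ 2 * (Yj j).card) ^ α * lam' ^ p0 ≤ A * (δ ^ 2 * (Xf j).card) := by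
    intro j
    set Xj := (Xf j).image (fun s => (s.1 - j * w, s.2)) with hXj
    have hXc : ((Xj.card : ℕ) : ℝ) ≤ ((Xf j).card : ℝ) := Nat.cast_le.2 Finset.card_image_le
    have hmass : ∀ k ∈ Yj j, lam' ≤ δ * (((Finset.Icc (k.1 - 2 * (w * L : ℕ)) (k.1 - (w * L : ℕ))).filter
          (fun i => (i, rowOf δ H0 k i) ∈ X)).filter (fun i => i / (w : ℤ) = j)).card := by
      intro k hk
      rw [hYj, Finset.mem_filter] at hk
      have h1 := hjj k
      rw [hk.2] at h1
      have h2 := hhit k hk.1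
      rw [hlam', div_le_iff₀ (by positivity)]
      refine h2.trans ?_
      rw [mul_assoc, mul_comm _ ((L : ℝ) + 1)]
      exact mul_le_mul_of_nonneg_left h1 hδ.le
    have hCF := hfam j (Yj j) ((Finset.filter_subset _ _).trans hY') (by
      intro k hk x hx
      have h1 := hmass k hk
      have h2 : 0 < (((Finset.Icc (k.1 - 2 * (w * L : ℕ)) (k.1 - (w * L : ℕ))).filter
          (fun i => (i, rowOf δ H0 k i) ∈ X)).filter (fun i => i / (w : ℤ) = j)).card := by
        by_contra h0
        have : (((Finset.Icc (k.1 - 2 * (w * L : ℕ)) (k.1 - (w * L : ℕ))).filter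
          (fun i => (i, rowOf δ H0 k i) ∈ X)).filter (fun i => i / (w : ℤ) = j)).card = 0 := by omega
        rw [this] at h1
        simp at h1; linarith
      obtain ⟨i, hi⟩ := Finset.card_pos.1 h2
      rw [Finset.mem_filter, Finset.mem_filter, Finset.mem_Icc] at hi
      obtain ⟨⟨⟨i1, i2⟩, -⟩, i3⟩ := hi
      have i4 : j * w ≤ i := by rw [← i3]; exact Int.ediv_mul_le i hwz.ne'
      have i5 : i < (j + 1) * w := by rw [← i3]; exact Int.lt_ediv_add_one_mul_self i hwz
      have r1 : (k.1 : ℝ) - 2 * (w * L) ≤ i := by exact_mod_cast i1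
      have r2 : (i : ℝ) ≤ k.1 - w * L := by exact_mod_cast i2
      have r4 : (j : ℝ) * w ≤ i := by exact_mod_cast i4
      have r5 : (i : ℝ) < (j + 1) * w := by exact_mod_cast i5
      have s1 := mul_le_mul_of_nonneg_left r1 hδ.le
      have s2 := mul_le_mul_of_nonneg_left r2 hδ.le
      have s4 := mul_le_mul_of_nonneg_left r4 hδ.le
      have s5 := mul_le_mul_of_nonneg_left r5.le hδ.le
      obtain ⟨x0, x1⟩ := hx
      constructor <;> nlinarith)
    have := hcore δ (δ * w) (Yj j) _ _ _ Xj lam' hCF hlam'0 hlam'1 (by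
      intro k hk
      refine (hmass k hk).trans ?_
      apply mul_le_mul_of_nonneg_left _ hδ.le
      refine Nat.cast_le.2 ?_
      refine Finset.card_le_card_of_injOn (fun i => i - j * w) ?_ (fun a _ b _ hab => by simpa using hab)
      intro i hi
      rw [Finset.mem_coe, Finset.mem_filter, Finset.mem_filter, Finset.mem_Icc] at hi
      obtain ⟨⟨⟨i1, i2⟩, i6⟩, i3⟩ := hi
      have i4 : j * w ≤ i := by rw [← i3]; exact Int.ediv_mul_le i hwz.ne'
      have i5 : i < (j + 1) * w := by rw [← i3]; exact Int.lt_ediv_add_one_mul_self i hwz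
      rw [Finset.mem_coe, hits, Finset.mem_filter, Finset.mem_Icc]
      have e : δ * w / δ = ((w : ℤ) : ℝ) := by push_cast; field_simp
      refine ⟨⟨by linarith, ?_⟩, ?_⟩
      · rw [e, Int.floor_intCast]; linarith
      · rw [hXj, Finset.mem_image]
        refine ⟨(i, rowOf δ H0 k i), ?_, ?_⟩
        · rw [hXf, Finset.mem_filter]; exact ⟨i6, i3⟩
        · simp only [rowOf, Prod.mk.injEq, true_and]
          congr 3
          push_cast; ring)
    exact this.trans (by gcongr)
  set M := A * lam'⁻¹ ^ p0 with hM
  have hM0 : 0 < M := by positivity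
  have hα' : 1 ≤ 1 / α := by rw [le_div_iff₀ hα0]; linarith
  have hY1 : ∀ j, δ ^ 2 * ((Yj j).card : ℝ) ≤ (M * (δ ^ 2 * (Xf j).card)) ^ (1 / α) := by
    intro j
    have h1 : (δ ^ 2 * ((Yj j).card : ℝ)) ^ α ≤ M * (δ ^ 2 * (Xf j).card) := by
      have : M * (δ ^ 2 * ((Xf j).card : ℝ)) = A * (δ ^ 2 * (Xf j).card) / lam' ^ p0 := by
        rw [hM, Real.inv_rpow hlam'0.le]; ring
      rw [this, le_div_iff₀ (by positivity)]
      exact hfib j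
    calc δ ^ 2 * ((Yj j).card : ℝ) = ((δ ^ 2 * ((Yj j).card : ℝ)) ^ α) ^ (1 / α) := by
          rw [← Real.rpow_mul (by positivity), mul_one_div_cancel hα0.ne', Real.rpow_one]
      _ ≤ _ := Real.rpow_le_rpow (by positivity) h1 (by positivity)
  have hsumY : δ ^ 2 * (Y'.card : ℝ) = ∑ j ∈ J, δ ^ 2 * ((Yj j).card : ℝ) := by
    have := Finset.card_eq_sum_card_image jj Y'
    rw [← Finset.mul_sum, this]
    push_cast; rfl
  have hsumX : ∑ j ∈ J, M * (δ ^ 2 * ((Xf j).card : ℝ)) ≤ M * (δ ^ 2 * X.card) := by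
    rw [← Finset.mul_sum, ← Finset.mul_sum]
    apply mul_le_mul_of_nonneg_left _ hM0.le
    apply mul_le_mul_of_nonneg_left _ (by positivity)
    have h1 : ∑ j ∈ J, (Xf j).card = (J.biUnion Xf).card := by
      rw [Finset.card_biUnion]
      intro a _ b _ hab
      rw [Function.onFun, Finset.disjoint_left]
      intro s hs hs'
      rw [hXf, Finset.mem_filter] at hs hs'
      exact hab (hs.2.symm.trans hs'.2)
    have h2 : (J.biUnion Xf).card ≤ X.card := Finset.card_le_card
      (Finset.biUnion_subset.2 fun j _ => Finset.filter_subset _ _)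
    rw [← h1] at h2
    exact_mod_cast h2
  have hfin : δ ^ 2 * (Y'.card : ℝ) ≤ (M * (δ ^ 2 * X.card)) ^ (1 / α) := by
    rw [hsumY]
    refine (Finset.sum_le_sum fun j _ => hY1 j).trans ?_
    refine (sum_rpow_le _ _ (fun j _ => by positivity) hα').trans ?_
    exact Real.rpow_le_rpow (Finset.sum_nonneg fun j _ => by positivity) hsumX (by positivity)
  have h3 : (δ ^ 2 * (Y'.card : ℝ)) ^ α ≤ M * (δ ^ 2 * X.card) := by
    calc (δ ^ 2 * (Y'.card : ℝ)) ^ α ≤ ((M * (δ ^ 2 * X.card)) ^ (1 / α)) ^ α :=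
          Real.rpow_le_rpow (by positivity) hfin hα0.le
      _ = _ := by rw [← Real.rpow_mul (by positivity), one_div_mul_cancel hα0.ne', Real.rpow_one]
  calc (δ ^ 2 * (Y'.card : ℝ)) ^ α * lam ^ p0 ≤ M * (δ ^ 2 * X.card) * lam ^ p0 := by gcongr
    _ = _ := by
      rw [hM, hlam', inv_div, Real.div_rpow (by positivity) hlam.le]
      field_simp

open Classical in
/-- Strong discrete bound. -/
lemma discrete_bound {C0 α p : ℝ} (hC0 : 1 ≤ C0) (hα : 1 / 2 < α) (hα1 : α ≤ 1) (hp : 3 - α < p) (L : ℕ) (hL : 8 ≤ L) :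
    ∃ C > 0, ∀ (δ : ℝ) (w : ℕ) (Y : Finset (ℤ × ℤ)) (H0 H1 H2 : ℤ × ℤ → ℝ → ℝ), 1 ≤ w → δ = 1 / (2 * (w * L)) →
      StripFam δ C0 w Y H0 H1 H2 → ∀ (F : ℤ × ℤ → ℝ) (U : Finset (ℤ × ℤ)), (∀ x, 0 ≤ F x) → (∀ x, x ∉ U → F x = 0) →
      ∑ k ∈ Y, δ ^ 2 * (δ * ∑ i ∈ Finset.Icc (k.1 - 2 * (w * L : ℕ)) (k.1 - (w * L : ℕ)),
        F (i, rowOf δ H0 k i)) ^ (p / α) ≤ C * (δ ^ 2 * ∑ x ∈ U, F x ^ p) ^ (1 / α) := by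
  have hε : 0 < (p - (3 - α)) / 2 := by linarith
  obtain ⟨A, hA, hweak⟩ := strip_weak hC0 hα hα1 hε L hL
  obtain ⟨C, hC, hm⟩ := marc (κ := ℤ × ℤ) (ξ := ℤ × ℤ) (α := α) (p := p) (p0 := 3 - α + (p - (3 - α)) / 2) (A := A)
    (by linarith) hα1 (by linarith) (by linarith) hA
  refine ⟨C, hC, ?_⟩
  intro δ w Y H0 H1 H2 hw hδe hfam F U hF hU
  have hw0 : (1 : ℝ) ≤ w := by exact_mod_cast hw
  have hL0 : (8 : ℝ) ≤ L := by exact_mod_cast hL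
  have hδ : 0 < δ := by rw [hδe]; positivity
  refine hm δ (δ ^ 2) Y (fun k => Finset.Icc (k.1 - 2 * (w * L : ℕ)) (k.1 - (w * L : ℕ)))
    (fun k i => (i, rowOf δ H0 k i)) F U hδ (by positivity) ?_ hF hU ?_
  · intro k hk
    rw [Int.card_Icc]
    have e : (k.1 - (w * L : ℕ) + 1 - (k.1 - 2 * (w * L : ℕ))).toNat = w * L + 1 := by omega
    rw [e, hδe, one_div, inv_mul_le_iff₀ (by positivity)]
    push_cast
    nlinarith
  · intro Y' hY' X lam h1 h2 h3
    refine hweak δ w Y H0 H1 H2 hw hδe hfam Y' hY' X lam h1 h2 ?_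
    intro k hk
    convert h3 k hk

/-- Quantitative information about `φ` near zero. -/
structure PhiPack (r m M : ℝ) (φ A B B1 : ℝ → ℝ) : Prop where
  hr : 0 < r
  hr1 : r ≤ 1
  hm : 0 < m
  hM : 1 ≤ M
  dG : ∀ u σ : ℝ, |σ * u| ≤ r → HasDerivAt (fun u => u ^ 2 * φ (σ * u)) (u * A (σ * u)) u
  dA : ∀ u σ : ℝ, |σ * u| ≤ r → HasDerivAt (fun u => u * A (σ * u)) (B (σ * u)) u
  dB : ∀ z : ℝ, |z| ≤ r → HasDerivAt B (B1 z) z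
  bφ : ∀ z : ℝ, |z| ≤ r → |φ z| ≤ M
  bA : ∀ z : ℝ, |z| ≤ r → |A z| ≤ M
  bB : ∀ z : ℝ, |z| ≤ r → |B z| ≤ M
  bB1 : ∀ z : ℝ, |z| ≤ r → |B1 z| ≤ M
  lφ : ∀ z z' : ℝ, |z| ≤ r → |z'| ≤ r → |φ z - φ z'| ≤ M * |z - z'|
  lA : ∀ z z' : ℝ, |z| ≤ r → |z'| ≤ r → |A z - A z'| ≤ M * |z - z'|
  lB1 : ∀ z z' : ℝ, |z| ≤ r → |z'| ≤ r → |B1 z - B1 z'| ≤ M * |z - z'|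
  mA : ∀ z : ℝ, |z| ≤ r → m ≤ |A z|
  eA : ∀ z z' : ℝ, |z| ≤ r → |z'| ≤ r → m * |z - z'| ≤ |A z - A z'|
  eB : ∀ z z' : ℝ, |z| ≤ r → |z'| ≤ r → m * |z - z'| ≤ |B z - B z'|

section
variable {r m M : ℝ} {φ A B B1 : ℝ → ℝ}

lemma PhiPack.u_bound (h : PhiPack r m M φ A B B1) {u u' z z' : ℝ} (hu' : 0 ≤ u' ∧ u' ≤ 2)
    (hz : |z| ≤ r) (hz' : |z'| ≤ r) :
    m * |u - u'| ≤ |u * A z - u' * A z'| + 2 * M * |z - z'| := by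
  have h1 : m * |u - u'| ≤ |(u - u') * A z| := by
    rw [abs_mul, mul_comm]
    exact mul_le_mul_of_nonneg_left (h.mA z hz) (abs_nonneg _)
  have h2 : (u - u') * A z = (u * A z - u' * A z') - u' * (A z - A z') := by ring
  have h3 : |u' * (A z - A z')| ≤ 2 * (M * |z - z'|) := by
    rw [abs_mul]
    exact mul_le_mul (abs_le.2 ⟨by linarith, hu'.2⟩) (h.lA z z' hz hz') (abs_nonneg _) (by norm_num)
  rw [h2] at h1
  have h4 := abs_sub (u * A z - u' * A z') (u' * (A z - A z'))
  linarith

lemma PhiPack.G_bound (h : PhiPack r m M φ A B B1) {u u' z z' : ℝ} (hu : 0 ≤ u ∧ u ≤ 2) (hu' : 0 ≤ u' ∧ u' ≤ 2)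
    (hz : |z| ≤ r) (hz' : |z'| ≤ r) :
    |u ^ 2 * φ z - u' ^ 2 * φ z'| ≤ 4 * M * |u - u'| + 4 * M * |z - z'| := by
  have e : u ^ 2 * φ z - u' ^ 2 * φ z' = (u - u') * (u + u') * φ z + u' ^ 2 * (φ z - φ z') := by ring
  rw [e]
  refine (abs_add_le _ _).trans (add_le_add ?_ ?_)
  · rw [abs_mul, abs_mul]
    have h1 : |u + u'| ≤ 4 := abs_le.2 ⟨by linarith, by linarith⟩
    calc |u - u'| * |u + u'| * |φ z| ≤ |u - u'| * 4 * M := by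
          gcongr
          exact h.bφ z hz
      _ = _ := by ring
  · rw [abs_mul]
    have h1 : |u' ^ 2| ≤ 4 := by rw [abs_of_nonneg (by positivity)]; nlinarith
    calc |u' ^ 2| * |φ z - φ z'| ≤ 4 * (M * |z - z'|) :=
          mul_le_mul h1 (h.lφ z z' hz hz') (abs_nonneg _) (by norm_num)
      _ = _ := by ring

lemma PhiPack.sig_bound {u u' σ σ' : ℝ} (hu : 1 / 4 ≤ u ∧ u ≤ 2)
    (hσ' : 0 ≤ σ' ∧ σ' ≤ 1) :
    |σ - σ'| ≤ 4 * |σ * u - σ' * u'| + 4 * |u - u'| := by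
  have e : (σ - σ') * u = (σ * u - σ' * u') - σ' * (u - u') := by ring
  have h1 : |(σ - σ') * u| ≤ |σ * u - σ' * u'| + |u - u'| := by
    rw [e]
    refine (abs_sub _ _).trans ?_
    have : |σ' * (u - u')| ≤ 1 * |u - u'| := by
      rw [abs_mul]
      exact mul_le_mul_of_nonneg_right (abs_le.2 ⟨by linarith, hσ'.2⟩) (abs_nonneg _)
    linarith
  rw [abs_mul, abs_of_pos (by linarith : 0 < u)] at h1
  nlinarith [abs_nonneg (σ - σ')]

lemma PhiPack.B_var (h : PhiPack r m M φ A B B1) {u u' σ σ' c0 : ℝ} (hσ : 0 ≤ σ ∧ σ ≤ r / 2)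
    (hσ' : 0 ≤ σ' ∧ σ' ≤ r / 2) (hc0 : 0 ≤ c0) (hc1 : c0 ≤ 1)
    (hu : ∀ x ∈ Icc (0 : ℝ) c0, 1 / 4 ≤ u - x ∧ u - x ≤ 2)
    (hu' : ∀ x ∈ Icc (0 : ℝ) c0, 1 / 4 ≤ u' - x ∧ u' - x ≤ 2) (x : ℝ) (hx : x ∈ Icc (0 : ℝ) c0) :
    |(B (σ * (u - x)) - B (σ' * (u' - x))) - (B (σ * u) - B (σ' * u'))| ≤
      (2 * M * |σ - σ'| + M * |σ * u - σ' * u'|) * c0 := by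
  have hM0 : 0 < M := by linarith [h.hM]
  have hr1 := h.hr1
  have hz : ∀ y ∈ Icc (0 : ℝ) c0, |σ * (u - y)| ≤ r := by
    intro y hy
    have := hu y hy
    rw [abs_of_nonneg (mul_nonneg hσ.1 (by linarith))]
    nlinarith [hσ.1, hσ.2]
  have hz' : ∀ y ∈ Icc (0 : ℝ) c0, |σ' * (u' - y)| ≤ r := by
    intro y hy
    have := hu' y hy
    rw [abs_of_nonneg (mul_nonneg hσ'.1 (by linarith))]
    nlinarith [hσ'.1, hσ'.2]
  have hd : ∀ y ∈ Icc (0 : ℝ) c0, HasDerivWithinAt (fun y => B (σ * (u - y)) - B (σ' * (u' - y)))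
      (-(σ * B1 (σ * (u - y))) + σ' * B1 (σ' * (u' - y))) (Icc (0 : ℝ) c0) y := by
    intro y hy
    have i1 : HasDerivAt (fun y => σ * (u - y)) (-σ) y := by
      have := ((hasDerivAt_id y).const_sub u).const_mul σ
      simpa using this
    have i2 : HasDerivAt (fun y => σ' * (u' - y)) (-σ') y := by
      have := ((hasDerivAt_id y).const_sub u').const_mul σ'
      simpa using this
    have j1 := (h.dB _ (hz y hy)).comp y i1
    have j2 := (h.dB _ (hz' y hy)).comp y i2
    refine (j1.sub j2).hasDerivWithinAt.congr_deriv ?_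
    ring
  have hb : ∀ y ∈ Icc (0 : ℝ) c0, ‖-(σ * B1 (σ * (u - y))) + σ' * B1 (σ' * (u' - y))‖ ≤
      2 * M * |σ - σ'| + M * |σ * u - σ' * u'| := by
    intro y hy
    have e : -(σ * B1 (σ * (u - y))) + σ' * B1 (σ' * (u' - y)) =
      -((σ - σ') * B1 (σ * (u - y))) - σ' * (B1 (σ * (u - y)) - B1 (σ' * (u' - y))) := by ring
    rw [Real.norm_eq_abs, e]
    refine (abs_sub _ _).trans ?_
    rw [abs_neg, abs_mul, abs_mul]
    have i1 : |σ - σ'| * |B1 (σ * (u - y))| ≤ |σ - σ'| * M :=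
      mul_le_mul_of_nonneg_left (h.bB1 _ (hz y hy)) (abs_nonneg _)
    have i3 : |σ * (u - y) - σ' * (u' - y)| ≤ |σ * u - σ' * u'| + |σ - σ'| := by
      have e : σ * (u - y) - σ' * (u' - y) = (σ * u - σ' * u') - y * (σ - σ') := by ring
      rw [e]
      refine (abs_sub _ _).trans ?_
      rw [abs_mul, abs_of_nonneg hy.1]
      nlinarith [abs_nonneg (σ - σ'), hy.2]
    have i2 : |σ'| * |B1 (σ * (u - y)) - B1 (σ' * (u' - y))| ≤ 1 * (M * (|σ * u - σ' * u'| + |σ - σ'|)) := by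
      refine mul_le_mul (abs_le.2 ⟨by linarith, by linarith⟩)
        ((h.lB1 _ _ (hz y hy) (hz' y hy)).trans (mul_le_mul_of_nonneg_left i3 hM0.le)) (abs_nonneg _) (by norm_num)
    linarith
  have := (convex_Icc (0 : ℝ) c0).norm_image_sub_le_of_norm_hasDerivWithin_le hd hb (left_mem_Icc.2 hc0) hx
  simp only [sub_zero, Real.norm_eq_abs] at this
  refine this.trans ?_
  apply mul_le_mul_of_nonneg_left _ (by positivity)
  rw [abs_of_nonneg hx.1]; exact hx.2

/-- the concrete family of curves -/
noncomputable def cH0 (φ : ℝ → ℝ) (δ : ℝ) (σ : ℤ × ℤ → ℝ) (k : ℤ × ℤ) (x : ℝ) : ℝ :=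
  δ * k.2 - (δ * k.1 - x) ^ 2 * φ (σ k * (δ * k.1 - x))

set_option maxHeartbeats 2000000 in
lemma PhiPack.stripFam (h : PhiPack r m M φ A B B1) :
    ∃ C0 ≥ 1, ∃ L : ℕ, 8 ≤ L ∧ ∀ (w : ℕ) (δ : ℝ) (Y : Finset (ℤ × ℤ)) (σ : ℤ × ℤ → ℝ), 1 ≤ w →
      δ = 1 / (2 * (w * L)) → (∀ k, 0 ≤ σ k ∧ σ k ≤ r / 2) →
      StripFam δ C0 w Y (cH0 φ δ σ) (fun k x => (δ * k.1 - x) * A (σ k * (δ * k.1 - x)))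
        (fun k x => -B (σ k * (δ * k.1 - x))) := by
  have hM := h.hM
  have hm := h.hm
  have hM0 : 0 < M := by linarith
  -- `|z - z'| ≤ a jetd`, `|u - u'| ≤ b jetd`, `|σ - σ'| ≤ 4 (a + b) jetd`
  set ca := 1 / m with hca
  set cb := (1 + 2 * M * ca) / m with hcb
  have hca0 : 0 < ca := by positivity
  have hcb0 : 0 < cb := by positivity
  set K := 2 * M * (4 * ca + 4 * cb) + M * ca with hK
  have hK0 : 0 < K := by positivity
  set C0 := 1 + cb + 4 * M * cb + 4 * M * ca + 16 * M * ca + 22 * M with hC0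
  have hC01 : 1 ≤ C0 := by
    have : 0 < cb + 4 * M * cb + 4 * M * ca + 16 * M * ca + 22 * M := by positivity
    linarith
  obtain ⟨L0, hL0⟩ := exists_nat_ge (8 * K)
  refine ⟨C0, hC01, max L0 8, le_max_right _ _, ?_⟩
  intro w δ Y σ hw hδe hσ
  set L := max L0 8 with hL
  have hL8 : (8 : ℝ) ≤ L := by exact_mod_cast le_max_right L0 8
  have hLK : 8 * K ≤ L := hL0.trans (by exact_mod_cast le_max_left L0 8)
  have hw1 : (1 : ℝ) ≤ w := by exact_mod_cast hw
  have hw0 : (0 : ℝ) < w := by linarith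
  have hδ : 0 < δ := by rw [hδe]; positivity
  have hδwL : δ * w * L = 1 / 2 := by rw [hδe]; field_simp
  have hδw0 : 0 < δ * w := by positivity
  have hδw : δ * w ≤ 1 / 16 := by nlinarith
  have hδw' : K * (δ * w) ≤ 1 / 16 := by nlinarith
  intro j Y' hY' hu
  set c0 := δ * w with hc0
  have huu : ∀ k ∈ Y', ∀ x ∈ Icc (0 : ℝ) c0, 1 / 4 ≤ (δ * k.1 - j * c0) - x ∧ (δ * k.1 - j * c0) - x ≤ 2 := by
    intro k hk x hx
    have := hu k hk x hx
    constructor <;> linarith [this.1, this.2]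
  have hz : ∀ k ∈ Y', ∀ x ∈ Icc (0 : ℝ) c0, |σ k * (δ * k.1 - (x + j * c0))| ≤ r := by
    intro k hk x hx
    have h1 := hu k hk x hx
    have h2 := hσ k
    rw [abs_of_nonneg (mul_nonneg h2.1 (by linarith))]
    nlinarith
  have h0mem : (0 : ℝ) ∈ Icc (0 : ℝ) c0 := left_mem_Icc.2 hδw0.le
  -- main jet estimates
  have key : ∀ k ∈ Y', ∀ k' ∈ Y', ∀ x ∈ Icc (0 : ℝ) c0,
      |σ k * (δ * k.1 - (x + j * c0)) - σ k' * (δ * k'.1 - (x + j * c0))| ≤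
        ca * |-B (σ k * (δ * k.1 - (x + j * c0))) - -B (σ k' * (δ * k'.1 - (x + j * c0)))| := by
    intro k hk k' hk' x hx
    have h1 := h.eB _ _ (hz k hk x hx) (hz k' hk' x hx)
    rw [neg_sub_neg, abs_sub_comm (B _), hca, one_div, ← div_eq_inv_mul, le_div_iff₀ hm]
    linarith
  set H0 : ℤ × ℤ → ℝ → ℝ := fun k x => cH0 φ δ σ k (x + j * c0) with hH0
  set H1 : ℤ × ℤ → ℝ → ℝ := fun k x => (δ * k.1 - (x + j * c0)) * A (σ k * (δ * k.1 - (x + j * c0))) with hH1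
  set H2 : ℤ × ℤ → ℝ → ℝ := fun k x => -B (σ k * (δ * k.1 - (x + j * c0))) with hH2
  have jz : ∀ k ∈ Y', ∀ k' ∈ Y', |σ k * (δ * k.1 - (0 + j * c0)) - σ k' * (δ * k'.1 - (0 + j * c0))| ≤
      ca * jetd H0 H1 H2 k k' := by
    intro k hk k' hk'
    refine (key k hk k' hk' 0 h0mem).trans ?_
    apply mul_le_mul_of_nonneg_left _ hca0.le
    unfold jetd
    linarith [abs_nonneg (H0 k 0 - H0 k' 0), abs_nonneg (H1 k 0 - H1 k' 0)]
  have ju : ∀ k ∈ Y', ∀ k' ∈ Y', |(δ * k.1 - (0 + j * c0)) - (δ * k'.1 - (0 + j * c0))| ≤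
      cb * jetd H0 H1 H2 k k' := by
    intro k hk k' hk'
    have h1 := h.u_bound (u := δ * k.1 - (0 + j * c0)) (u' := δ * k'.1 - (0 + j * c0))
      ⟨by linarith [(hu k' hk' 0 h0mem).1], (hu k' hk' 0 h0mem).2⟩ (hz k hk 0 h0mem) (hz k' hk' 0 h0mem)
    have h2 := jz k hk k' hk'
    have h3 : |H1 k 0 - H1 k' 0| ≤ jetd H0 H1 H2 k k' := by
      unfold jetd
      linarith [abs_nonneg (H0 k 0 - H0 k' 0), abs_nonneg (H2 k 0 - H2 k' 0)]
    rw [hcb, div_mul_eq_mul_div, le_div_iff₀ hm]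
    have h4 := mul_le_mul_of_nonneg_left h2 (by positivity : 0 ≤ 2 * M)
    have h5 : |(δ * k.1 - (0 + j * c0)) * A (σ k * (δ * k.1 - (0 + j * c0))) -
      (δ * k'.1 - (0 + j * c0)) * A (σ k' * (δ * k'.1 - (0 + j * c0)))| ≤ jetd H0 H1 H2 k k' := h3
    linarith
  have jd0 : ∀ k k', 0 ≤ jetd H0 H1 H2 k k' := by
    intro k k'; unfold jetd; positivity
  have k2 : ∀ (k k' : ℤ × ℤ) (x : ℝ), δ * ((k.2 : ℝ) - k'.2) = (H0 k x - H0 k' x) +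
      ((δ * k.1 - (x + j * c0)) ^ 2 * φ (σ k * (δ * k.1 - (x + j * c0))) -
        (δ * k'.1 - (x + j * c0)) ^ 2 * φ (σ k' * (δ * k'.1 - (x + j * c0)))) := by
    intro k k' x
    simp only [hH0, cH0]; ring
  have k2a : ∀ (k k' : ℤ × ℤ), δ * |(k.2 : ℝ) - k'.2| = |δ * ((k.2 : ℝ) - k'.2)| := by
    intro k k'; rw [abs_mul, abs_of_pos hδ]
  have gb : ∀ k ∈ Y', ∀ x ∈ Icc (0 : ℝ) c0,
      |(δ * k.1 - (x + j * c0)) ^ 2 * φ (σ k * (δ * k.1 - (x + j * c0)))| ≤ 4 * M := by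
    intro k hk x hx
    have h1 := hu k hk x hx
    rw [abs_mul]
    refine mul_le_mul ?_ (h.bφ _ (hz k hk x hx)) (abs_nonneg _) (by norm_num)
    rw [abs_of_nonneg (by positivity)]; nlinarith
  have hdx : ∀ (k : ℤ × ℤ) (x : ℝ), HasDerivAt (fun x => δ * k.1 - (x + j * c0)) (-1) x := by
    intro k x
    have := ((hasDerivAt_id x).add_const (j * c0)).const_sub (δ * k.1)
    simpa using this
  refine ⟨hδ, ?_, hδw0, hδw, hC01, ?_, ?_, ?_, ?_, ?_, ?_⟩
  · rw [hδe]
    rw [div_le_div_iff₀ (by positivity) (by norm_num)]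
    nlinarith
  · intro k hk x hx
    have h1 := ((h.dG _ (σ k) (hz k hk x hx)).comp x (hdx k x)).const_sub (δ * k.2)
    refine h1.congr_deriv ?_
    ring
  · intro k hk x hx
    have h1 := (h.dA _ (σ k) (hz k hk x hx)).comp x (hdx k x)
    refine h1.congr_deriv ?_
    ring
  · intro k hk k' hk' x hx
    have h1 := h.B_var (hσ k) (hσ k') hδw0.le (by linarith) (huu k hk) (huu k' hk') x hx
    have e1 : ∀ k : ℤ × ℤ, δ * k.1 - j * c0 - x = δ * k.1 - (x + j * c0) := fun k => by ring
    have e2 : ∀ k : ℤ × ℤ, δ * k.1 - j * c0 = δ * k.1 - (0 + j * c0) := fun k => by ring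
    simp only [e1] at h1
    simp only [e2] at h1
    have h2 := PhiPack.sig_bound (u := δ * k.1 - (0 + j * c0)) (u' := δ * k'.1 - (0 + j * c0)) (σ := σ k)
      (hu k hk 0 h0mem) ⟨(hσ k').1, by linarith [(hσ k').2, h.hr1]⟩
    have h3 := jz k hk k' hk'
    have h4 := ju k hk k' hk'
    have e3 : H2 k x - H2 k' x - (H2 k 0 - H2 k' 0) =
      -((B (σ k * (δ * k.1 - (x + j * c0))) - B (σ k' * (δ * k'.1 - (x + j * c0)))) -
        (B (σ k * (δ * k.1 - (0 + j * c0))) - B (σ k' * (δ * k'.1 - (0 + j * c0))))) := by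
      simp only [hH2]; ring
    rw [e3, abs_neg]
    refine h1.trans ?_
    have h5 : |σ k - σ k'| ≤ (4 * ca + 4 * cb) * jetd H0 H1 H2 k k' := by linarith
    have h6 : 2 * M * |σ k - σ k'| + M * |σ k * (δ * k.1 - (0 + j * c0)) - σ k' * (δ * k'.1 - (0 + j * c0))| ≤
        K * jetd H0 H1 H2 k k' := by
      have i1 := mul_le_mul_of_nonneg_left h5 (by positivity : 0 ≤ 2 * M)
      have i2 := mul_le_mul_of_nonneg_left h3 hM0.le
      rw [hK]; linarith
    calc _ ≤ (K * jetd H0 H1 H2 k k') * c0 := mul_le_mul_of_nonneg_right h6 hδw0.le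
      _ = (K * c0) * jetd H0 H1 H2 k k' := by ring
      _ ≤ (1 / 16) * jetd H0 H1 H2 k k' := mul_le_mul_of_nonneg_right hδw' (jd0 k k')
      _ = _ := by ring
  · intro k hk k' hk' hkk x hx
    rw [k2a, k2 k k' x]
    refine (abs_add_le _ _).trans ?_
    have h1 := h.G_bound (u := δ * k.1 - (x + j * c0)) (u' := δ * k'.1 - (x + j * c0))
      ⟨by linarith [(hu k hk x hx).1], (hu k hk x hx).2⟩ ⟨by linarith [(hu k' hk' x hx).1], (hu k' hk' x hx).2⟩
      (hz k hk x hx) (hz k' hk' x hx)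
    have hu1 := hu k hk x hx
    have h2 := h.eA _ _ (hz k hk x hx) (hz k' hk' x hx)
    have h3 : |H1 k x - H1 k' x| = (δ * k.1 - (x + j * c0)) *
        |A (σ k * (δ * k.1 - (x + j * c0))) - A (σ k' * (δ * k'.1 - (x + j * c0)))| := by
      simp only [hH1]
      rw [← hkk, ← mul_sub, abs_mul, abs_of_pos (by linarith)]
    rw [hkk, sub_self, abs_zero, mul_zero, zero_add, ← hkk] at h1
    rw [← hkk] at h2 h3
    set Z := |σ k * (δ * k.1 - (x + j * c0)) - σ k' * (δ * k.1 - (x + j * c0))| with hZ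
    set D := |A (σ k * (δ * k.1 - (x + j * c0))) - A (σ k' * (δ * k.1 - (x + j * c0)))| with hD
    have hD0 : 0 ≤ D := abs_nonneg _
    have h4 : D ≤ 4 * |H1 k x - H1 k' x| := by rw [h3]; nlinarith
    have h5 : Z ≤ ca * D := by
      rw [hca, one_div, ← div_eq_inv_mul, le_div_iff₀ hm]; linarith
    have h6 : 4 * M * Z ≤ 16 * M * ca * |H1 k x - H1 k' x| := by
      calc 4 * M * Z ≤ 4 * M * (ca * (4 * |H1 k x - H1 k' x|)) := by gcongr; exact h5.trans (by gcongr)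
        _ = _ := by ring
    rw [← hkk]
    have h7 : 16 * M * ca * |H1 k x - H1 k' x| ≤ C0 * |H1 k x - H1 k' x| := by
      apply mul_le_mul_of_nonneg_right _ (abs_nonneg _)
      have : 0 < cb + 4 * M * cb + 4 * M * ca + 22 * M := by positivity
      linarith
    have h8 : |H0 k x - H0 k' x| ≤ C0 * |H0 k x - H0 k' x| := le_mul_of_one_le_left (abs_nonneg _) hC01
    rw [mul_add]
    linarith
  · intro k hk k' hk'
    have h3 := jz k hk k' hk'
    have h4 := ju k hk k' hk'
    have hj := jd0 k k'
    have q1 : 0 < M * cb := by positivity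
    have q2 : 0 < M * ca := by positivity
    constructor
    · have e : (δ * k.1 - (0 + j * c0)) - (δ * k'.1 - (0 + j * c0)) = δ * ((k.1 : ℝ) - k'.1) := by ring
      rw [e, abs_mul, abs_of_pos hδ] at h4
      refine h4.trans (mul_le_mul_of_nonneg_right ?_ hj)
      linarith
    · rw [k2a, k2 k k' 0]
      refine (abs_add_le _ _).trans ?_
      have h1 := h.G_bound (u := δ * k.1 - (0 + j * c0)) (u' := δ * k'.1 - (0 + j * c0))
        ⟨by linarith [(hu k hk 0 h0mem).1], (hu k hk 0 h0mem).2⟩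
        ⟨by linarith [(hu k' hk' 0 h0mem).1], (hu k' hk' 0 h0mem).2⟩
        (hz k hk 0 h0mem) (hz k' hk' 0 h0mem)
      have h5 : |H0 k 0 - H0 k' 0| ≤ jetd H0 H1 H2 k k' := by
        unfold jetd
        linarith [abs_nonneg (H1 k 0 - H1 k' 0), abs_nonneg (H2 k 0 - H2 k' 0)]
      have i1 := mul_le_mul_of_nonneg_left h4 (by positivity : 0 ≤ 4 * M)
      have i2 := mul_le_mul_of_nonneg_left h3 (by positivity : 0 ≤ 4 * M)
      calc _ ≤ jetd H0 H1 H2 k k' + (4 * M * (cb * jetd H0 H1 H2 k k') + 4 * M * (ca * jetd H0 H1 H2 k k')) := by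
            linarith
        _ = (1 + 4 * M * cb + 4 * M * ca) * jetd H0 H1 H2 k k' := by ring
        _ ≤ _ := by
            apply mul_le_mul_of_nonneg_right _ hj
            linarith
  · intro k hk k' hk' x hx hle
    have h1 : |δ * ((k.2 : ℝ) - k'.2)| ≤ 1 + 8 * M := by
      rw [k2 k k' x]
      refine (abs_add_le _ _).trans ?_
      have i1 := abs_sub ((δ * k.1 - (x + j * c0)) ^ 2 * φ (σ k * (δ * k.1 - (x + j * c0))))
        ((δ * k'.1 - (x + j * c0)) ^ 2 * φ (σ k' * (δ * k'.1 - (x + j * c0))))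
      linarith [gb k hk x hx, gb k' hk' x hx]
    have h2 : |H0 k 0 - H0 k' 0| ≤ 1 + 16 * M := by
      have e : H0 k 0 - H0 k' 0 = δ * ((k.2 : ℝ) - k'.2) -
        ((δ * k.1 - (0 + j * c0)) ^ 2 * φ (σ k * (δ * k.1 - (0 + j * c0))) -
        (δ * k'.1 - (0 + j * c0)) ^ 2 * φ (σ k' * (δ * k'.1 - (0 + j * c0)))) := by
        rw [k2 k k' 0]; ring
      rw [e]
      refine (abs_sub _ _).trans ?_
      have i1 := abs_sub ((δ * k.1 - (0 + j * c0)) ^ 2 * φ (σ k * (δ * k.1 - (0 + j * c0))))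
        ((δ * k'.1 - (0 + j * c0)) ^ 2 * φ (σ k' * (δ * k'.1 - (0 + j * c0))))
      linarith [gb k hk 0 h0mem, gb k' hk' 0 h0mem]
    have hb : ∀ k ∈ Y', |H1 k 0| ≤ 2 * M := by
      intro k hk
      have h1 := hu k hk 0 h0mem
      simp only [hH1]
      rw [abs_mul]
      exact mul_le_mul (abs_le.2 ⟨by linarith, h1.2⟩) (h.bA _ (hz k hk 0 h0mem)) (abs_nonneg _) (by norm_num)
    have hb2 : ∀ k ∈ Y', |H2 k 0| ≤ M := by
      intro k hk
      simp only [hH2]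
      rw [abs_neg]
      exact h.bB _ (hz k hk 0 h0mem)
    have h3 := abs_sub (H1 k 0) (H1 k' 0)
    have h4 := abs_sub (H2 k 0) (H2 k' 0)
    have h5 := hb k hk
    have h6 := hb k' hk'
    have h7 := hb2 k hk
    have h8 := hb2 k' hk'
    have q1 : 0 < M * cb := by positivity
    have q2 : 0 < M * ca := by positivity
    unfold jetd
    linarith
end

lemma mvt_upper {r M : ℝ} {f f' : ℝ → ℝ} (hd : ∀ z, |z| ≤ r → HasDerivAt f (f' z) z)
    (hb : ∀ z, |z| ≤ r → |f' z| ≤ M) (z z' : ℝ) (hz : |z| ≤ r) (hz' : |z'| ≤ r) :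
    |f z - f z'| ≤ M * |z - z'| := by
  have := (convex_Icc (-r) r).norm_image_sub_le_of_norm_hasDerivWithin_le (f := f) (f' := f') (C := M)
    (fun x hx => (hd x (abs_le.2 hx)).hasDerivWithinAt) (fun x hx => hb x (abs_le.2 hx))
    (abs_le.1 hz') (abs_le.1 hz)
  simpa using this

lemma mvt_lower {r m : ℝ} {f f' : ℝ → ℝ} (hd : ∀ z, |z| ≤ r → HasDerivAt f (f' z) z)
    (hb : ∀ z, |z| ≤ r → m ≤ |f' z|) (z z' : ℝ) (hz : |z| ≤ r) (hz' : |z'| ≤ r) :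
    m * |z - z'| ≤ |f z - f z'| := by
  wlog hlt : z < z' generalizing z z' with H
  · rcases eq_or_lt_of_le (not_lt.1 hlt) with h | h
    · simp [h]
    · have := H z' z hz' hz h
      rwa [abs_sub_comm z' z, abs_sub_comm (f z') (f z)] at this
  have hI : ∀ x ∈ Icc z z', |x| ≤ r := fun x hx =>
    abs_le.2 ⟨by linarith [(abs_le.1 hz).1, hx.1], by linarith [(abs_le.1 hz').2, hx.2]⟩
  obtain ⟨c, hc, hs⟩ := exists_hasDerivAt_eq_slope f f' hlt
    (fun x hx => (hd x (hI x hx)).continuousAt.continuousWithinAt)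
    (fun x hx => hd x (hI x (Ioo_subset_Icc_self hx)))
  have h1 := hb c (hI c (Ioo_subset_Icc_self hc))
  rw [hs, abs_div, le_div_iff₀ (abs_pos.2 (by linarith))] at h1
  rw [abs_sub_comm z, abs_sub_comm (f z)]
  exact h1

lemma bdd_near {r0 : ℝ} {f : ℝ → ℝ} (hf : ContinuousOn f (Icc (-r0) r0)) : ∃ M, ∀ z, |z| ≤ r0 → |f z| ≤ M := by
  obtain ⟨M, hM⟩ := isCompact_Icc.exists_bound_of_continuousOn hf
  exact ⟨M, fun z hz => hM z (abs_le.1 hz)⟩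

lemma low_near {f : ℝ → ℝ} {m : ℝ} (hf : ContinuousAt f 0) (hm : m < |f 0|) :
    ∃ r > 0, ∀ z, |z| ≤ r → m ≤ |f z| := by
  have h1 : ∀ᶠ z in nhds (0 : ℝ), m < |f z| := hf.abs.eventually (lt_mem_nhds hm)
  obtain ⟨r, hr, h2⟩ := Metric.eventually_nhds_iff.1 h1
  refine ⟨r / 2, by positivity, fun z hz => (h2 ?_).le⟩
  rw [Real.dist_eq, sub_zero]; linarith

lemma exists_pack {a b : ℝ} (ha : a < 0) (hb : 0 < b) {φ : ℝ → ℝ}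
    (hφ : ContDiffOn ℝ (⊤ : ℕ∞) φ (Set.Ioo a b)) (hφ0 : φ 0 ≠ 0) (hφ' : deriv φ 0 ≠ 0) :
    ∃ r m M A B B1, r < min (-a) b ∧ PhiPack r m M φ A B B1 := by
  have hle : ((⊤ : ℕ∞) : WithTop ℕ∞) + 1 ≤ ((⊤ : ℕ∞) : WithTop ℕ∞) := by
    exact_mod_cast le_top
  have hstep : ∀ g : ℝ → ℝ, ContDiffOn ℝ (⊤ : ℕ∞) g (Ioo a b) → ContDiffOn ℝ (⊤ : ℕ∞) (deriv g) (Ioo a b) :=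
    fun g hg => hg.deriv_of_isOpen isOpen_Ioo hle
  have hder : ∀ g : ℝ → ℝ, ContDiffOn ℝ (⊤ : ℕ∞) g (Ioo a b) → ∀ z ∈ Ioo a b, HasDerivAt g (deriv g z) z :=
    fun g hg z hz => ((hg.differentiableOn (by simp)).differentiableAt (isOpen_Ioo.mem_nhds hz)).hasDerivAt
  set φ1 := deriv φ with e1
  set φ2 := deriv φ1 with e2
  set φ3 := deriv φ2 with e3
  set φ4 := deriv φ3 with e4
  have s1 := hstep φ hφ
  have s2 := hstep _ s1
  have s3 := hstep _ s2
  have s4 := hstep _ s3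
  have d0 := hder _ hφ
  have d1 := hder _ s1
  have d2 := hder _ s2
  have d3 := hder _ s3
  set A : ℝ → ℝ := fun z => 2 * φ z + z * φ1 z with hA
  set A1 : ℝ → ℝ := fun z => 3 * φ1 z + z * φ2 z with hA1
  set B : ℝ → ℝ := fun z => 2 * φ z + 4 * (z * φ1 z) + z ^ 2 * φ2 z with hB
  set B1 : ℝ → ℝ := fun z => 6 * φ1 z + 6 * (z * φ2 z) + z ^ 2 * φ3 z with hB1
  set B2 : ℝ → ℝ := fun z => 12 * φ2 z + 8 * (z * φ3 z) + z ^ 2 * φ4 z with hB2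
  have c0 := hφ.continuousOn
  have c1 := s1.continuousOn
  have c2 := s2.continuousOn
  have c3 := s3.continuousOn
  have c4 := s4.continuousOn
  have dA : ∀ z ∈ Ioo a b, HasDerivAt A (A1 z) z := by
    intro z hz
    have := ((d0 z hz).const_mul 2).add ((hasDerivAt_id z).mul (d1 z hz))
    refine this.congr_deriv ?_
    simp only [hA1, id]; ring
  have dB : ∀ z ∈ Ioo a b, HasDerivAt B (B1 z) z := by
    intro z hz
    have := (((d0 z hz).const_mul 2).add (((hasDerivAt_id z).mul (d1 z hz)).const_mul 4)).add
      ((hasDerivAt_pow 2 z).mul (d2 z hz))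
    refine this.congr_deriv ?_
    simp only [hB1, id]; ring
  have dB1 : ∀ z ∈ Ioo a b, HasDerivAt B1 (B2 z) z := by
    intro z hz
    have := (((d1 z hz).const_mul 6).add (((hasDerivAt_id z).mul (d2 z hz)).const_mul 6)).add
      ((hasDerivAt_pow 2 z).mul (d3 z hz))
    refine this.congr_deriv ?_
    simp only [hB2, id]; ring
  set r0 := min (min (-a) b) 1 / 2 with hr0
  have hmin : 0 < min (min (-a) b) 1 := lt_min (lt_min (by linarith) hb) one_pos
  have hr00 : 0 < r0 := by positivity
  have m1 : min (min (-a) b) 1 ≤ min (-a) b := min_le_left _ _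
  have m2 : min (-a) b ≤ -a := min_le_left _ _
  have m3 : min (-a) b ≤ b := min_le_right _ _
  have m4 : min (min (-a) b) 1 ≤ 1 := min_le_right _ _
  have hsub : Icc (-r0) r0 ⊆ Ioo a b := fun z hz => ⟨by linarith [hz.1], by linarith [hz.2]⟩
  have h0mem : (0 : ℝ) ∈ Ioo a b := ⟨ha, hb⟩
  have cA : ContinuousOn A (Ioo a b) := fun z hz => (dA z hz).continuousAt.continuousWithinAt
  have cB : ContinuousOn B (Ioo a b) := fun z hz => (dB z hz).continuousAt.continuousWithinAt
  have cB1 : ContinuousOn B1 (Ioo a b) := fun z hz => (dB1 z hz).continuousAt.continuousWithinAt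
  have cA1 : ContinuousOn A1 (Ioo a b) := by simp only [hA1]; fun_prop
  have cB2 : ContinuousOn B2 (Ioo a b) := by simp only [hB2]; fun_prop
  obtain ⟨M0, hM0⟩ := bdd_near (c0.mono hsub)
  obtain ⟨M1, hM1⟩ := bdd_near (c1.mono hsub)
  obtain ⟨M2, hM2⟩ := bdd_near (cA.mono hsub)
  obtain ⟨M3, hM3⟩ := bdd_near (cA1.mono hsub)
  obtain ⟨M4, hM4⟩ := bdd_near (cB.mono hsub)
  obtain ⟨M5, hM5⟩ := bdd_near (cB1.mono hsub)
  obtain ⟨M6, hM6⟩ := bdd_near (cB2.mono hsub)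
  have hp0 : 0 < |φ 0| := abs_pos.2 hφ0
  have hp1 : 0 < |φ1 0| := abs_pos.2 hφ'
  obtain ⟨r1, hr1, hlA⟩ := low_near (f := A) (m := |φ 0|) (cA.continuousAt (isOpen_Ioo.mem_nhds h0mem)) (by
    simp only [hA, zero_mul, add_zero, abs_mul, abs_two]; linarith)
  obtain ⟨r2, hr2, hlA1⟩ := low_near (f := A1) (m := |φ1 0|) (cA1.continuousAt (isOpen_Ioo.mem_nhds h0mem)) (by
    simp only [hA1, zero_mul, add_zero, abs_mul]; norm_num; linarith)
  obtain ⟨r3, hr3, hlB1⟩ := low_near (f := B1) (m := |φ1 0|) (cB1.continuousAt (isOpen_Ioo.mem_nhds h0mem)) (by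
    simp only [hB1]; norm_num [abs_mul]; linarith)
  set r := min r0 (min r1 (min r2 r3)) with hr
  have k0 : r ≤ r0 := min_le_left _ _
  have k1 : r ≤ r1 := (min_le_right _ _).trans (min_le_left _ _)
  have k2 : r ≤ r2 := (min_le_right _ _).trans ((min_le_right _ _).trans (min_le_left _ _))
  have k3 : r ≤ r3 := (min_le_right _ _).trans ((min_le_right _ _).trans (min_le_right _ _))
  set m := min |φ 0| |φ1 0| with hm
  set M := max 1 (max M0 (max M1 (max M2 (max M3 (max M4 (max M5 M6)))))) with hM
  have g0 : M0 ≤ M := by simp [hM]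
  have g1 : M1 ≤ M := by simp [hM]
  have g2 : M2 ≤ M := by simp [hM]
  have g3 : M3 ≤ M := by simp [hM]
  have g4 : M4 ≤ M := by simp [hM]
  have g5 : M5 ≤ M := by simp [hM]
  have g6 : M6 ≤ M := by simp [hM]
  have hI : ∀ z, |z| ≤ r → z ∈ Ioo a b := fun z hz => hsub (abs_le.1 (hz.trans k0))
  refine ⟨r, m, M, A, B, B1, by linarith, ?_⟩
  have hm0 : m ≤ |φ 0| := min_le_left _ _
  have hm1 : m ≤ |φ1 0| := min_le_right _ _
  refine ⟨lt_min hr00 (lt_min hr1 (lt_min hr2 hr3)), by linarith, lt_min hp0 hp1, le_max_left _ _, ?_, ?_,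
    fun z hz => dB z (hI z hz), fun z hz => (hM0 z (hz.trans k0)).trans g0,
    fun z hz => (hM2 z (hz.trans k0)).trans g2, fun z hz => (hM4 z (hz.trans k0)).trans g4,
    fun z hz => (hM5 z (hz.trans k0)).trans g5,
    mvt_upper (fun z hz => d0 z (hI z hz)) (fun z hz => (hM1 z (hz.trans k0)).trans g1),
    mvt_upper (fun z hz => dA z (hI z hz)) (fun z hz => (hM3 z (hz.trans k0)).trans g3),
    mvt_upper (fun z hz => dB1 z (hI z hz)) (fun z hz => (hM6 z (hz.trans k0)).trans g6),
    fun z hz => hm0.trans (hlA z (hz.trans k1)),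
    mvt_lower (fun z hz => dA z (hI z hz)) (fun z hz => hm1.trans (hlA1 z (hz.trans k2))),
    mvt_lower (fun z hz => dB z (hI z hz)) (fun z hz => hm1.trans (hlB1 z (hz.trans k3)))⟩
  · intro u σ hz
    have i1 : HasDerivAt (fun u => σ * u) σ u := by simpa using (hasDerivAt_id u).const_mul σ
    have := (hasDerivAt_pow 2 u).mul ((d0 _ (hI _ hz)).comp u i1)
    refine this.congr_deriv ?_
    simp only [hA, Function.comp]; ring
  · intro u σ hz
    have i1 : HasDerivAt (fun u => σ * u) σ u := by simpa using (hasDerivAt_id u).const_mul σ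
    have := (hasDerivAt_id u).mul ((dA _ (hI _ hz)).comp u i1)
    refine this.congr_deriv ?_
    simp only [hA, hA1, hB, Function.comp, id]; ring

noncomputable def cellOf (δ : ℝ) (y : ℝ × ℝ) : ℤ × ℤ := (⌊y.1 / δ⌋, ⌊y.2 / δ⌋)

lemma measurable_cellOf (δ : ℝ) : Measurable (cellOf δ) := by
  unfold cellOf
  exact ((measurable_fst.div_const δ).floor).prodMk ((measurable_snd.div_const δ).floor)

lemma floor_mem {δ : ℝ} (hδ : 0 < δ) (x : ℝ) : δ * ⌊x / δ⌋ ≤ x ∧ x < δ * ⌊x / δ⌋ + δ := by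
  have h1 := Int.floor_le (x / δ)
  have h2 := Int.lt_floor_add_one (x / δ)
  rw [le_div_iff₀ hδ] at h1
  rw [div_lt_iff₀ hδ] at h2
  constructor <;> nlinarith

lemma cellOf_preimage {δ : ℝ} (hδ : 0 < δ) (k : ℤ × ℤ) :
    cellOf δ ⁻¹' {k} = Ico (δ * k.1) (δ * k.1 + δ) ×ˢ Ico (δ * k.2) (δ * k.2 + δ) := by
  have h : ∀ (x : ℝ) (n : ℤ), ⌊x / δ⌋ = n ↔ x ∈ Ico (δ * n) (δ * n + δ) := by
    intro x n
    rw [Int.floor_eq_iff, le_div_iff₀ hδ, div_lt_iff₀ hδ, mem_Ico]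
    constructor <;> rintro ⟨h1, h2⟩ <;> constructor <;> linarith
  ext y
  rw [mem_preimage, mem_singleton_iff, mem_prod, cellOf, Prod.ext_iff]
  simp only [h]

lemma cell_lintegral {δ : ℝ} (hδ : 0 < δ) (g : ℤ × ℤ → ℝ≥0∞) :
    ∫⁻ y : ℝ × ℝ, g (cellOf δ y) = ENNReal.ofReal (δ ^ 2) * ∑' k, g k := by
  rw [← lintegral_map (f := g) (measurable_of_countable g) (measurable_cellOf δ), lintegral_countable',
    ← ENNReal.tsum_mul_left]
  refine tsum_congr fun k => ?_
  rw [Measure.map_apply (measurable_cellOf δ) (measurableSet_singleton k), cellOf_preimage hδ,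
    Measure.volume_eq_prod, Measure.prod_prod, Real.volume_Ico, Real.volume_Ico, mul_comm]
  congr 1
  rw [← ENNReal.ofReal_mul (by linarith)]
  congr 1; ring

/-- the averaging operator over one dyadic piece -/
noncomputable def avg (φ : ℝ → ℝ) (f : ℝ × ℝ → ℝ) (σ : ℝ) (y : ℝ × ℝ) : ℝ≥0∞ :=
  ∫⁻ v in Icc (1 / 2 : ℝ) 1, ENNReal.ofReal (f (y.1 - v, y.2 - v ^ 2 * φ (σ * v)))

section
variable {r m M : ℝ} {φ A B B1 : ℝ → ℝ}

/-- points of the curve through `y` are close to corners of the discretised curve -/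
lemma PhiPack.close (h : PhiPack r m M φ A B B1) {δ : ℝ} (hδ : 0 < δ) (hδ1 : δ ≤ 1 / 16) (s : ℝ) (hs : 0 ≤ s ∧ s ≤ r / 2)
    (y : ℝ × ℝ) {v : ℝ} (hv : v ∈ Icc (1 / 2 : ℝ) 1) :
    dist ((y.1 - v, y.2 - v ^ 2 * φ (s * v)) : ℝ × ℝ) (δ * (⌊(y.1 - v) / δ⌋ : ℤ),
      δ * (rowOf δ (cH0 φ δ (fun _ => s)) (cellOf δ y) ⌊(y.1 - v) / δ⌋ : ℤ)) ≤ (2 + 8 * M) * δ := by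
  have hM := h.hM
  have f1 := floor_mem hδ (y.1 - v)
  set i := ⌊(y.1 - v) / δ⌋ with hi
  have f2 := floor_mem hδ y.1
  have f3 := floor_mem hδ y.2
  set u := δ * (cellOf δ y).1 - δ * i with hu
  have e1 : ((cellOf δ y).1 : ℤ) = ⌊y.1 / δ⌋ := rfl
  have e2 : ((cellOf δ y).2 : ℤ) = ⌊y.2 / δ⌋ := rfl
  rw [← e1] at f2
  rw [← e2] at f3
  have huv : |v - u| ≤ δ := abs_le.2 ⟨by rw [hu]; linarith, by rw [hu]; linarith⟩
  have huv' := abs_le.1 huv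
  have hH : rowOf δ (cH0 φ δ (fun _ => s)) (cellOf δ y) i = ⌊(δ * (cellOf δ y).2 - u ^ 2 * φ (s * u)) / δ⌋ := rfl
  rw [hH]
  have f4 := floor_mem hδ (δ * (cellOf δ y).2 - u ^ 2 * φ (s * u))
  set rr := ⌊(δ * (cellOf δ y).2 - u ^ 2 * φ (s * u)) / δ⌋ with hrr
  have hr1 := h.hr1
  have z1 : |s * v| ≤ r := by
    rw [abs_of_nonneg (mul_nonneg hs.1 (by linarith [hv.1]))]; nlinarith [hv.1, hv.2]
  have z2 : |s * u| ≤ r := by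
    rw [abs_of_nonneg (mul_nonneg hs.1 (by linarith [hv.1]))]; nlinarith [hv.1, hv.2]
  have hG := h.G_bound (u := v) (u' := u) ⟨by linarith [hv.1], by linarith [hv.2]⟩
    ⟨by linarith [hv.1], by linarith [hv.2]⟩ z1 z2
  have h5 : |s * v - s * u| ≤ δ := by
    rw [← mul_sub, abs_mul, abs_of_nonneg hs.1]
    nlinarith [abs_nonneg (v - u)]
  have hG2 : |v ^ 2 * φ (s * v) - u ^ 2 * φ (s * u)| ≤ 8 * M * δ := by
    have i1 := mul_le_mul_of_nonneg_left huv (by linarith : 0 ≤ 4 * M)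
    have i2 := mul_le_mul_of_nonneg_left h5 (by linarith : 0 ≤ 4 * M)
    linarith
  have hG3 := abs_le.1 hG2
  have hMδ : 0 < M * δ := by positivity
  rw [Prod.dist_eq]
  refine max_le ?_ ?_
  · rw [Real.dist_eq, abs_le]
    constructor <;> simp only <;> linarith
  · rw [Real.dist_eq, abs_le]
    constructor <;> simp only <;> linarith

lemma PhiPack.avg_le (h : PhiPack r m M φ A B B1) {L w : ℕ} (hL : 8 ≤ L) (hw : 1 ≤ w) {δ : ℝ}
    (hδe : δ = 1 / (2 * (w * L))) {f : ℝ × ℝ → ℝ}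
    {ω : ℝ} (hω : 0 < ω) (hf : ∀ P Q, dist P Q ≤ (2 + 8 * M) * δ → |f P - f Q| ≤ ω) (s : ℝ) (hs : 0 ≤ s ∧ s ≤ r / 2)
    (y : ℝ × ℝ) :
    avg φ f s y ≤ ENNReal.ofReal ω + ENNReal.ofReal (δ * ∑ i ∈ Finset.Icc ((cellOf δ y).1 - 2 * (w * L : ℕ))
      ((cellOf δ y).1 - (w * L : ℕ)), (fun k : ℤ × ℤ => max (f (δ * k.1, δ * k.2) - ω) 0)
        (i, rowOf δ (cH0 φ δ (fun _ => s)) (cellOf δ y) i)) := by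
  have hw1 : (1 : ℝ) ≤ w := by exact_mod_cast hw
  have hL8 : (8 : ℝ) ≤ L := by exact_mod_cast hL
  have hδ : 0 < δ := by rw [hδe]; positivity
  have hδ1 : δ ≤ 1 / 16 := by
    rw [hδe, div_le_div_iff₀ (by positivity) (by norm_num)]; nlinarith
  have hwL : δ * (w * L) = 1 / 2 := by rw [hδe]; field_simp
  set F : ℤ × ℤ → ℝ := fun k => max (f (δ * k.1, δ * k.2) - ω) 0 with hF
  set I := Finset.Icc ((cellOf δ y).1 - 2 * (w * L : ℕ)) ((cellOf δ y).1 - (w * L : ℕ)) with hI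
  set R : ℤ → ℤ := rowOf δ (cH0 φ δ (fun _ => s)) (cellOf δ y) with hR
  set S : ℤ → Set ℝ := fun i => Ioc (y.1 - δ * i - δ) (y.1 - δ * i) with hS
  have hF0 : ∀ k, 0 ≤ F k := fun k => le_max_right _ _
  have hpt : ∀ v ∈ Icc (1 / 2 : ℝ) 1, ENNReal.ofReal (f (y.1 - v, y.2 - v ^ 2 * φ (s * v))) ≤
      ENNReal.ofReal (2 * ω) + ∑ i ∈ I, (S i).indicator (fun _ => ENNReal.ofReal (F (i, R i))) v := by
    intro v hv
    have h1 := hf _ _ (h.close hδ hδ1 s hs y hv)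
    have f1 := floor_mem hδ (y.1 - v)
    have f2 := floor_mem hδ y.1
    set i := ⌊(y.1 - v) / δ⌋ with hi
    have e1 : ((cellOf δ y).1 : ℤ) = ⌊y.1 / δ⌋ := rfl
    have hiI : i ∈ I := by
      rw [hI, Finset.mem_Icc, e1]
      have a1 : ((⌊y.1 / δ⌋ - 2 * (w * L : ℕ) : ℤ) : ℝ) < i + 1 := by
        push_cast
        refine lt_of_mul_lt_mul_left ?_ hδ.le
        nlinarith [hv.2]
      have a2 : (i : ℝ) < ((⌊y.1 / δ⌋ - (w * L : ℕ) : ℤ) : ℝ) + 1 := by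
        push_cast
        refine lt_of_mul_lt_mul_left ?_ hδ.le
        nlinarith [hv.1]
      exact ⟨Int.lt_add_one_iff.1 (by exact_mod_cast a1), Int.lt_add_one_iff.1 (by exact_mod_cast a2)⟩
    have hvS : v ∈ S i := ⟨by linarith, by linarith⟩
    have h2 : ENNReal.ofReal (F (i, R i)) ≤ ∑ i ∈ I, (S i).indicator (fun _ => ENNReal.ofReal (F (i, R i))) v := by
      have := Finset.single_le_sum (f := fun i => (S i).indicator (fun _ => ENNReal.ofReal (F (i, R i))) v)
        (fun _ _ => zero_le) hiI
      simp only [indicator_of_mem hvS] at this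
      exact this
    refine le_trans ?_ (add_le_add le_rfl h2)
    rw [← ENNReal.ofReal_add (by linarith) (hF0 _)]
    apply ENNReal.ofReal_le_ofReal
    have h3 : f (δ * i, δ * (R i : ℤ)) - ω ≤ F (i, R i) := le_max_left _ _
    have h4 := (abs_le.1 h1).2
    linarith
  have hmeas : ∀ i ∈ I, Measurable ((S i).indicator (fun _ : ℝ => ENNReal.ofReal (F (i, R i)))) :=
    fun i _ => measurable_const.indicator measurableSet_Ioc
  calc avg φ f s y ≤ ∫⁻ v in Icc (1 / 2 : ℝ) 1, (ENNReal.ofReal (2 * ω) +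
        ∑ i ∈ I, (S i).indicator (fun _ => ENNReal.ofReal (F (i, R i))) v) :=
        setLIntegral_mono' measurableSet_Icc hpt
    _ = (∫⁻ v in Icc (1 / 2 : ℝ) 1, ENNReal.ofReal (2 * ω)) + ∫⁻ v in Icc (1 / 2 : ℝ) 1,
        ∑ i ∈ I, (S i).indicator (fun _ => ENNReal.ofReal (F (i, R i))) v := lintegral_add_left measurable_const _
    _ ≤ ENNReal.ofReal ω + ∫⁻ v, ∑ i ∈ I, (S i).indicator (fun _ => ENNReal.ofReal (F (i, R i))) v := by
        refine add_le_add ?_ (setLIntegral_le_lintegral _ _)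
        rw [setLIntegral_const, Real.volume_Icc, ← ENNReal.ofReal_mul (by linarith)]
        apply ENNReal.ofReal_le_ofReal
        linarith
    _ = ENNReal.ofReal ω + ∑ i ∈ I, ENNReal.ofReal (F (i, R i)) * ENNReal.ofReal δ := by
        rw [lintegral_finsetSum _ hmeas]
        congr 1
        refine Finset.sum_congr rfl fun i _ => ?_
        rw [lintegral_indicator_const measurableSet_Ioc, Real.volume_Ioc]
        congr 2; ring
    _ = _ := by
        rw [← Finset.sum_mul, ← ENNReal.ofReal_sum_of_nonneg (fun i _ => hF0 _),
          ← ENNReal.ofReal_mul (Finset.sum_nonneg fun i _ => hF0 _), mul_comm]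
end

section
variable {r m M : ℝ} {φ A B B1 : ℝ → ℝ}

lemma grid_mass {δ ω p : ℝ} (hδ : 0 < δ) (hp : 0 < p) {f : ℝ × ℝ → ℝ} (hf0 : ∀ P, 0 ≤ f P)
    (hf : ∀ P Q, dist P Q ≤ δ → |f P - f Q| ≤ ω) (U : Finset (ℤ × ℤ)) :
    ENNReal.ofReal (δ ^ 2 * ∑ k ∈ U, (max (f (δ * k.1, δ * k.2) - ω) 0) ^ p) ≤
      ∫⁻ y, ENNReal.ofReal (f y) ^ p := by
  set F : ℤ × ℤ → ℝ := fun k => max (f (δ * k.1, δ * k.2) - ω) 0 with hF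
  have hF0 : ∀ k, 0 ≤ F k := fun k => le_max_right _ _
  have h1 : ∫⁻ y : ℝ × ℝ, ENNReal.ofReal (F (cellOf δ y)) ^ p ≤ ∫⁻ y, ENNReal.ofReal (f y) ^ p := by
    refine lintegral_mono fun y => ?_
    refine ENNReal.rpow_le_rpow (ENNReal.ofReal_le_ofReal ?_) hp.le
    refine max_le ?_ (hf0 y)
    have f1 := floor_mem hδ y.1
    have f2 := floor_mem hδ y.2
    have := hf (δ * (cellOf δ y).1, δ * (cellOf δ y).2) y (by
      rw [Prod.dist_eq]
      refine max_le ?_ ?_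
      · rw [Real.dist_eq, abs_le]; simp only [cellOf]; constructor <;> linarith
      · rw [Real.dist_eq, abs_le]; simp only [cellOf]; constructor <;> linarith)
    linarith [(abs_le.1 this).2]
  rw [cell_lintegral hδ (fun k => ENNReal.ofReal (F k) ^ p)] at h1
  refine le_trans ?_ h1
  rw [ENNReal.ofReal_mul (by positivity)]
  gcongr
  rw [ENNReal.ofReal_sum_of_nonneg (fun k _ => Real.rpow_nonneg (hF0 k) p)]
  refine le_trans (Finset.sum_le_sum fun k _ => ?_) (ENNReal.sum_le_tsum U)
  rw [ENNReal.ofReal_rpow_of_nonneg (hF0 k) hp.le]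

lemma grid_finite {δ ω : ℝ} (hδ : 0 < δ) (hω : 0 < ω) {f : ℝ × ℝ → ℝ} (hf : HasCompactSupport f) :
    ∃ U : Finset (ℤ × ℤ), ∀ k, k ∉ U → max (f (δ * k.1, δ * k.2) - ω) 0 = 0 := by
  obtain ⟨R, hR⟩ := hf.isCompact.isBounded.subset_closedBall (0 : ℝ × ℝ)
  refine ⟨Finset.Icc (-⌈R / δ⌉) ⌈R / δ⌉ ×ˢ Finset.Icc (-⌈R / δ⌉) ⌈R / δ⌉, fun k hk => ?_⟩
  by_contra hne
  have h0 : f (δ * k.1, δ * k.2) ≠ 0 := by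
    intro h0
    apply hne
    rw [h0]
    exact max_eq_right (by linarith)
  have h1 := hR (subset_tsupport f h0)
  rw [mem_closedBall_zero_iff, Prod.norm_def, max_le_iff, Real.norm_eq_abs, Real.norm_eq_abs] at h1
  have key : ∀ n : ℤ, |δ * n| ≤ R → n ∈ Finset.Icc (-⌈R / δ⌉) ⌈R / δ⌉ := by
    intro n hn
    rw [abs_le] at hn
    have hc := Int.le_ceil (R / δ)
    rw [div_le_iff₀ hδ] at hc
    rw [Finset.mem_Icc]
    constructor
    · have : ((-⌈R / δ⌉ : ℤ) : ℝ) ≤ n := by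
        push_cast
        refine le_of_mul_le_mul_left ?_ hδ
        linarith
      exact_mod_cast this
    · have : (n : ℝ) ≤ ⌈R / δ⌉ := by
        refine le_of_mul_le_mul_left ?_ hδ
        linarith
      exact_mod_cast this
  exact hk (Finset.mem_product.2 ⟨key _ h1.1, key _ h1.2⟩)

lemma PhiPack.N_step (h : PhiPack r m M φ A B B1) {α p : ℝ} (hα : 1 / 2 < α) (hα1 : α ≤ 1) (hp : 3 - α < p) :
    ∃ C > 0, ∀ f : ℝ × ℝ → ℝ, Continuous f → HasCompactSupport f → (∀ P, 0 ≤ f P) → ∀ ω > 0,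
      ∃ T : ℝ × ℝ → ℝ≥0∞, Measurable T ∧
        (∀ s, 0 ≤ s ∧ s ≤ r / 2 → ∀ y, avg φ f s y ≤ ENNReal.ofReal ω + T y) ∧
        ∫⁻ y, T y ^ (p / α) ≤ ENNReal.ofReal C * (∫⁻ y, ENNReal.ofReal (f y) ^ p) ^ (1 / α) := by
  obtain ⟨C0, hC0, L, hL, hfam⟩ := h.stripFam
  obtain ⟨C, hC, hdisc⟩ := discrete_bound hC0 hα hα1 hp L hL
  have hα0 : 0 < α := by linarith
  have hp0 : 0 < p := by linarith
  have hq0 : 0 < p / α := by positivity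
  have hM := h.hM
  have hr := h.hr
  refine ⟨2 ^ (p / α) * C, by positivity, ?_⟩
  intro f hfc hfs hf0 ω hω
  have huc := hfs.uniformContinuous_of_continuous hfc
  obtain ⟨ρ, hρ, hfρ⟩ := Metric.uniformContinuous_iff.1 huc ω hω
  have hL8 : (8 : ℝ) ≤ L := by exact_mod_cast hL
  obtain ⟨w, hw⟩ := exists_nat_gt ((2 + 8 * M) / ρ)
  have hwpos : (0 : ℝ) < w := lt_trans (by positivity) hw
  have hw1 : 1 ≤ w := by exact_mod_cast hwpos
  obtain ⟨δ, hδe⟩ : ∃ δ : ℝ, δ = 1 / (2 * (w * L)) := ⟨_, rfl⟩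
  have hδ : 0 < δ := by rw [hδe]; positivity
  have hδρ : (2 + 8 * M) * δ < ρ := by
    rw [div_lt_iff₀ hρ] at hw
    rw [hδe, mul_one_div, div_lt_iff₀ (by positivity)]
    have : w * ρ ≤ ρ * (2 * (w * L)) := by nlinarith [mul_pos hwpos hρ]
    linarith
  have hf : ∀ P Q, dist P Q ≤ (2 + 8 * M) * δ → |f P - f Q| ≤ ω := fun P Q hPQ => by
    have := hfρ (hPQ.trans_lt hδρ)
    rw [Real.dist_eq] at this
    exact this.le
  have hf1 : ∀ P Q, dist P Q ≤ δ → |f P - f Q| ≤ ω := fun P Q hPQ => hf P Q (hPQ.trans (by nlinarith))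
  obtain ⟨U, hU⟩ := grid_finite hδ hω hfs
  set F : ℤ × ℤ → ℝ := fun k => max (f (δ * k.1, δ * k.2) - ω) 0 with hF
  have hF0 : ∀ k, 0 ≤ F k := fun k => le_max_right _ _
  set I : ℤ × ℤ → Finset ℤ := fun k => Finset.Icc (k.1 - 2 * (w * L : ℕ)) (k.1 - (w * L : ℕ)) with hI
  set a : ℤ × ℤ → ℝ → ℝ := fun k s => δ * ∑ i ∈ I k, F (i, rowOf δ (cH0 φ δ (fun _ => s)) k i) with ha
  set S : ℤ × ℤ → ℝ≥0∞ := fun k => ⨆ s : Icc (0 : ℝ) (r / 2), ENNReal.ofReal (a k s) with hS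
  have ha0 : ∀ k s, 0 ≤ a k s := fun k s => mul_nonneg hδ.le (Finset.sum_nonneg fun i _ => hF0 _)
  have hFb : ∀ k, F k ≤ ∑ x ∈ U, F x := by
    intro k
    by_cases hk : k ∈ U
    · exact Finset.single_le_sum (f := F) (fun x _ => hF0 x) hk
    · have : F k = 0 := hU k hk
      rw [this]; exact Finset.sum_nonneg fun x _ => hF0 x
  have hSfin : ∀ k, S k ≠ ⊤ := by
    intro k
    refine ne_top_of_le_ne_top (b := ENNReal.ofReal (δ * ∑ i ∈ I k, ∑ x ∈ U, F x)) ENNReal.ofReal_ne_top ?_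
    refine iSup_le fun s => ENNReal.ofReal_le_ofReal ?_
    exact mul_le_mul_of_nonneg_left (Finset.sum_le_sum fun i _ => hFb _) hδ.le
  have h0mem : (0 : ℝ) ∈ Icc (0 : ℝ) (r / 2) := ⟨le_rfl, by positivity⟩
  have hsel : ∀ k, ∃ s : Icc (0 : ℝ) (r / 2), S k ≤ 2 * ENNReal.ofReal (a k s) := by
    intro k
    by_cases h0 : S k = 0
    · exact ⟨⟨0, h0mem⟩, by rw [h0]; exact zero_le⟩
    · have hlt : S k / 2 < S k := ENNReal.half_lt_self h0 (hSfin k)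
      obtain ⟨s, hs⟩ := lt_iSup_iff.1 hlt
      refine ⟨s, ?_⟩
      have := ENNReal.div_le_iff (by norm_num) (by norm_num) |>.1 hs.le
      rwa [mul_comm]
  choose σ hσ using hsel
  refine ⟨fun y => S (cellOf δ y), (measurable_of_countable S).comp (measurable_cellOf δ), ?_, ?_⟩
  · intro s hs y
    refine (h.avg_le hL hw1 hδe hω hf s hs y).trans ?_
    gcongr
    exact le_iSup (fun s : Icc (0 : ℝ) (r / 2) => ENNReal.ofReal (a (cellOf δ y) s)) ⟨s, hs⟩
  · rw [cell_lintegral hδ (fun k => S k ^ (p / α)), ← ENNReal.tsum_mul_left, ENNReal.tsum_eq_iSup_sum]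
    refine iSup_le fun Y => ?_
    have hd := hdisc δ w Y (cH0 φ δ (fun k => σ k)) _ _ hw1 hδe
      (hfam w δ Y (fun k => σ k) hw1 hδe (fun k => (σ k).2)) F U hF0 hU
    have hd' : ∑ k ∈ Y, δ ^ 2 * a k (σ k) ^ (p / α) ≤ C * (δ ^ 2 * ∑ x ∈ U, F x ^ p) ^ (1 / α) := hd
    have hmass := grid_mass hδ hp0 hf0 hf1 U
    calc ∑ k ∈ Y, ENNReal.ofReal (δ ^ 2) * S k ^ (p / α)
        ≤ ∑ k ∈ Y, ENNReal.ofReal (2 ^ (p / α)) * ENNReal.ofReal (δ ^ 2 * a k (σ k) ^ (p / α)) := by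
          refine Finset.sum_le_sum fun k _ => ?_
          have h1 : S k ^ (p / α) ≤ (2 * ENNReal.ofReal (a k (σ k))) ^ (p / α) :=
            ENNReal.rpow_le_rpow (hσ k) hq0.le
          have h2 : (2 * ENNReal.ofReal (a k (σ k))) ^ (p / α) = ENNReal.ofReal (2 ^ (p / α) * a k (σ k) ^ (p / α)) := by
            rw [← Real.mul_rpow (by norm_num) (ha0 _ _), ← ENNReal.ofReal_rpow_of_nonneg
              (mul_nonneg (by norm_num) (ha0 _ _)) hq0.le, ENNReal.ofReal_mul (p := 2) (by norm_num)]
            rw [show ENNReal.ofReal 2 = 2 by norm_num]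
          calc _ ≤ ENNReal.ofReal (δ ^ 2) * ENNReal.ofReal (2 ^ (p / α) * a k (σ k) ^ (p / α)) := by
                rw [← h2]; gcongr
            _ = _ := by
                rw [← ENNReal.ofReal_mul (by positivity), ← ENNReal.ofReal_mul (by positivity)]
                congr 1; ring
      _ = ENNReal.ofReal (2 ^ (p / α)) * ENNReal.ofReal (∑ k ∈ Y, δ ^ 2 * a k (σ k) ^ (p / α)) := by
          rw [← Finset.mul_sum, ENNReal.ofReal_sum_of_nonneg]
          intro k _
          exact mul_nonneg (by positivity) (Real.rpow_nonneg (ha0 _ _) _)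
      _ ≤ ENNReal.ofReal (2 ^ (p / α)) * ENNReal.ofReal (C * (δ ^ 2 * ∑ x ∈ U, F x ^ p) ^ (1 / α)) := by
          gcongr
      _ = ENNReal.ofReal (2 ^ (p / α) * C) * (ENNReal.ofReal (δ ^ 2 * ∑ x ∈ U, F x ^ p)) ^ (1 / α) := by
          rw [ENNReal.ofReal_mul hC.le, ENNReal.ofReal_mul (by positivity), mul_assoc,
            ENNReal.ofReal_rpow_of_nonneg (mul_nonneg (by positivity)
              (Finset.sum_nonneg fun x _ => Real.rpow_nonneg (hF0 x) p)) (by positivity)]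
      _ ≤ _ := by
          gcongr

lemma PhiPack.N_bound (h : PhiPack r m M φ A B B1) {α p : ℝ} (hα : 1 / 2 < α) (hα1 : α ≤ 1) (hp : 3 - α < p) :
    ∃ C > 0, ∀ f : ℝ × ℝ → ℝ, Continuous f → HasCompactSupport f → (∀ P, 0 ≤ f P) →
      ∃ V : ℝ × ℝ → ℝ≥0∞, Measurable V ∧
        (∀ s, 0 ≤ s ∧ s ≤ r / 2 → ∀ y, avg φ f s y ≤ V y) ∧
        ∫⁻ y, V y ^ (p / α) ≤ ENNReal.ofReal C * (∫⁻ y, ENNReal.ofReal (f y) ^ p) ^ (1 / α) := by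
  obtain ⟨C, hC, hstep⟩ := h.N_step hα hα1 hp
  refine ⟨C, hC, fun f hfc hfs hf0 => ?_⟩
  have hq0 : 0 < p / α := div_pos (by linarith) (by linarith)
  choose T hTm hTa hTi using fun n : ℕ => hstep f hfc hfs hf0 (1 / ((n : ℝ) + 1)) (by positivity)
  refine ⟨fun y => Filter.liminf (fun n => T n y) Filter.atTop, Measurable.liminf hTm, ?_, ?_⟩
  · intro s hs y
    have hlim : Filter.Tendsto (fun n : ℕ => avg φ f s y - ENNReal.ofReal (1 / ((n : ℝ) + 1))) Filter.atTop
        (nhds (avg φ f s y)) := by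
      have h1 : Filter.Tendsto (fun n : ℕ => ENNReal.ofReal (1 / ((n : ℝ) + 1))) Filter.atTop (nhds 0) := by
        have := (ENNReal.continuous_ofReal.tendsto 0).comp tendsto_one_div_add_atTop_nhds_zero_nat
        rw [ENNReal.ofReal_zero] at this
        exact this
      have h2 := ENNReal.Tendsto.sub (tendsto_const_nhds (x := avg φ f s y)) h1 (Or.inr (by norm_num))
      simpa using h2
    rw [← hlim.liminf_eq]
    refine Filter.liminf_le_liminf (Filter.Eventually.of_forall fun n => ?_)
    exact tsub_le_iff_left.2 (hTa n s hs y)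
  · have h1 : ∀ y, (Filter.liminf (fun n => T n y) Filter.atTop) ^ (p / α) =
        Filter.liminf (fun n => T n y ^ (p / α)) Filter.atTop := by
      intro y
      have := (ENNReal.orderIsoRpow (p / α) hq0).liminf_apply (f := Filter.atTop) (u := fun n => T n y)
      simpa using this
    simp only [h1]
    refine (lintegral_liminf_le fun n => (hTm n).pow_const _).trans ?_
    exact Filter.liminf_le_of_le (by isBoundedDefault) fun b hb => by
      obtain ⟨n, hn⟩ := hb.exists
      exact hn.trans (hTi n)
end

/-- linear change of variables in one dimension, no measurability needed -/
lemma lint_scale1 {c : ℝ} (hc : 0 < c) (F : ℝ → ℝ≥0∞) :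
    ∫⁻ x, F x = ENNReal.ofReal c * ∫⁻ x, F (c * x) := by
  have h1 := Real.smul_map_volume_mul_left hc.ne'
  have h2 : ∫⁻ x, F x ∂(Measure.map (fun x => c * x) volume) = ∫⁻ x, F (c * x) :=
    lintegral_map_equiv F (Homeomorph.mulLeft₀ c hc.ne').toMeasurableEquiv
  conv_lhs => rw [← h1]
  rw [lintegral_smul_measure, abs_of_pos hc]
  erw [h2]
  rfl

lemma lint_scale2 {c d : ℝ} (hc : 0 < c) (hd : 0 < d) {F : ℝ × ℝ → ℝ≥0∞} (hF : Measurable F) :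
    ∫⁻ y : ℝ × ℝ, F y = ENNReal.ofReal (c * d) * ∫⁻ y : ℝ × ℝ, F (c * y.1, d * y.2) := by
  rw [Measure.volume_eq_prod, lintegral_prod _ hF.aemeasurable, lintegral_prod _ (by fun_prop)]
  rw [lint_scale1 hc, ENNReal.ofReal_mul hc.le, mul_assoc]
  congr 1
  rw [← lintegral_const_mul' _ _ ENNReal.ofReal_ne_top]
  refine lintegral_congr fun x => ?_
  exact lint_scale1 hd fun y => F (c * x, y)

/-- dyadic decomposition of an integral near zero -/
lemma lint_dyadic {c : ℝ} (hc : 0 < c) (F : ℝ → ℝ≥0∞) :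
    ∫⁻ x in Ioc 0 c, F x ≤ ∑' n : ℕ, ENNReal.ofReal (c * (1 / 2) ^ n) *
      ∫⁻ v in Icc (1 / 2 : ℝ) 1, F (c * (1 / 2) ^ n * v) := by
  have hsub : Ioc 0 c ⊆ ⋃ n : ℕ, Ioc (c * (1 / 2) ^ n / 2) (c * (1 / 2) ^ n) := by
    intro x hx
    obtain ⟨n, hn1, hn2⟩ := exists_nat_pow_near_of_lt_one (x := x / c) (y := (1 / 2 : ℝ))
      (div_pos hx.1 hc) ((div_le_one hc).2 hx.2) (by norm_num) (by norm_num)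
    rw [lt_div_iff₀ hc] at hn1
    rw [div_le_iff₀ hc] at hn2
    refine mem_iUnion.2 ⟨n, ?_, ?_⟩
    · rw [pow_succ] at hn1; linarith
    · linarith
  refine (lintegral_mono_set hsub).trans ((lintegral_iUnion_le _ _).trans ?_)
  refine ENNReal.tsum_le_tsum fun n => ?_
  have hl : 0 < c * (1 / 2 : ℝ) ^ n := by positivity
  set l := c * (1 / 2 : ℝ) ^ n
  rw [← lintegral_indicator measurableSet_Ioc, ← lintegral_indicator measurableSet_Icc, lint_scale1 hl]
  gcongr with v
  by_cases hv : l * v ∈ Ioc (l / 2) l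
  · have hv' : v ∈ Icc (1 / 2 : ℝ) 1 := by
      constructor
      · by_contra hh
        push Not at hh
        have := hv.1
        nlinarith
      · by_contra hh
        push Not at hh
        have := hv.2
        nlinarith
    rw [indicator_of_mem hv, indicator_of_mem hv']
  · rw [indicator_of_notMem hv]
    exact zero_le

/-- Minkowski's inequality for countable sums -/
lemma lint_minkowski {q : ℝ} (hq : 1 ≤ q) {F : ℕ → ℝ × ℝ → ℝ≥0∞} (hF : ∀ n, Measurable (F n)) :
    (∫⁻ y, (∑' n, F n y) ^ q) ^ (1 / q) ≤ ∑' n, (∫⁻ y, F n y ^ q) ^ (1 / q) := by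
  have hq0 : 0 < q := by linarith
  have hfin : ∀ N : ℕ, (∫⁻ y, (∑ n ∈ Finset.range N, F n y) ^ q) ^ (1 / q) ≤
      ∑ n ∈ Finset.range N, (∫⁻ y, F n y ^ q) ^ (1 / q) := by
    intro N
    induction N with
    | zero => simp [hq0, ENNReal.zero_rpow_of_pos]
    | succ N ih =>
      rw [Finset.sum_range_succ]
      simp only [Finset.sum_range_succ]
      refine (ENNReal.lintegral_Lp_add_le (f := fun y => ∑ n ∈ Finset.range N, F n y) (g := F N)
        (Finset.measurable_fun_sum _ fun n _ => hF n).aemeasurable (hF N).aemeasurable hq).trans ?_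
      gcongr
  have hmono : Monotone fun (N : ℕ) y => (∑ n ∈ Finset.range N, F n y) ^ q := by
    intro N N' hN y
    exact ENNReal.rpow_le_rpow (Finset.sum_le_sum_of_subset (Finset.range_mono hN)) hq0.le
  have hlim : ∀ y, (∑' n, F n y) ^ q = ⨆ N : ℕ, (∑ n ∈ Finset.range N, F n y) ^ q := by
    intro y
    rw [ENNReal.tsum_eq_iSup_nat]
    exact (ENNReal.orderIsoRpow q hq0).map_iSup _
  simp only [hlim]
  rw [lintegral_iSup (fun N => (Finset.measurable_fun_sum _ fun n _ => hF n).pow_const q) hmono]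
  rw [show ∀ u : ℕ → ℝ≥0∞, (⨆ N, u N) ^ (1 / q) = ⨆ N, (u N) ^ (1 / q) from
    fun u => (ENNReal.orderIsoRpow (1 / q) (by positivity)).map_iSup _]
  refine iSup_le fun N => (hfin N).trans ?_
  exact ENNReal.sum_le_tsum _

section
variable {r m M : ℝ} {φ A B B1 : ℝ → ℝ}

set_option maxHeartbeats 1000000 in
lemma PhiPack.half (h : PhiPack r m M φ A B B1) {p q : ℝ} (hp : 1 < p) (hq : 1 < q)
    (hpq₁ : 1 / (2 * p) < 1 / q) (hpq₂ : 1 / q ≤ 1 / p) (hpq₃ : 3 / p - 1 < 1 / q) :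
    ∃ C > 0, ∀ g : ℝ × ℝ → ℝ, Continuous g → HasCompactSupport g → (∀ P, 0 ≤ g P) →
      ∃ W : ℝ × ℝ → ℝ≥0∞, Measurable W ∧
        (∀ t, 1 ≤ t ∧ t ≤ 2 → ∀ y : ℝ × ℝ, ∫⁻ x in Ioc 0 (r / 4),
          ENNReal.ofReal (g (y.1 - t * x, y.2 - t ^ 2 * x ^ 2 * φ x)) ≤ W y) ∧
        (∫⁻ y, W y ^ q) ^ (1 / q) ≤ ENNReal.ofReal C * (∫⁻ y, ENNReal.ofReal (g y) ^ p) ^ (1 / p) := by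
  have hp0 : 0 < p := by linarith
  have hq0 : 0 < q := by linarith
  have hr := h.hr
  have hα : 1 / 2 < p / q := by
    rw [div_lt_div_iff₀ (by positivity) hq0] at hpq₁
    rw [div_lt_div_iff₀ (by norm_num) hq0]; linarith
  have hα1 : p / q ≤ 1 := by
    rw [div_le_div_iff₀ hq0 hp0] at hpq₂
    rw [div_le_one hq0]; linarith
  have hp3 : 3 - p / q < p := by
    have := mul_lt_mul_of_pos_left hpq₃ hp0
    have e1 : p * (3 / p - 1) = 3 - p := by field_simp
    have e2 : p * (1 / q) = p / q := by ring
    rw [e1, e2] at this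
    linarith
  obtain ⟨C, hC, hN⟩ := h.N_bound hα hα1 hp3
  have eq1 : p / (p / q) = q := by field_simp
  have eq2 : 1 / (p / q) = q / p := by field_simp
  rw [eq1, eq2] at hN
  set κ : ℝ := 1 + 3 / q - 3 / p with hκ
  have hκ0 : 0 < κ := by
    have : 0 < 1 / q := by positivity
    have e : 3 / q = 3 * (1 / q) := by ring
    rw [hκ, e]; linarith
  set ρ : ℝ := (1 / 2 : ℝ) ^ κ with hρ
  have hρ0 : 0 < ρ := by positivity
  have hρ1 : ρ < 1 := Real.rpow_lt_one (by norm_num) (by norm_num) hκ0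
  set K : ℝ := C ^ (1 / q) * (r / 2) ^ κ with hK
  have hK0 : 0 < K := by positivity
  refine ⟨K * (1 - ρ)⁻¹, mul_pos hK0 (inv_pos.2 (by linarith)), fun g hgc hgs hg0 => ?_⟩
  obtain ⟨l, hl⟩ : ∃ l : ℕ → ℝ, l = fun n => r / 2 * (1 / 2) ^ n := ⟨_, rfl⟩
  have hl0 : ∀ n, 0 < l n := fun n => by simp only [hl]; positivity
  have hlr : ∀ n, l n ≤ r / 2 := fun n => by
    have : (1 / 2 : ℝ) ^ n ≤ 1 := pow_le_one₀ (by norm_num) (by norm_num)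
    simp only [hl]; nlinarith
  have hgl : ∀ n, ∃ V : ℝ × ℝ → ℝ≥0∞, Measurable V ∧
        (∀ s, 0 ≤ s ∧ s ≤ r / 2 → ∀ y, avg φ (fun Y => g (l n * Y.1, l n ^ 2 * Y.2)) s y ≤ V y) ∧
        ∫⁻ y, V y ^ q ≤ ENNReal.ofReal C *
          (∫⁻ y : ℝ × ℝ, ENNReal.ofReal (g (l n * y.1, l n ^ 2 * y.2)) ^ p) ^ (q / p) := by
    intro n
    refine hN _ (by fun_prop) ?_ (fun P => hg0 _)
    exact hgs.comp_homeomorph ((Homeomorph.mulLeft₀ (l n) (hl0 n).ne').prodCongr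
      (Homeomorph.mulLeft₀ (l n ^ 2) (pow_pos (hl0 n) 2).ne'))
  choose V hVm hVa hVi using hgl
  set F : ℕ → ℝ × ℝ → ℝ≥0∞ := fun n y => ENNReal.ofReal (l n) * V n (y.1 / l n, y.2 / l n ^ 2) with hF
  have hFm : ∀ n, Measurable (F n) := fun n => by
    have := hVm n
    simp only [hF]; fun_prop
  refine ⟨fun y => ∑' n, F n y, Measurable.tsum hFm, ?_, ?_⟩
  · intro t ht y
    have ht0 : 0 < t := by linarith
    have hsub : Ioc 0 (r / 4) ⊆ Ioc 0 (r / 2 / t) := Ioc_subset_Ioc_right (by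
      rw [le_div_iff₀ ht0]; nlinarith)
    refine (lintegral_mono_set hsub).trans ((lint_dyadic (by positivity) _).trans ?_)
    refine ENNReal.tsum_le_tsum fun n => ?_
    have e : r / 2 / t * (1 / 2) ^ n = l n / t := by simp only [hl]; ring
    rw [e]
    have hln := hl0 n
    have hlt : l n / t ≤ l n := div_le_self hln.le ht.1
    simp only [hF]
    refine mul_le_mul' (ENNReal.ofReal_le_ofReal hlt) ?_
    refine le_trans (le_of_eq ?_) (hVa n (l n / t) ⟨by positivity, hlt.trans (hlr n)⟩ _)
    unfold avg
    refine lintegral_congr fun v => ?_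
    congr 2
    ext
    · simp only; field_simp
    · simp only; field_simp
  · refine (lint_minkowski hq.le hFm).trans ?_
    set G := (∫⁻ y, ENNReal.ofReal (g y) ^ p) with hG
    have hpiece : ∀ n, (∫⁻ y, F n y ^ q) ^ (1 / q) ≤ ENNReal.ofReal (K * ρ ^ n) * G ^ (1 / p) := by
      intro n
      have hln := hl0 n
      have i1 : ∫⁻ y, F n y ^ q = ENNReal.ofReal (l n ^ 3) * (ENNReal.ofReal (l n) ^ q * ∫⁻ y, V n y ^ q) := by
        rw [lint_scale2 hln (pow_pos hln 2) ((hFm n).pow_const q)]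
        congr 1
        · congr 1; ring
        · rw [← lintegral_const_mul _ ((hVm n).pow_const q)]
          refine lintegral_congr fun y => ?_
          simp only [hF]
          rw [ENNReal.mul_rpow_of_nonneg _ _ hq0.le]
          congr 3
          ext
          · simp only; field_simp
          · simp only; field_simp
      have i2 : G = ENNReal.ofReal (l n ^ 3) *
          ∫⁻ y : ℝ × ℝ, ENNReal.ofReal (g (l n * y.1, l n ^ 2 * y.2)) ^ p := by
        rw [hG, lint_scale2 hln (pow_pos hln 2) (by fun_prop)]
        congr 2; ring
      have i3 : ∫⁻ y : ℝ × ℝ, ENNReal.ofReal (g (l n * y.1, l n ^ 2 * y.2)) ^ p =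
          ENNReal.ofReal ((l n ^ 3)⁻¹) * G := by
        rw [i2, ← mul_assoc, ← ENNReal.ofReal_mul (by positivity), inv_mul_cancel₀ (by positivity)]
        simp
      have i4 := hVi n
      rw [i3] at i4
      rw [i1]
      have hq1 : 0 ≤ 1 / q := by positivity
      calc _ ≤ (ENNReal.ofReal (l n ^ 3) * (ENNReal.ofReal (l n) ^ q *
              (ENNReal.ofReal C * (ENNReal.ofReal ((l n ^ 3)⁻¹) * G) ^ (q / p)))) ^ (1 / q) := by
            gcongr
        _ = ENNReal.ofReal ((l n ^ 3) ^ (1 / q) * (l n * (C ^ (1 / q) * ((l n ^ 3)⁻¹) ^ (1 / p)))) *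
              G ^ (1 / p) := by
            have e5 : q / p * (1 / q) = 1 / p := by field_simp
            have e6 : q * (1 / q) = 1 := by field_simp
            rw [ENNReal.mul_rpow_of_nonneg _ _ hq1, ENNReal.mul_rpow_of_nonneg _ _ hq1,
              ENNReal.mul_rpow_of_nonneg _ _ hq1, ← ENNReal.rpow_mul, ← ENNReal.rpow_mul, e5, e6,
              ENNReal.rpow_one, ENNReal.mul_rpow_of_nonneg _ _ (by positivity : 0 ≤ 1 / p),
              ENNReal.ofReal_mul (by positivity), ENNReal.ofReal_mul (by positivity),
              ENNReal.ofReal_mul (by positivity),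
              ENNReal.ofReal_rpow_of_nonneg (by positivity) hq1,
              ENNReal.ofReal_rpow_of_nonneg (by positivity) hq1,
              ENNReal.ofReal_rpow_of_nonneg (by positivity) (by positivity : 0 ≤ 1 / p)]
            ring
        _ = _ := by
            congr 2
            have e7 : (l n ^ 3) ^ (1 / q) = l n ^ (3 / q) := by
              rw [← Real.rpow_natCast, ← Real.rpow_mul hln.le]; congr 1; push_cast; ring
            have e8 : ((l n ^ 3)⁻¹) ^ (1 / p) = l n ^ (-(3 / p)) := by
              rw [← Real.rpow_natCast, ← Real.rpow_neg hln.le, ← Real.rpow_mul hln.le]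
              congr 1; push_cast; ring
            have e9 : l n ^ κ = l n ^ (3 / q) * l n * l n ^ (-(3 / p)) := by
              nth_rewrite 3 [← Real.rpow_one (l n)]
              rw [← Real.rpow_add hln, ← Real.rpow_add hln]
              congr 1; rw [hκ]; ring
            have e10 : l n ^ κ = (r / 2) ^ κ * ρ ^ n := by
              rw [hρ, ← Real.rpow_natCast, ← Real.rpow_mul (by norm_num), mul_comm κ,
                Real.rpow_mul (by norm_num), Real.rpow_natCast, ← Real.mul_rpow (by positivity) (by positivity), hl]
            rw [e7, e8, hK, mul_assoc (C ^ (1 / q)), ← e10, e9]; ring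
    calc _ ≤ ∑' n, ENNReal.ofReal (K * ρ ^ n) * G ^ (1 / p) := ENNReal.tsum_le_tsum hpiece
      _ = _ := by
        rw [ENNReal.tsum_mul_right, ← ENNReal.ofReal_tsum_of_nonneg (fun n => by positivity)
          ((summable_geometric_of_lt_one hρ0.le hρ1).mul_left K), tsum_mul_left,
          tsum_geometric_of_lt_one hρ0.le hρ1]

end

lemma lint_reflect2 {F : ℝ × ℝ → ℝ≥0∞} (hF : Measurable F) :
    ∫⁻ y : ℝ × ℝ, F (-y.1, y.2) = ∫⁻ y, F y := by
  rw [Measure.volume_eq_prod, lintegral_prod _ hF.aemeasurable, lintegral_prod _ (by fun_prop)]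
  exact lintegral_neg_eq_self (fun x : ℝ => ∫⁻ y, F (x, y))

lemma lint_reflect1 (F : ℝ → ℝ≥0∞) (e : ℝ) :
    ∫⁻ x in Icc (-e) 0, F x = ∫⁻ x in Ioc 0 e, F (-x) := by
  rw [restrict_Ioc_eq_restrict_Icc, ← lintegral_indicator measurableSet_Icc, ← lintegral_indicator measurableSet_Icc,
    ← lintegral_neg_eq_self]
  refine lintegral_congr fun x => ?_
  by_cases hx : x ∈ Icc 0 e
  · rw [indicator_of_mem hx, indicator_of_mem]
    exact ⟨by linarith [hx.2], by linarith [hx.1]⟩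
  · rw [indicator_of_notMem hx, indicator_of_notMem]
    exact fun hh => hx ⟨by linarith [hh.2], by linarith [hh.1]⟩

lemma max_pointwise {φ η : ℝ → ℝ} {f : ℝ × ℝ → ℝ} {e E : ℝ} (he : tsupport η ⊆ Icc (-e) e) (he0 : 0 < e)
    (hE : ∀ x, ‖η x‖ ≤ E) {y : ℝ × ℝ} {w : ℝ≥0∞}
    (hw : ∀ t, 1 ≤ t ∧ t ≤ 2 → ∫⁻ x in Icc (-e) e,
      ENNReal.ofReal |f (y.1 - t * x, y.2 - t ^ 2 * x ^ 2 * φ x)| ≤ w) :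
    ‖maxOpCurve φ η f y‖ₑ ≤ ENNReal.ofReal E * w := by
  have hone : ∀ t, 1 ≤ t ∧ t ≤ 2 →
      ENNReal.ofReal |∫ x : ℝ, f (y.1 - t * x, y.2 - t ^ 2 * x ^ 2 * φ x) * η x| ≤ ENNReal.ofReal E * w := by
    intro t ht
    rw [← Real.norm_eq_abs, ofReal_norm]
    refine (enorm_integral_le_lintegral_enorm _).trans ?_
    refine le_trans ?_ (mul_le_mul' le_rfl (hw t ht))
    rw [← lintegral_indicator measurableSet_Icc, ← lintegral_const_mul' _ _ ENNReal.ofReal_ne_top]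
    refine lintegral_mono fun x => ?_
    by_cases hx : x ∈ Icc (-e) e
    · rw [indicator_of_mem hx, enorm_mul, mul_comm, ← Real.norm_eq_abs, ofReal_norm]
      gcongr
      rw [← ofReal_norm]
      exact ENNReal.ofReal_le_ofReal (hE x)
    · have : η x = 0 := by
        by_contra hh
        exact hx (he (subset_tsupport _ hh))
      simp [this]
  by_cases htop : ENNReal.ofReal E * w = ∞
  · rw [htop]; exact le_top
  have h0 : 0 ≤ maxOpCurve φ η f y := Real.iSup_nonneg fun t => abs_nonneg _
  rw [← ofReal_norm, Real.norm_of_nonneg h0, ENNReal.ofReal_le_iff_le_toReal htop]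
  haveI : Nonempty (Icc (1 : ℝ) 2) := ⟨⟨1, by norm_num⟩⟩
  refine ciSup_le fun t => ?_
  exact (ENNReal.ofReal_le_iff_le_toReal htop).1 (hone t t.2)

theorem maximal_curve_Lp_Lq
    (p q : ℝ) (hp : 1 < p) (hq : 1 < q)
    (hpq₁ : 1 / (2 * p) < 1 / q) (hpq₂ : 1 / q ≤ 1 / p) (hpq₃ : 3 / p - 1 < 1 / q)
    (a b : ℝ) (ha : a < 0) (hb : 0 < b)
    (φ : ℝ → ℝ) (hφ : ContDiffOn ℝ (⊤ : ℕ∞) φ (Set.Ioo a b))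
    (hφ0 : φ 0 ≠ 0) (hφ' : deriv φ 0 ≠ 0) :
    ∃ ε₀ > 0, ∀ η : ℝ → ℝ, ContDiff ℝ (⊤ : ℕ∞) η → HasCompactSupport η →
      tsupport η ⊆ Set.Icc (-ε₀) ε₀ →
      ∃ C > 0, ∀ f : ℝ × ℝ → ℝ, ContDiff ℝ (⊤ : ℕ∞) f → HasCompactSupport f →
        eLpNorm (maxOpCurve φ η f) (ENNReal.ofReal q) volume ≤
          ENNReal.ofReal C * eLpNorm f (ENNReal.ofReal p) volume := by
  have hp0 : 0 < p := by linarith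
  have hq0 : 0 < q := by linarith
  obtain ⟨r, m, M, A, B, B1, -, hP⟩ := exists_pack ha hb hφ hφ0 hφ'
  obtain ⟨r', m', M', A', B', B1', -, hP'⟩ := exists_pack (a := -b) (b := -a) (φ := fun x => φ (-x))
    (by linarith) (by linarith)
    (hφ.comp contDiff_neg.contDiffOn (fun x hx => ⟨by linarith [hx.2], by linarith [hx.1]⟩))
    (by simpa using hφ0) (by
      rw [deriv_comp_neg]; simpa using hφ')
  obtain ⟨C1, hC1, h1⟩ := hP.half hp hq hpq₁ hpq₂ hpq₃
  obtain ⟨C2, hC2, h2⟩ := hP'.half hp hq hpq₁ hpq₂ hpq₃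
  have hr := hP.hr
  have hr' := hP'.hr
  refine ⟨min r r' / 4, by positivity, fun η hη hηs hηt => ?_⟩
  set e := min r r' / 4 with he
  have he0 : 0 < e := by positivity
  have her : e ≤ r / 4 := by rw [he]; linarith [min_le_left r r']
  have her' : e ≤ r' / 4 := by rw [he]; linarith [min_le_right r r']
  obtain ⟨E0, hE0⟩ := hηs.exists_bound_of_continuous hη.continuous
  obtain ⟨E, hEpos, hE⟩ : ∃ E > 0, ∀ x, ‖η x‖ ≤ E :=
    ⟨max E0 1, by positivity, fun x => (hE0 x).trans (le_max_left _ _)⟩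
  refine ⟨E * (C1 + C2), by positivity, fun f hf hfs => ?_⟩
  have hfc := hf.continuous
  obtain ⟨W, hWm, hWa, hWi⟩ := h1 (fun y => |f y|) (by fun_prop)
    (hfs.comp_left (g := fun x : ℝ => |x|) (by simp)) (fun P => abs_nonneg _)
  obtain ⟨W', hWm', hWa', hWi'⟩ := h2 (fun y => |f (-y.1, y.2)|) (by fun_prop)
    ((hfs.comp_left (g := fun x : ℝ => |x|) (by simp)).comp_homeomorph
      ((Homeomorph.neg ℝ).prodCongr (Homeomorph.refl ℝ))) (fun P => abs_nonneg _)
  have hfp : ∫⁻ y : ℝ × ℝ, ENNReal.ofReal |f (-y.1, y.2)| ^ p = ∫⁻ y, ENNReal.ofReal |f y| ^ p :=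
    lint_reflect2 (F := fun y => ENNReal.ofReal |f y| ^ p) (by fun_prop)
  rw [hfp] at hWi'
  have hWp : ∫⁻ y : ℝ × ℝ, W' (-y.1, y.2) ^ q = ∫⁻ y, W' y ^ q :=
    lint_reflect2 (F := fun y => W' y ^ q) (by fun_prop)
  rw [← hWp] at hWi'
  have hpt : ∀ y, ‖maxOpCurve φ η f y‖ₑ ≤ ENNReal.ofReal E * (W y + W' (-y.1, y.2)) := by
    intro y
    refine max_pointwise hηt he0 hE fun t ht => ?_
    have hsub : Icc (-e) e ⊆ Ioc 0 e ∪ Icc (-e) 0 := by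
      intro x hx
      rcases lt_or_ge 0 x with h | h
      · exact Or.inl ⟨h, hx.2⟩
      · exact Or.inr ⟨hx.1, h⟩
    refine (lintegral_mono_set hsub).trans ((lintegral_union_le _ _ _).trans (add_le_add ?_ ?_))
    · exact (lintegral_mono_set (Ioc_subset_Ioc_right her)).trans (hWa t ht y)
    · rw [lint_reflect1]
      refine (lintegral_mono_set (Ioc_subset_Ioc_right her')).trans (le_trans (le_of_eq ?_) (hWa' t ht (-y.1, y.2)))
      refine lintegral_congr fun x => ?_
      congr 3
      ext
      · simp only; ring
      · simp only; ring
  have hq' : ENNReal.ofReal q ≠ 0 := by simpa using hq0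
  have hp' : ENNReal.ofReal p ≠ 0 := by simpa using hp0
  rw [eLpNorm_eq_lintegral_rpow_enorm_toReal hq' ENNReal.ofReal_ne_top,
    eLpNorm_eq_lintegral_rpow_enorm_toReal hp' ENNReal.ofReal_ne_top,
    ENNReal.toReal_ofReal hq0.le, ENNReal.toReal_ofReal hp0.le]
  have hfn : ∫⁻ y, ‖f y‖ₑ ^ p = ∫⁻ y, ENNReal.ofReal |f y| ^ p := by
    refine lintegral_congr fun y => ?_
    rw [← Real.norm_eq_abs, ofReal_norm]
  rw [hfn]
  have hWr : Measurable fun y : ℝ × ℝ => W' (-y.1, y.2) := by fun_prop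
  set G := (∫⁻ y, ENNReal.ofReal |f y| ^ p) ^ (1 / p)
  have hq1 : 0 ≤ 1 / q := by positivity
  calc (∫⁻ y, ‖maxOpCurve φ η f y‖ₑ ^ q) ^ (1 / q)
      ≤ (∫⁻ y, ENNReal.ofReal E ^ q * (W y + W' (-y.1, y.2)) ^ q) ^ (1 / q) := by
        refine ENNReal.rpow_le_rpow (lintegral_mono fun y => ?_) hq1
        rw [← ENNReal.mul_rpow_of_nonneg _ _ hq0.le]
        exact ENNReal.rpow_le_rpow (hpt y) hq0.le
    _ = ENNReal.ofReal E * (∫⁻ y, (W y + W' (-y.1, y.2)) ^ q) ^ (1 / q) := by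
        rw [lintegral_const_mul _ (by fun_prop), ENNReal.mul_rpow_of_nonneg _ _ hq1, ← ENNReal.rpow_mul,
          mul_one_div_cancel hq0.ne', ENNReal.rpow_one]
    _ ≤ ENNReal.ofReal E * (ENNReal.ofReal C1 * G + ENNReal.ofReal C2 * G) := by
        gcongr
        exact (ENNReal.lintegral_Lp_add_le hWm.aemeasurable hWr.aemeasurable hq.le).trans (add_le_add hWi hWi')
    _ = ENNReal.ofReal (E * (C1 + C2)) * G := by
        rw [ENNReal.ofReal_mul hEpos.le, ENNReal.ofReal_add hC1.le hC2.le]; ring
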